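/- arXiv:1511.07689 — 2 statements merged into one kernel-verified Lean document; each statement's English description precedes it below -/
import Mathlib

section
/- Let ℓ be a positive integer and let f, g ∈ ℂ(x) be rational functions with g non-constant. If N#(f ∘ g) ≤ ℓ, then either g(x) = λ(a·x^n + b·x^{−n}) for some Möbius transformation λ(w) = (αw + β)/(γw + δ) with α, β, γ, δ ∈ ℂ, αδ − βγ ≠ 0, some a, b ∈ ℂ and some natural number n, or deg(f) ≤ 2016 · 5^ℓ. -/
open Polynomial

/-- `N#(g)`: the minimal total number of nonzero terms over all representations
`g = p/q` with `p, q ∈ ℂ[x]`, `q ≠ 0` (not necessarily coprime). -/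
noncomputable def Nsharp (g : RatFunc ℂ) : ℕ :=
  sInf {n : ℕ | ∃ p q : Polynomial ℂ, q ≠ 0 ∧
    g = algebraMap (Polynomial ℂ) (RatFunc ℂ) p / algebraMap (Polynomial ℂ) (RatFunc ℂ) q ∧
    n = p.support.card + q.support.card}

/-- The degree of a rational function `f = p/q` with `p, q` coprime:
`max (deg p) (deg q)`. -/
noncomputable def ratDeg (f : RatFunc ℂ) : ℕ :=
  max f.num.natDegree f.denom.natDegree

/-- Composition `f ∘ g` of rational functions over `ℂ`. -/
noncomputable def ratComp (f g : RatFunc ℂ) : RatFunc ℂ :=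
  RatFunc.eval RatFunc.C g f

open WithZero

theorem exists_const_relation_of_wronskian {k L ι : Type*} [Field k] [Field L] [Algebra k L]
    [DecidableEq ι] (δ : Derivation k L L) (hδ : ∀ a, δ a = 0 → ∃ c : k, algebraMap k L c = a)
    (u : ι → L) (s : Finset ι) (a : ι → L) (ha : ∃ j ∈ s, a j ≠ 0)
    (h : ∀ i < s.card, ∑ j ∈ s, a j * δ^[i] (u j) = 0) :
    ∃ c : ι → k, (∃ j ∈ s, c j ≠ 0) ∧ ∑ j ∈ s, c j • u j = 0 := by
  induction hn : s.card generalizing s a with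
  | zero =>
    obtain ⟨j, hj, -⟩ := ha
    rw [Finset.card_eq_zero] at hn
    simp [hn] at hj
  | succ n ih =>
    obtain ⟨j₀, hj₀, ha₀⟩ := ha
    set b : ι → L := fun j => a j / a j₀ with hb
    have hb₀ : b j₀ = 1 := by simp [hb, ha₀]
    have hbs : ∀ i < s.card, ∑ j ∈ s, b j * δ^[i] (u j) = 0 := by
      intro i hi
      have := h i hi
      have h2 : ∑ j ∈ s, b j * δ^[i] (u j) = (∑ j ∈ s, a j * δ^[i] (u j)) / a j₀ := by
        rw [Finset.sum_div]
        exact Finset.sum_congr rfl fun j _ => by simp only [hb]; ring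
      rw [h2, this, zero_div]
    by_cases hd : ∃ j ∈ s.erase j₀, δ (b j) ≠ 0
    · have hcard : (s.erase j₀).card = n := by rw [Finset.card_erase_of_mem hj₀, hn]; simp
      obtain ⟨c, ⟨j, hj, hcj⟩, hc⟩ := ih (s.erase j₀) (fun j => δ (b j)) hd (by
        intro i hi
        rw [hcard] at hi
        have h1 := congrArg δ (hbs i (by omega))
        rw [map_sum, map_zero] at h1
        have h2 := hbs (i + 1) (by omega)
        have h3 : ∑ j ∈ s, δ (b j) * δ^[i] (u j) = 0 := by
          have : ∀ j, δ (b j) * δ^[i] (u j) =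
              δ (b j * δ^[i] (u j)) - b j * δ^[i + 1] (u j) := by
            intro j
            rw [Derivation.leibniz, Function.iterate_succ_apply', smul_eq_mul, smul_eq_mul]
            ring
          simp_rw [this]
          rw [Finset.sum_sub_distrib, h1, h2, sub_zero]
        rw [← Finset.add_sum_erase _ _ hj₀, hb₀] at h3
        simpa using h3) hcard
      refine ⟨Function.update c j₀ 0, ⟨j, Finset.mem_of_mem_erase hj, ?_⟩, ?_⟩
      · rwa [Function.update_of_ne (Finset.ne_of_mem_erase hj)]
      · rw [← Finset.add_sum_erase _ _ hj₀]
        simp only [Function.update_self, zero_smul, zero_add]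
        rw [← hc]
        exact Finset.sum_congr rfl fun j hj => by
          rw [Function.update_of_ne (Finset.ne_of_mem_erase hj)]
    · push Not at hd
      have hc : ∀ j, ∃ c : k, j ∈ s → algebraMap k L c = b j := by
        intro j
        by_cases hj : j ∈ s
        · by_cases hjj : j = j₀
          · exact ⟨1, fun _ => by rw [hjj, hb₀, map_one]⟩
          · obtain ⟨c, hc⟩ := hδ (b j) (hd j (Finset.mem_erase.2 ⟨hjj, hj⟩))
            exact ⟨c, fun _ => hc⟩
        · exact ⟨0, fun h => absurd h hj⟩
      choose c hc using hc
      refine ⟨c, ⟨j₀, hj₀, ?_⟩, ?_⟩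
      · intro h0
        have := hc j₀ hj₀
        rw [h0, map_zero, hb₀] at this
        exact zero_ne_one this
      · rw [← hbs 0 (by omega)]
        exact Finset.sum_congr rfl fun j hj => by
          rw [Algebra.smul_def, hc j hj, Function.iterate_zero, id]

theorem sum_filter_smul_eq_zero_of_minimal_close {k V ι : Type*} [Field k] [AddCommGroup V]
    [Module k V] [Fintype ι] [DecidableEq ι] (u : ι → V) (S : Finset ι)
    (hS : ∀ c : ι → k, ∑ i, c i • u i = 0 →
      (∀ c' : ι → k, c' ≠ 0 → ∑ i, c' i • u i = 0 → (∀ i, c i = 0 → c' i = 0) →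
        ∀ i, c' i = 0 → c i = 0) →
      ∀ i j, c i ≠ 0 → c j ≠ 0 → i ∈ S → j ∈ S)
    (c : ι → k) (hc : ∑ i, c i • u i = 0) : ∑ i ∈ S, c i • u i = 0 := by
  classical
  induction hn : (Finset.univ.filter (fun i => c i ≠ 0)).card using Nat.strong_induction_on
    generalizing c with
  | _ n ih =>
    by_cases hc0 : c = 0
    · simp [hc0]
    · have hex : ∃ N, ∃ m : ι → k, m ≠ 0 ∧ ∑ i, m i • u i = 0 ∧ (∀ i, c i = 0 → m i = 0) ∧
          (Finset.univ.filter (fun i => m i ≠ 0)).card = N := ⟨_, c, hc0, hc, fun _ h => h, rfl⟩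
      obtain ⟨m, hm0, hm, hmc, hmN⟩ := Nat.find_spec hex
      have hmin := fun N (hN : N < Nat.find hex) => Nat.find_min hex hN
      have hmS : ∀ i j, m i ≠ 0 → m j ≠ 0 → i ∈ S → j ∈ S := by
        refine hS m hm ?_
        intro c' hc' hrel hsub i hi
        by_contra hmi
        refine hmin _ ?_ ⟨c', hc', hrel, fun i hi => hsub i (hmc i hi), rfl⟩
        rw [← hmN]
        refine Finset.card_lt_card (Finset.ssubset_iff_subset_ne.2 ⟨?_, ?_⟩)
        · intro j hj
          simp only [Finset.mem_filter, Finset.mem_univ, true_and] at hj ⊢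
          exact fun h => hj (hsub j h)
        · intro h
          have : i ∈ Finset.univ.filter (fun i => m i ≠ 0) := by simp [hmi]
          rw [← h] at this
          simp [hi] at this
      have hmr : ∑ i ∈ S, m i • u i = 0 := by
        by_cases hex2 : ∃ i ∈ S, m i ≠ 0
        · obtain ⟨i, hi, hmi⟩ := hex2
          rw [← hm]
          refine Finset.sum_subset (Finset.subset_univ _) fun j _ hj => ?_
          by_cases hmj : m j = 0
          · rw [hmj, zero_smul]
          · exact absurd (hmS i j hmi hmj hi) hj
        · push Not at hex2
          exact Finset.sum_eq_zero fun i hi => by rw [hex2 i hi, zero_smul]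
      obtain ⟨i, hmi⟩ : ∃ i, m i ≠ 0 := by
        by_contra h
        push Not at h
        exact hm0 (funext h)
      set t := c i / m i with ht
      have key := ih _ ?_ (fun j => c j - t * m j) ?_ rfl
      · simp_rw [sub_smul, mul_smul] at key
        rw [Finset.sum_sub_distrib, ← Finset.smul_sum, hmr, smul_zero, sub_zero] at key
        exact key
      · rw [← hn]
        refine Finset.card_lt_card (Finset.ssubset_iff_subset_ne.2 ⟨?_, ?_⟩)
        · intro j hj
          simp only [Finset.mem_filter, Finset.mem_univ, true_and] at hj ⊢
          intro h
          exact hj (by rw [h, hmc j h]; simp)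
        · intro h
          have : i ∈ Finset.univ.filter (fun i => c i ≠ 0) := by
            simp only [Finset.mem_filter, Finset.mem_univ, true_and]
            exact fun h => hmi (hmc i h)
          rw [← h] at this
          simp only [Finset.mem_filter, Finset.mem_univ, true_and] at this
          exact this (by rw [ht]; field_simp; simp)
      · simp_rw [sub_smul, mul_smul]
        rw [Finset.sum_sub_distrib, ← Finset.smul_sum, hm, hc]; simp

theorem Submodule.pow_mono_of_one_mem {k L : Type*} [CommSemiring k] [CommSemiring L] [Algebra k L]
    {S : Submodule k L} (h1 : (1 : L) ∈ S) {m n : ℕ} (h : m ≤ n) : S ^ m ≤ S ^ n :=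
  pow_le_pow_right' (Submodule.one_le.2 h1) h

theorem Submodule.prod_mem_pow_card {k L ι : Type*} [CommSemiring k] [CommSemiring L] [Algebra k L]
    {P : Submodule k L} (s : Finset ι) (f : ι → L) (h : ∀ i ∈ s, f i ∈ P) :
    ∏ i ∈ s, f i ∈ P ^ s.card := by
  classical
  induction s using Finset.induction_on with
  | empty => simpa [Submodule.mem_one] using ⟨1, map_one _⟩
  | insert a s ha ih =>
    rw [Finset.prod_insert ha, Finset.card_insert_of_notMem ha, pow_succ']
    exact Submodule.mul_mem_mul (h a (Finset.mem_insert_self _ _))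
      (ih fun i hi => h i (Finset.mem_insert_of_mem hi))

theorem Matrix.det_mem_submodule_pow {k L n : Type*} [CommRing k] [CommRing L] [Algebra k L]
    [Fintype n] [DecidableEq n] {P : Submodule k L} (A : Matrix n n L) (h : ∀ i j, A i j ∈ P) :
    A.det ∈ P ^ Fintype.card n := by
  rw [Matrix.det_apply]
  refine Submodule.sum_mem _ fun σ _ => ?_
  have := Submodule.prod_mem_pow_card (Finset.univ : Finset n) (fun i => A (σ i) i)
    (fun i _ => h _ _)
  rcases Int.units_eq_one_or (Equiv.Perm.sign σ) with h | h
  · rw [h, one_smul]; exact this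
  · rw [h, Units.neg_smul, one_smul]; exact Submodule.neg_mem _ this

theorem Derivation.mem_pow_of_mem_pow {k L : Type*} [Field k] [Field L] [Algebra k L]
    (δ : Derivation k L L) {S : Submodule k L} {s : ℕ}
    (hS : ∀ a ∈ S, δ a ∈ S ^ (s + 1)) (m : ℕ) {a : L} (ha : a ∈ S ^ m) : δ a ∈ S ^ (m + s) := by
  induction m generalizing a with
  | zero =>
    rw [pow_zero, Submodule.mem_one] at ha
    obtain ⟨c, rfl⟩ := ha
    rw [Derivation.map_algebraMap]
    exact Submodule.zero_mem _
  | succ m ih =>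
    rw [pow_succ] at ha
    refine Submodule.mul_induction_on ha ?_ ?_
    · intro p hp q hq
      rw [Derivation.leibniz, smul_eq_mul, smul_eq_mul]
      refine Submodule.add_mem _ ?_ ?_
      · have := Submodule.mul_mem_mul hp (hS q hq)
        rwa [← pow_add, show m + (s + 1) = m + 1 + s by ring] at this
      · have := Submodule.mul_mem_mul hq (ih hp)
        rwa [← pow_succ', show m + s + 1 = m + 1 + s by ring] at this
    · intro p q hp hq
      rw [map_add]
      exact Submodule.add_mem _ hp hq

theorem exists_mul_eq_mul_of_minimal_relation {k L ι : Type*} [Field k] [Field L] [Algebra k L]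
    [Fintype ι] [DecidableEq ι]
    (δ : Derivation k L L) (hδ : ∀ a, δ a = 0 → ∃ c : k, algebraMap k L c = a)
    {S : Submodule k L} (h1 : (1 : L) ∈ S) {s : ℕ} (hS : ∀ a ∈ S, δ a ∈ S ^ (s + 1))
    (u η : ι → L) (hu : ∀ i, u i ≠ 0) (hη : ∀ i, η i ∈ S ^ s) (huη : ∀ i, δ (u i) = u i * η i)
    (c : ι → k) (hc : ∑ i, c i • u i = 0)
    (hmin : ∀ c' : ι → k, c' ≠ 0 → ∑ i, c' i • u i = 0 → (∀ i, c i = 0 → c' i = 0) →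
        ∀ i, c' i = 0 → c i = 0)
    (p q : ι) (hp : c p ≠ 0) (hq : c q ≠ 0) :
    ∃ a b : L, a ≠ 0 ∧ b ≠ 0 ∧ a ∈ S ^ (Fintype.card ι ^ 2 * s) ∧
      b ∈ S ^ (Fintype.card ι ^ 2 * s) ∧ u p * a = u q * b := by
  classical
  by_cases hpq : p = q
  · have : (1 : L) ∈ S ^ (Fintype.card ι ^ 2 * s) :=
      Submodule.one_le.1 (one_le_pow_of_one_le' (Submodule.one_le.2 h1) _)
    exact ⟨1, 1, one_ne_zero, one_ne_zero, this, this, by rw [hpq]⟩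
  have hE : ∀ i j, ∃ e, e ∈ S ^ (i * s) ∧ δ^[i] (u j) = u j * e := by
    intro i j
    induction i with
    | zero => exact ⟨1, by simp [Submodule.mem_one], by simp⟩
    | succ i ih =>
      obtain ⟨e, he, h⟩ := ih
      refine ⟨η j * e + δ e, Submodule.add_mem _ ?_ ?_, ?_⟩
      · have := Submodule.mul_mem_mul (hη j) he
        rwa [← pow_add, show s + i * s = (i + 1) * s by ring] at this
      · have := δ.mem_pow_of_mem_pow hS _ he
        rwa [show i * s + s = (i + 1) * s by ring] at this
      · rw [Function.iterate_succ_apply', h, Derivation.leibniz, huη, smul_eq_mul, smul_eq_mul]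
        ring
  choose E hES hEu using hE
  set t : Finset ι := (Finset.univ.filter fun i => c i ≠ 0).erase p with ht
  have hqt : q ∈ t := by simp [ht, hq, Ne.symm hpq]
  obtain ⟨n, hn⟩ : ∃ n, t.card = n := ⟨_, rfl⟩
  have hncard : n ≤ Fintype.card ι := hn ▸ Finset.card_le_univ t
  let e : Fin n ≃ t := (t.equivFinOfCardEq hn).symm
  let A : Matrix (Fin n) (Fin n) L := Matrix.of fun i j => E i (e j)
  have hsum : ∀ f : ι → L, ∑ j : Fin n, f (e j) = ∑ j ∈ t, f j := by
    intro f
    rw [← Finset.sum_coe_sort t f]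
    exact Equiv.sum_comp e (fun j : t => f j)
  have hdet : A.det ≠ 0 := by
    intro h0
    obtain ⟨w, hw, hAw⟩ := Matrix.exists_mulVec_eq_zero_iff.2 h0
    obtain ⟨j, hj⟩ := Function.ne_iff.1 hw
    let a : ι → L := fun i => if h : i ∈ t then w (e.symm ⟨i, h⟩) / u i else 0
    have hae : ∀ j, a (e j) = w j / u (e j) := by
      intro j
      simp [a]
    obtain ⟨c', ⟨i, hi, hci⟩, hc'⟩ := exists_const_relation_of_wronskian δ hδ u t a
      ⟨e j, (e j).2, by rw [hae]; exact div_ne_zero hj (hu _)⟩ (by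
        intro i hi
        rw [hn] at hi
        have := congrFun hAw ⟨i, hi⟩
        rw [← hsum (fun j => a j * δ^[i] (u j)),
          ← Pi.zero_apply (M := fun _ => L) (⟨i, hi⟩ : Fin n),
          ← this]
        refine Finset.sum_congr rfl fun j _ => ?_
        rw [hae, hEu]
        simp only [A, Matrix.of_apply]
        have := hu (e j)
        field_simp)
    let c'' : ι → k := fun i => if i ∈ t then c' i else 0
    refine hp (hmin c'' (Function.ne_iff.2 ⟨i, by simp [c'', hi, hci]⟩) ?_ ?_ p (by simp [c'', ht]))
    · simp only [c'', ite_smul, zero_smul]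
      rw [Finset.sum_ite_mem, Finset.univ_inter, hc']
    · intro i hi
      simp [c'', ht, hi]
  let b : Fin n → L := fun i => E i p
  have hmul : A.mulVec (fun j => c (e j) • u (e j)) = (-(c p • u p)) • b := by
    ext i
    have h0 : ∑ j, c j • δ^[i] (u j) = 0 := by
      have : ∀ (m : ℕ) (f : ι → L), δ^[m] (∑ j, c j • f j) = ∑ j, c j • δ^[m] (f j) := by
        intro m
        induction m with
        | zero => simp
        | succ m ih =>
          intro f
          simp only [Function.iterate_succ_apply, map_sum, Derivation.map_smul]
          exact ih _
      rw [← this, hc]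
      clear this
      generalize (i : ℕ) = m
      induction m with
      | zero => rfl
      | succ m ih => rw [Function.iterate_succ_apply, map_zero, ih]
    have h1 : ∑ j, c j • δ^[i] (u j) = c p • δ^[i] (u p) + ∑ j ∈ t, c j • δ^[i] (u j) := by
      rw [ht, Finset.add_sum_erase _ (fun j => c j • δ^[i] (u j)) (by simp [hp])]
      symm
      refine Finset.sum_subset (Finset.subset_univ _) fun j _ hj => ?_
      have : c j = 0 := by simpa using hj
      rw [this, zero_smul]
    rw [h0] at h1
    simp only [Matrix.mulVec, dotProduct, A, b, Matrix.of_apply, Pi.smul_apply, smul_eq_mul]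
    rw [hsum (fun j => E i j * (c j • u j))]
    have h2 : ∑ j ∈ t, c j • δ^[i] (u j) = ∑ j ∈ t, E i j * (c j • u j) :=
      Finset.sum_congr rfl fun j _ => by rw [hEu, Algebra.smul_def, Algebra.smul_def]; ring
    rw [← h2, hEu, Algebra.smul_def] at *
    linear_combination (-1 : L) * h1
  have hcr := congrArg (Matrix.cramer A) hmul
  rw [Matrix.cramer_eq_adjugate_mulVec, Matrix.mulVec_mulVec, Matrix.adjugate_mul, map_smul,
    Matrix.smul_mulVec, Matrix.one_mulVec] at hcr
  have hcr' := congrFun hcr (e.symm ⟨q, hqt⟩)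
  simp only [Pi.smul_apply, smul_eq_mul, Equiv.apply_symm_apply, Matrix.cramer_apply] at hcr'
  set Δ := (A.updateCol (e.symm ⟨q, hqt⟩) b).det with hΔ
  have hmemA : ∀ B : Matrix (Fin n) (Fin n) L, (∀ i j, ∃ l, B i j = E i l) →
      B.det ∈ S ^ (Fintype.card ι ^ 2 * s) := by
    intro B hB
    have h2 : B.det ∈ (S ^ (n * s)) ^ Fintype.card (Fin n) := by
      refine B.det_mem_submodule_pow fun i j => ?_
      obtain ⟨l, hl⟩ := hB i j
      rw [hl]
      exact Submodule.pow_mono_of_one_mem h1 (Nat.mul_le_mul_right _ i.2.le) (hES _ _)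
    rw [← pow_mul, Fintype.card_fin] at h2
    refine Submodule.pow_mono_of_one_mem h1 ?_ h2
    calc n * s * n = n ^ 2 * s := by ring
      _ ≤ _ := Nat.mul_le_mul_right _ (Nat.pow_le_pow_left hncard 2)
  have hΔmem : Δ ∈ S ^ (Fintype.card ι ^ 2 * s) := by
    refine hmemA _ fun i j => ?_
    by_cases hj : j = e.symm ⟨q, hqt⟩
    · exact ⟨p, by rw [hj]; simp [b]⟩
    · exact ⟨e j, by rw [Matrix.updateCol_ne hj]; rfl⟩
  have hAmem : A.det ∈ S ^ (Fintype.card ι ^ 2 * s) := hmemA _ fun i j => ⟨e j, rfl⟩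
  have hΔ0 : Δ ≠ 0 := by
    intro h0
    rw [h0, mul_zero, Algebra.smul_def] at hcr'
    exact mul_ne_zero hdet (mul_ne_zero (by simpa using hq) (hu q)) hcr'
  refine ⟨(-c p) • Δ, c q • A.det, smul_ne_zero (neg_ne_zero.2 hp) hΔ0, smul_ne_zero hq hdet,
    Submodule.smul_mem _ _ hΔmem, Submodule.smul_mem _ _ hAmem, ?_⟩
  rw [Algebra.smul_def, Algebra.smul_def] at *
  rw [map_neg]
  linear_combination -hcr'

theorem Derivation.eq_zero_of_isAlgebraic {k L : Type*} [Field k] [Field L] [Algebra k L]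
    [CharZero k]
    (D : Derivation k L L) {a : L} (ha : D a = 0) {x : L}
    (hx : IsAlgebraic (IntermediateField.adjoin k {a}) x) : D x = 0 := by
  have hF : ∀ b ∈ IntermediateField.adjoin k {a}, D b = 0 := by
    intro b hb
    induction hb using IntermediateField.adjoin_induction with
    | mem x hx => rw [Set.mem_singleton_iff.1 hx, ha]
    | algebraMap x => exact D.map_algebraMap x
    | add x y _ _ hx hy => rw [map_add, hx, hy, add_zero]
    | inv x _ hx => rw [Derivation.leibniz_inv, hx, smul_zero]
    | mul x y _ _ hx hy => rw [Derivation.leibniz, hx, hy, smul_zero, smul_zero, add_zero]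
  set F := IntermediateField.adjoin k {a}
  have hint : IsIntegral F x := hx.isIntegral
  have : CharZero F := charZero_of_injective_algebraMap (algebraMap k F).injective
  have key : ∀ p : F[X], D (aeval x p) = aeval x (derivative p) * D x := by
    intro p
    induction p using Polynomial.induction_on' with
    | add p q hp hq => simp only [map_add, hp, hq, add_mul]
    | monomial n b =>
      have h1 : D (algebraMap F L b) = 0 := hF _ b.2
      rw [aeval_monomial, Derivation.leibniz, h1, smul_zero, add_zero, Derivation.leibniz_pow,
        derivative_monomial, aeval_monomial]
      have h2 : algebraMap F L (n : F) = (n : L) := by simp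
      simp only [smul_eq_mul, nsmul_eq_mul, map_mul, h2]
      ring
  have h0 := key (minpoly F x)
  rw [minpoly.aeval, map_zero] at h0
  refine (mul_eq_zero.1 h0.symm).resolve_left fun h => ?_
  exact (minpoly.irreducible hint).separable.aeval_derivative_ne_zero (minpoly.aeval F x) h

theorem Derivation.exists_algebraMap_eq_of_eq_zero {k L : Type*} [Field k] [IsAlgClosed k]
    [CharZero k] [Field L] [Algebra k L] [Algebra (RatFunc k) L] [IsScalarTower k (RatFunc k) L]
    [FiniteDimensional (RatFunc k) L] (D : Derivation k L L) {x : L} (hDx : D x ≠ 0)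
    {a : L} (ha : D a = 0) : ∃ c : k, algebraMap k L c = a := by
  by_cases hat : Transcendental k a
  · exfalso
    let : Algebra k[X] L :=
      ((algebraMap (RatFunc k) L).comp (algebraMap k[X] (RatFunc k))).toAlgebra
    have : IsScalarTower k[X] (RatFunc k) L := IsScalarTower.of_algebraMap_eq fun _ => rfl
    have : IsScalarTower k k[X] L := IsScalarTower.of_algebraMap_eq fun c => by
      rw [IsScalarTower.algebraMap_apply k (RatFunc k) L,
        IsScalarTower.algebraMap_apply k k[X] (RatFunc k),
        IsScalarTower.algebraMap_apply k[X] (RatFunc k) L]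
    have : Algebra.IsAlgebraic k[X] L :=
      (IsFractionRing.comap_isAlgebraic_iff (A := k[X]) (K := RatFunc k) (C := L)).2 inferInstance
    have : FaithfulSMul k[X] L := (faithfulSMul_iff_algebraMap_injective _ _).2 (by
      rw [IsScalarTower.algebraMap_eq k[X] (RatFunc k) L]
      exact (algebraMap (RatFunc k) L).injective.comp (RatFunc.algebraMap_injective k))
    have htr : Algebra.trdeg k L ≤ 1 := by
      have h := lift_trdeg_add_eq k k[X] L
      rw [trdeg_eq_zero (R := k[X]) (A := L),
        Polynomial.trdeg_of_isDomain] at h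
      simp at h
      exact h.symm.le
    have hind : AlgebraicIndependent k (fun _ : PUnit.{1} => a) :=
      algebraicIndependent_unique_type_iff.2 hat
    have hb := hind.isTranscendenceBasis_of_lift_trdeg_le_of_finite (by simpa using htr)
    have halg := hb.isAlgebraic_field
    rw [Set.range_const] at halg
    exact hDx (D.eq_zero_of_isAlgebraic ha (halg.isAlgebraic x))
  · have hint : IsIntegral k a := IsAlgebraic.isIntegral (not_not.1 hat)
    have hd := IsAlgClosed.degree_eq_one_of_irreducible k (minpoly.irreducible hint)
    obtain ⟨c, hc⟩ := minpoly.degree_eq_one_iff.1 hd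
    exact ⟨c, hc⟩

theorem exists_derivation_eq_one {k L : Type*} [Field k] [CharZero k] [Field L] [Algebra k L]
    [Algebra (RatFunc k) L] [IsScalarTower k (RatFunc k) L] [FiniteDimensional (RatFunc k) L] :
    ∃ D : Derivation k L L, D (algebraMap (RatFunc k) L RatFunc.X) = 1 := by
  have : CharZero (RatFunc k) := charZero_of_injective_algebraMap (algebraMap k _).injective
  let : Algebra k[X] L := ((algebraMap (RatFunc k) L).comp (algebraMap k[X] (RatFunc k))).toAlgebra
  have : IsScalarTower k[X] (RatFunc k) L := IsScalarTower.of_algebraMap_eq fun _ => rfl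
  have : IsScalarTower k k[X] L := IsScalarTower.of_algebraMap_eq fun c => by
    rw [IsScalarTower.algebraMap_apply k (RatFunc k) L,
      IsScalarTower.algebraMap_apply k k[X] (RatFunc k),
      IsScalarTower.algebraMap_apply k[X] (RatFunc k) L]
  have : Algebra.FormallyEtale k[X] (RatFunc k) :=
    Algebra.FormallyEtale.of_isLocalization (nonZeroDivisors k[X])
  have : Algebra.FormallyEtale (RatFunc k) L := Algebra.FormallyEtale.of_isSeparable _ _
  have : Algebra.FormallyEtale k[X] L := Algebra.FormallyEtale.comp k[X] (RatFunc k) L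
  let d : Derivation k k[X] L :=
    Polynomial.mkDerivation k (1 : L)
  let e := KaehlerDifferential.tensorKaehlerEquivOfFormallyEtale k k[X] L
  let φ : TensorProduct k[X] L (KaehlerDifferential k k[X]) →ₗ[L] L :=
    d.liftKaehlerDifferential.liftBaseChange L
  refine ⟨(φ.comp e.symm.toLinearMap).compDer (KaehlerDifferential.D k L), ?_⟩
  have h1 : algebraMap (RatFunc k) L RatFunc.X = algebraMap k[X] L X := by
    rw [IsScalarTower.algebraMap_apply k[X] (RatFunc k) L, RatFunc.algebraMap_X]
  rw [h1]
  change φ (e.symm (KaehlerDifferential.D k L (algebraMap k[X] L X))) = 1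
  rw [KaehlerDifferential.tensorKaehlerEquivOfFormallyEtale_symm_D_algebraMap]
  simp [φ, d]

theorem exists_valuation_X_lt_one {k L : Type*} [Field k] [CharZero k] [Field L]
    (i : RatFunc k →+* L) (hi : i.Finite) :
    ∃ v : Valuation L ℤᵐ⁰, v (i RatFunc.X) < 1 ∧ ∀ c : k, c ≠ 0 → v (i (RatFunc.C c)) = 1 := by
  let : Algebra (RatFunc k) L := i.toAlgebra
  have : FiniteDimensional (RatFunc k) L := hi
  change ∃ v : Valuation L ℤᵐ⁰, v (algebraMap (RatFunc k) L RatFunc.X) < 1 ∧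
      ∀ c : k, c ≠ 0 → v (algebraMap (RatFunc k) L (RatFunc.C c)) = 1
  have : CharZero (RatFunc k) := charZero_of_injective_algebraMap (algebraMap k _).injective
  let : Algebra k[X] L := ((algebraMap (RatFunc k) L).comp (algebraMap k[X] (RatFunc k))).toAlgebra
  have : IsScalarTower k[X] (RatFunc k) L := IsScalarTower.of_algebraMap_eq fun _ => rfl
  let A := integralClosure k[X] L
  have : IsDedekindDomain A := integralClosure.isDedekindDomain k[X] (RatFunc k) L
  have : IsFractionRing A L := integralClosure.isFractionRing_of_finite_extension (RatFunc k) L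
  have hinj : Function.Injective (algebraMap k[X] L) := by
    rw [IsScalarTower.algebraMap_eq k[X] (RatFunc k) L]
    exact (algebraMap (RatFunc k) L).injective.comp (RatFunc.algebraMap_injective k)
  have hinjA : Function.Injective (algebraMap k[X] A) := by
    intro a b h
    exact hinj (congrArg Subtype.val h)
  have hmax : (Ideal.span {(X : k[X])}).IsMaximal :=
    PrincipalIdealRing.isMaximal_of_irreducible irreducible_X
  obtain ⟨Q, hQ, hQc⟩ := Ideal.exists_ideal_over_maximal_of_isIntegral (R := k[X]) (S := A)
    (Ideal.span {(X : k[X])}) (by rw [(RingHom.injective_iff_ker_eq_bot _).1 hinjA]; exact bot_le)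
  have hXQ : algebraMap k[X] A X ∈ Q := by
    rw [← Ideal.mem_comap, hQc]
    exact Ideal.mem_span_singleton_self _
  let P : IsDedekindDomain.HeightOneSpectrum A :=
    ⟨Q, hQ.isPrime, fun h => by
      rw [h, Ideal.mem_bot] at hXQ
      exact X_ne_zero (hinjA (hXQ.trans (map_zero _).symm))⟩
  refine ⟨P.valuation L, ?_, ?_⟩
  · have : algebraMap (RatFunc k) L RatFunc.X = algebraMap A L (algebraMap k[X] A X) := by
      rw [← RatFunc.algebraMap_X]; rfl
    rw [this]
    exact (P.valuation_lt_one_iff_mem (K := L) _).2 hXQ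
  · intro c hc
    have hle : ∀ c : k, P.valuation L (algebraMap (RatFunc k) L (RatFunc.C c)) ≤ 1 := by
      intro c
      have : algebraMap (RatFunc k) L (RatFunc.C c) = algebraMap A L (algebraMap k[X] A (C c)) := by
        rw [← RatFunc.algebraMap_C]; rfl
      rw [this]
      exact P.valuation_le_one _
    refine le_antisymm (hle c) ?_
    have h1 := hle c⁻¹
    have h2 : P.valuation L (algebraMap (RatFunc k) L (RatFunc.C c)) *
        P.valuation L (algebraMap (RatFunc k) L (RatFunc.C c⁻¹)) = 1 := by
      rw [← map_mul, ← map_mul, ← map_mul, mul_inv_cancel₀ hc, map_one, map_one, map_one]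
    rw [← h2]
    exact mul_le_of_le_one_right' h1

namespace RatFunc

variable {k : Type*} [Field k]

theorem algHom_algebraMap {L : Type*} [Field L] [Algebra k L] (φ : RatFunc k →ₐ[k] L) (p : k[X]) :
    φ (algebraMap k[X] (RatFunc k) p) = aeval (φ X) p := by
  rw [aeval_algHom_apply, aeval_X_left_eq_algebraMap]

theorem algHom_eq {L : Type*} [Field L] [Algebra k L] (φ : RatFunc k →ₐ[k] L) (f : RatFunc k) :
    φ f = aeval (φ X) f.num / aeval (φ X) f.denom := by
  conv_lhs => rw [← num_div_denom f]
  rw [map_div₀, algHom_algebraMap, algHom_algebraMap]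

theorem algHom_ext_of_X {L : Type*} [Field L] [Algebra k L] {φ ψ : RatFunc k →ₐ[k] L}
    (h : φ X = ψ X) : φ = ψ := by
  ext f
  rw [algHom_eq φ, algHom_eq ψ, h]

/-- Substitution of a transcendental element for the variable of a rational function. -/
noncomputable def substHom {L : Type*} [Field L] [Algebra k L] (g : L) (hg : Transcendental k g) :
    RatFunc k →ₐ[k] L :=
  RatFunc.liftAlgHom (aeval g)
    (nonZeroDivisors_le_comap_nonZeroDivisors_of_injective (aeval g)
      (transcendental_iff_injective.1 hg))

theorem substHom_algebraMap {L : Type*} [Field L] [Algebra k L] (g : L) (hg : Transcendental k g)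
    (p : k[X]) : substHom g hg (algebraMap k[X] (RatFunc k) p) = aeval g p := by
  have := liftAlgHom_apply_div (aeval g) (nonZeroDivisors_le_comap_nonZeroDivisors_of_injective
    (aeval g) (transcendental_iff_injective.1 hg)) p 1
  simp only [map_one, div_one] at this
  exact this

theorem substHom_X {L : Type*} [Field L] [Algebra k L] (g : L) (hg : Transcendental k g) :
    substHom g hg (X : RatFunc k) = g := by
  rw [← algebraMap_X, substHom_algebraMap, aeval_X]

theorem substHom_eq {L : Type*} [Field L] [Algebra k L] (g : L) (hg : Transcendental k g)
    (f : RatFunc k) : substHom g hg f = aeval g f.num / aeval g f.denom := by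
  rw [algHom_eq, substHom_X]

theorem transcendental_X_inv : Transcendental k (X⁻¹ : RatFunc k) := by
  intro h
  exact transcendental_X (by simpa using h.inv)

theorem substHom_X_inv_involutive (f : RatFunc k) :
    substHom X⁻¹ transcendental_X_inv (substHom X⁻¹ transcendental_X_inv f) = f := by
  have : ((substHom X⁻¹ (transcendental_X_inv (k := k))).comp
      (substHom X⁻¹ (transcendental_X_inv (k := k)))) = AlgHom.id k (RatFunc k) := by
    refine algHom_ext_of_X ?_
    rw [AlgHom.comp_apply, substHom_X, map_inv₀, substHom_X, inv_inv, AlgHom.id_apply]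
  exact DFunLike.congr_fun this f

end RatFunc

theorem exists_valuation_one_lt_X {k L : Type*} [Field k] [CharZero k] [Field L]
    (i : RatFunc k →+* L) (hi : i.Finite) :
    ∃ v : Valuation L ℤᵐ⁰, 1 < v (i RatFunc.X) ∧ ∀ c : k, c ≠ 0 → v (i (RatFunc.C c)) = 1 := by
  set φ := RatFunc.substHom _ (RatFunc.transcendental_X_inv (k := k)) with hφ
  obtain ⟨v, hv, hvc⟩ := exists_valuation_X_lt_one (i.comp φ.toRingHom)
    (hi.comp (RingHom.Finite.of_surjective _
      fun f => ⟨φ f, RatFunc.substHom_X_inv_involutive f⟩))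
  refine ⟨v, ?_, fun c hc => ?_⟩
  · have : i.comp φ.toRingHom RatFunc.X = (i RatFunc.X)⁻¹ := by
      change i (φ RatFunc.X) = _
      rw [RatFunc.substHom_X, map_inv₀]
    rw [this, map_inv₀] at hv
    have h0 : v (i RatFunc.X) ≠ 0 := by simp [RatFunc.X_ne_zero]
    exact (inv_lt_one₀ (zero_lt_iff.2 h0)).1 hv
  · rw [← hvc c hc]
    change _ = v (i (φ (RatFunc.C c)))
    rw [← RatFunc.algebraMap_eq_C, AlgHom.commutes]

section
variable {k L : Type*} [Field k] [Field L] [Algebra k L]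

theorem Polynomial.aeval_mem_span_one_self_pow {x : L} {p : k[X]} {s : ℕ} (hp : p.natDegree ≤ s) :
    aeval x p ∈ (Submodule.span k {1, x}) ^ s := by
  rw [aeval_eq_sum_range]
  refine Submodule.sum_mem _ fun i hi => Submodule.smul_mem _ _ ?_
  have h1 : (1 : L) ∈ Submodule.span k {1, x} := Submodule.subset_span (by simp)
  exact Submodule.pow_mono_of_one_mem h1
    ((Nat.lt_succ_iff.1 (Finset.mem_range.1 hi)).trans hp)
    (Submodule.pow_mem_pow _ (Submodule.subset_span (by simp)) i)

theorem Valuation.le_pow_of_mem_submodule_pow (v : Valuation L ℤᵐ⁰)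
    (hv : ∀ c : k, v (algebraMap k L c) ≤ 1) {S : Submodule k L} {b : ℤᵐ⁰}
    (hS : ∀ a ∈ S, v a ≤ b) (n : ℕ) : ∀ a ∈ S ^ n, v a ≤ b ^ n := by
  induction n with
  | zero =>
    intro a ha
    rw [pow_zero, Submodule.mem_one] at ha
    obtain ⟨c, rfl⟩ := ha
    simpa using hv c
  | succ n ih =>
    intro a ha
    rw [pow_succ] at ha ⊢
    refine Submodule.mul_induction_on ha (fun m hm n hn => ?_) fun m n hm hn => ?_
    · rw [map_mul]; exact mul_le_mul' (ih _ hm) (hS _ hn)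
    · exact v.map_add_le hm hn

theorem Derivation.mul_aeval_mul_eq (D : Derivation k L L) {x z : L} {A B : k[X]} {r : ℕ}
    (hx : aeval x (X ^ r * A) = z * aeval x B) :
    x * D z * aeval x (A * B) =
      z * aeval x (((r : k[X]) * A + X * derivative A) * B - X * A * derivative B) * D x := by
  have h := congrArg D hx
  have hmul : D (aeval x (X ^ r * A)) * x = x ^ r * (r * aeval x A + x * aeval x (derivative A)) *
      D x := by
    rw [map_mul, aeval_X_pow, D.leibniz, D.leibniz_pow, D.map_aeval]
    cases r with
    | zero => simp; ring
    | succ n => simp [smul_eq_mul]; ring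
  rw [h, D.leibniz, D.map_aeval] at hmul
  rw [map_mul, aeval_X_pow] at hx
  simp only [smul_eq_mul] at hmul
  have hr : aeval x (r : k[X]) = r := _root_.map_natCast (aeval x) r
  simp only [map_mul, map_sub, map_add, aeval_X, hr]
  linear_combination (aeval x A) * hmul + (r * aeval x A + x * aeval x (derivative A)) * D x * hx

theorem Submodule.mem_mul_pow_of_mem {A : Submodule k L} {n : ℕ} {a b : L} (ha : a ∈ A)
    (hb : b ∈ A ^ n) : a * b ∈ A ^ (n + 1) := by
  rw [pow_succ']
  exact Submodule.mul_mem_mul ha hb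

theorem Derivation.mem_pow_of_span_pair (δ : Derivation k L L) {x y e f : L} {s : ℕ}
    (he : e ∈ (Submodule.span k {1, x} * Submodule.span k {1, y}) ^ s)
    (hf : f ∈ (Submodule.span k {1, x} * Submodule.span k {1, y}) ^ s)
    (hx : δ x = x * e) (hy : δ y = y * f) {a : L}
    (ha : a ∈ Submodule.span k {1, x} * Submodule.span k {1, y}) :
    δ a ∈ (Submodule.span k {1, x} * Submodule.span k {1, y}) ^ (s + 1) := by
  have key : ∀ x e : L, δ x = x * e → ∀ a ∈ Submodule.span k {1, x},
      ∃ b ∈ Submodule.span k {1, x}, δ a = b * e := by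
    intro x e hx a ha
    obtain ⟨α, β, rfl⟩ := Submodule.mem_span_pair.1 ha
    refine ⟨β • x, Submodule.smul_mem _ _ (Submodule.subset_span (by simp)), ?_⟩
    simp [hx]
  refine Submodule.mul_induction_on ha (fun m hm n hn => ?_) fun m n hm hn => ?_
  · obtain ⟨b, hb, hb'⟩ := key x e hx m hm
    obtain ⟨c, hc, hc'⟩ := key y f hy n hn
    rw [δ.leibniz, hb', hc', smul_eq_mul, smul_eq_mul]
    refine Submodule.add_mem _ ?_ ?_
    · rw [← mul_assoc]
      exact Submodule.mem_mul_pow_of_mem (Submodule.mul_mem_mul hm hc) hf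
    · rw [← mul_assoc, mul_comm n]
      exact Submodule.mem_mul_pow_of_mem (Submodule.mul_mem_mul hb hn) he
  · rw [map_add]; exact Submodule.add_mem _ hm hn

theorem WithZero.log_le_of_le_pow_mul {v a b : ℤᵐ⁰} {n : ℕ} (hv : v ≠ 0)
    (h : v ≤ (max 1 a * max 1 b) ^ n) : log v ≤ n * (max 0 (log a) + max 0 (log b)) := by
  have hlog : ∀ a : ℤᵐ⁰, log (max 1 a) = max 0 (log a) := by
    intro a
    rcases eq_or_ne a 0 with rfl | ha
    · simp
    rcases le_total 1 a with h | h
    · rw [max_eq_right h, max_eq_right]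
      rw [← log_one]; exact (log_le_log one_ne_zero ha).2 h
    · rw [max_eq_left h, max_eq_left, log_one]
      rw [← log_one]; exact (log_le_log ha one_ne_zero).2 h
  have h0 : ∀ a : ℤᵐ⁰, max 1 a ≠ 0 := fun a => (zero_lt_one.trans_le (le_max_left _ _)).ne'
  have := (log_le_log hv (pow_ne_zero _ (mul_ne_zero (h0 a) (h0 b)))).2 h
  rw [log_pow, log_mul (h0 a) (h0 b), hlog, hlog] at this
  simpa using this

theorem sum_abs_log_le_of_minimal_relation {G ι : Type*} [Fintype G] [Fintype ι] [DecidableEq ι]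
    [CharZero k]
    (D : Derivation k L L) (hD : ∀ a, D a = 0 → ∃ c : k, algebraMap k L c = a)
    {x y z : L} (hx : Transcendental k x) (hy : Transcendental k y) (hz : Transcendental k z)
    {A B : k[X]} (hA : A ≠ 0) (hB : B ≠ 0) {m : ℕ}
    (hxz : aeval x (X ^ m * A) = z * aeval x B) (hyz : aeval y (X ^ m * A) = z * aeval y B)
    (v : G → Valuation L ℤᵐ⁰) (hv : ∀ g, ∀ c : k, v g (algebraMap k L c) ≤ 1)
    (T : Subalgebra k L) (hxT : x ∈ T) (hyT : y ∈ T)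
    (hT : ∀ a ∈ T, a ≠ 0 → 0 ≤ ∑ g, log (v g a))
    (r t : ι → ℕ) (c : ι → k) (hc : ∑ i, c i • (x ^ r i * y ^ t i) = 0)
    (hmin : ∀ c' : ι → k, c' ≠ 0 → ∑ i, c' i • (x ^ r i * y ^ t i) = 0 →
      (∀ i, c i = 0 → c' i = 0) → ∀ i, c' i = 0 → c i = 0)
    (p q : ι) (hp : c p ≠ 0) (hq : c q ≠ 0) :
    ∑ g, |((r p : ℤ) - r q) * log (v g x) + ((t p : ℤ) - t q) * log (v g y)| ≤
      2 * ((Fintype.card ι ^ 2 * (A.natDegree + B.natDegree) : ℕ) : ℤ) *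
        ∑ g, (max 0 (log (v g x)) + max 0 (log (v g y))) := by
  have hDne : ∀ a : L, Transcendental k a → D a ≠ 0 := by
    intro a ha h
    obtain ⟨c, rfl⟩ := hD a h
    exact ha (isAlgebraic_algebraMap c)
  have hane : ∀ {a : L}, Transcendental k a → ∀ {P : k[X]}, P ≠ 0 → aeval a P ≠ 0 :=
    fun ha P hP h =>
    ha ⟨P, hP, h⟩
  have hne0 : ∀ a : L, Transcendental k a → a ≠ 0 := by
    rintro a ha rfl
    exact ha isAlgebraic_zero
  set s := A.natDegree + B.natDegree with hs
  set N : k[X] := ((m : k[X]) * A + X * derivative A) * B - X * A * derivative B with hN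
  have hXd : ∀ P : k[X], (X * derivative P).natDegree ≤ P.natDegree := by
    intro P
    rcases Nat.eq_zero_or_pos P.natDegree with h | h
    · rw [derivative_of_natDegree_zero h]; simp
    · refine natDegree_mul_le.trans ?_
      have := natDegree_derivative_lt h.ne'
      rw [natDegree_X]; omega
  have hNs : N.natDegree ≤ s := by
    have h1 : ((m : k[X]) * A + X * derivative A).natDegree ≤ A.natDegree := by
      refine natDegree_add_le_of_degree_le ?_ (hXd A)
      refine natDegree_mul_le.trans ?_
      simp
    have h2 : X * A * derivative B = A * (X * derivative B) := by ring
    rw [hN, h2]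
    exact (natDegree_sub_le_of_le (natDegree_mul_le.trans (Nat.add_le_add_right h1 _))
      (natDegree_mul_le.trans (Nat.add_le_add_left (hXd B) _))).trans (max_self _).le
  have hDs : (A * B).natDegree ≤ s := natDegree_mul_le
  have ex := D.mul_aeval_mul_eq hxz
  have ey := D.mul_aeval_mul_eq hyz
  rw [← hN] at ex ey
  have hdx := hDne x hx
  have hdy := hDne y hy
  have hdz := hDne z hz
  have hx0 := hne0 x hx
  have hy0 := hne0 y hy
  have hz0 := hne0 z hz
  have hAB : A * B ≠ 0 := mul_ne_zero hA hB
  have hDx0 := hane hx hAB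
  have hDy0 := hane hy hAB
  have hNy0 : aeval y N ≠ 0 := by
    intro h
    rw [h] at ey
    simp [hy0, hdz] at ey
    exact hDy0 (by rw [map_mul]; simpa using ey)
  set κ : L := x * aeval x (A * B) * aeval y N / D x with hκ
  have hκ0 : κ ≠ 0 := div_ne_zero (mul_ne_zero (mul_ne_zero hx0 hDx0) hNy0) hdx
  set δ : Derivation k L L := κ • D with hδdef
  have hδa : ∀ a, δ a = κ * D a := fun a => rfl
  have hδ : ∀ a, δ a = 0 → ∃ c : k, algebraMap k L c = a := fun a ha =>
    hD a ((mul_eq_zero.1 ((hδa a).symm.trans ha)).resolve_left hκ0)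
  have hδx : δ x = x * (aeval x (A * B) * aeval y N) := by
    rw [hδa, hκ]; field_simp
  have hδy : δ y = y * (aeval x N * aeval y (A * B)) := by
    rw [hδa, hκ, div_mul_eq_mul_div, div_eq_iff hdx]
    refine mul_left_cancel₀ (mul_ne_zero hz0 hdz) ?_
    linear_combination (-D z * x * aeval x (A * B)) * ey + (D z * y * aeval y (A * B)) * ex
  set S := Submodule.span k {1, x} * Submodule.span k {1, y} with hS
  have h1x : (1 : L) ∈ Submodule.span k {1, x} := Submodule.subset_span (by simp)
  have h1y : (1 : L) ∈ Submodule.span k {1, y} := Submodule.subset_span (by simp)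
  have h1S : (1 : L) ∈ S := by
    have := Submodule.mul_mem_mul h1x h1y
    rwa [one_mul] at this
  have he : aeval x (A * B) * aeval y N ∈ S ^ s := by
    rw [hS, mul_pow]
    exact Submodule.mul_mem_mul (aeval_mem_span_one_self_pow hDs) (aeval_mem_span_one_self_pow hNs)
  have hf : aeval x N * aeval y (A * B) ∈ S ^ s := by
    rw [hS, mul_pow]
    exact Submodule.mul_mem_mul (aeval_mem_span_one_self_pow hNs) (aeval_mem_span_one_self_pow hDs)
  have hδS : ∀ a ∈ S, δ a ∈ S ^ (s + 1) := fun a ha => δ.mem_pow_of_span_pair he hf hδx hδy ha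
  obtain ⟨a, b, ha0, hb0, ha, hb, hab⟩ := exists_mul_eq_mul_of_minimal_relation δ hδ h1S hδS
    (fun i => x ^ r i * y ^ t i)
    (fun i => (r i : k) • (aeval x (A * B) * aeval y N) + (t i : k) • (aeval x N * aeval y (A * B)))
    (fun i => mul_ne_zero (pow_ne_zero _ hx0) (pow_ne_zero _ hy0))
    (fun i => Submodule.add_mem _ (Submodule.smul_mem _ _ he) (Submodule.smul_mem _ _ hf))
    (fun i => by
      have hpow : ∀ (w e : L) (n : ℕ), δ w = w * e → δ (w ^ n) = n * w ^ n * e := by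
        intro w e n hw
        rw [δ.leibniz_pow, hw]
        cases n with
        | zero => simp
        | succ n => simp [smul_eq_mul]; ring
      rw [δ.leibniz, hpow _ _ _ hδx, hpow _ _ _ hδy]
      simp only [smul_eq_mul, Algebra.smul_def, map_natCast]
      ring) c hc hmin p q hp hq
  set M := Fintype.card ι ^ 2 * s with hM
  have hST : S ≤ Subalgebra.toSubmodule T := by
    rw [hS, Submodule.mul_le]
    have hspan : ∀ w ∈ T, Submodule.span k {1, w} ≤ Subalgebra.toSubmodule T := by
      intro w hw
      rw [Submodule.span_le]
      rintro _ (rfl | rfl)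
      · exact T.one_mem
      · exact hw
    exact fun m hm n hn => T.mul_mem (hspan x hxT hm) (hspan y hyT hn)
  have hSMT : ∀ a ∈ S ^ M, a ∈ T := by
    intro a ha
    refine Submodule.pow_induction_on_left' (M := S) (C := fun n a _ => a ∈ T)
      (fun c => T.algebraMap_mem c) (fun _ _ _ _ _ => T.add_mem)
      (fun m hm _ _ _ h => T.mul_mem (hST hm) h) ha
  have hvS : ∀ g, ∀ a ∈ S ^ M, a ≠ 0 → log (v g a) ≤
      M * (max 0 (log (v g x)) + max 0 (log (v g y))) := by
    intro g a ha ha0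
    refine log_le_of_le_pow_mul ((v g).ne_zero_iff.2 ha0)
      ((v g).le_pow_of_mem_submodule_pow (hv g) (fun a ha => ?_) M a ha)
    have hspan : ∀ w, ∀ a ∈ Submodule.span k {1, w}, v g a ≤ max 1 (v g w) := by
      intro w a ha
      obtain ⟨α, β, rfl⟩ := Submodule.mem_span_pair.1 ha
      refine (v g).map_add_le ?_ ?_
      · rw [Algebra.smul_def, mul_one]
        exact (hv g α).trans (le_max_left _ _)
      · rw [Algebra.smul_def, map_mul]
        exact (mul_le_of_le_one_left' (hv g β)).trans (le_max_right _ _)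
    refine Submodule.mul_induction_on ha (fun m hm n hn => ?_) fun m n hm hn => ?_
    · rw [map_mul]; exact mul_le_mul' (hspan x m hm) (hspan y n hn)
    · exact (v g).map_add_le hm hn
  have hpt : ∀ g, |((r p : ℤ) - r q) * log (v g x) + ((t p : ℤ) - t q) * log (v g y)| ≤
      2 * (M : ℤ) * (max 0 (log (v g x)) + max 0 (log (v g y))) - log (v g a) - log (v g b) := by
    intro g
    have hvx := (v g).ne_zero_iff.2 hx0
    have hvy := (v g).ne_zero_iff.2 hy0
    have h := congrArg (fun w => log (v g w)) hab
    simp only [map_mul, map_pow] at h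
    rw [log_mul (mul_ne_zero (pow_ne_zero _ hvx) (pow_ne_zero _ hvy)) ((v g).ne_zero_iff.2 ha0),
      log_mul (mul_ne_zero (pow_ne_zero _ hvx) (pow_ne_zero _ hvy)) ((v g).ne_zero_iff.2 hb0),
      log_mul (pow_ne_zero _ hvx) (pow_ne_zero _ hvy), log_mul (pow_ne_zero _ hvx)
      (pow_ne_zero _ hvy)] at h
    simp only [log_pow, nsmul_eq_mul] at h
    have h1 := hvS g a ha ha0
    have h2 := hvS g b hb hb0
    rw [abs_le]
    constructor <;> linarith
  calc _ ≤ ∑ g, (2 * (M : ℤ) * (max 0 (log (v g x)) + max 0 (log (v g y))) -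
        log (v g a) - log (v g b)) := Finset.sum_le_sum fun g _ => hpt g
    _ ≤ _ := by
        rw [Finset.sum_sub_distrib, Finset.sum_sub_distrib, ← Finset.mul_sum]
        have h1 := hT a (hSMT a ha) ha0
        have h2 := hT b (hSMT b hb) hb0
        linarith

end

theorem Finset.le_add_mul_card_of_no_gap {U : Finset ℕ} {T : ℕ}
    (hU : ∀ a ∈ U, ∀ b ∈ U, a < b → ∃ c ∈ U, a < c ∧ c ≤ a + T) :
    ∀ a ∈ U, ∀ b ∈ U, b ≤ a + T * U.card := by
  intro a ha b hb
  have key : ∀ b, b ∈ U → b ≤ a + T * (U.filter (· < b)).card := by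
    intro b
    induction b using Nat.strong_induction_on with
    | _ b ih =>
      intro hb
      rcases le_or_gt b a with h | h
      · exact h.trans (Nat.le_add_right _ _)
      have hne : (U.filter (· < b)).Nonempty := ⟨a, Finset.mem_filter.2 ⟨ha, h⟩⟩
      obtain ⟨hmU, hmb⟩ := Finset.mem_filter.1 (Finset.max'_mem _ hne)
      set m := (U.filter (· < b)).max' hne
      obtain ⟨c, hcU, hmc, hcm⟩ := hU m hmU b hb hmb
      have hbc : b ≤ c := by
        by_contra! hlt
        exact absurd ((U.filter (· < b)).le_max' c (Finset.mem_filter.2 ⟨hcU, hlt⟩)) (not_le.2 hmc)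
      have hlt : (U.filter (· < m)).card < (U.filter (· < b)).card := by
        refine Finset.card_lt_card ⟨fun u hu => ?_, fun hsub => ?_⟩
        · obtain ⟨h1, h2⟩ := Finset.mem_filter.1 hu
          exact Finset.mem_filter.2 ⟨h1, h2.trans hmb⟩
        · exact lt_irrefl _ (Finset.mem_filter.1 (hsub (Finset.mem_filter.2 ⟨hmU, hmb⟩))).2
      have := ih m hmb hmU
      calc b ≤ a + T * (U.filter (· < m)).card + T := by omega
        _ = a + T * ((U.filter (· < m)).card + 1) := by ring
        _ ≤ _ := by gcongr; exact hlt
  exact (key b hb).trans (by gcongr; exact Finset.filter_subset _ _)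

section
variable {k L : Type*} [Field k] [Field L] [Algebra k L]

theorem Polynomial.le_add_mul_card_of_minimal_relation {x y : L} (hx : Transcendental k x)
    (hy : Transcendental k y) {P Q : k[X]} (hQ : Q ≠ 0)
    (hrel : aeval x P * aeval y Q = aeval x Q * aeval y P)
    (hmin : ∀ P' Q' : k[X], Q' ≠ 0 → P' * Q = Q' * P →
      P.support.card + Q.support.card ≤ P'.support.card + Q'.support.card)
    {U : Finset ℕ} (hU : U = P.support ∪ Q.support) {T : ℕ}
    (hT : ∀ c : U × U → k, ∑ i, c i • (x ^ (i.1 : ℕ) * y ^ (i.2 : ℕ)) = 0 →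
      (∀ c' : U × U → k, c' ≠ 0 → ∑ i, c' i • (x ^ (i.1 : ℕ) * y ^ (i.2 : ℕ)) = 0 →
        (∀ i, c i = 0 → c' i = 0) → ∀ i, c' i = 0 → c i = 0) →
      ∀ i j, c i ≠ 0 → c j ≠ 0 → (j.1 : ℕ) ≤ i.1 + T) :
    ∀ a ∈ U, ∀ b ∈ U, b ≤ a + T * U.card := by
  classical
  refine Finset.le_add_mul_card_of_no_gap fun a ha b hb hab => ?_
  by_contra! hgap
  have hPU : P.support ⊆ U := hU ▸ Finset.subset_union_left
  have hQU : Q.support ⊆ U := hU ▸ Finset.subset_union_right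
  have hsum : ∀ (R : k[X]) (w : L), R.support ⊆ U →
      aeval w R = ∑ u : U, R.coeff u • w ^ (u : ℕ) := by
    intro R w hR
    rw [aeval_eq_sum_range, Finset.sum_coe_sort U fun u => R.coeff u • w ^ u]
    have h1 : ∑ i ∈ Finset.range (R.natDegree + 1), R.coeff i • w ^ i =
        ∑ i ∈ R.support, R.coeff i • w ^ i := by
      refine (Finset.sum_subset (fun i hi => Finset.mem_range_succ_iff.2
        (le_natDegree_of_mem_supp i hi)) fun i _ hi => ?_).symm
      rw [notMem_support_iff.1 hi, zero_smul]
    rw [h1]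
    exact Finset.sum_subset hR fun i _ hi => by rw [notMem_support_iff.1 hi, zero_smul]
  let tr : k[X] → k[X] := fun R => ∑ i ∈ R.support.filter (· ≤ a), monomial i (R.coeff i)
  have hcoeff : ∀ (R : k[X]) (n : ℕ), (tr R).coeff n = if n ≤ a then R.coeff n else 0 := by
    intro R n
    simp only [tr, finsetSum_coeff, coeff_monomial, Finset.sum_ite_eq', Finset.mem_filter,
      mem_support_iff]
    by_cases h0 : R.coeff n = 0 <;> by_cases hn : n ≤ a <;> simp [h0, hn]
  have hsupp : ∀ R : k[X], (tr R).support = R.support.filter (· ≤ a) := by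
    intro R
    ext n
    rw [mem_support_iff, hcoeff, Finset.mem_filter, mem_support_iff]
    by_cases hn : n ≤ a <;> simp [hn]
  let c : U × U → k := fun i => P.coeff i.1 * Q.coeff i.2 - Q.coeff i.1 * P.coeff i.2
  have hfac : ∀ R S R' S' : k[X], R.support ⊆ U → S.support ⊆ U → R'.support ⊆ U → S'.support ⊆ U →
      ∑ i : U × U, (R.coeff i.1 * S.coeff i.2 - R'.coeff i.1 * S'.coeff i.2) •
        (x ^ (i.1 : ℕ) * y ^ (i.2 : ℕ)) = aeval x R * aeval y S - aeval x R' * aeval y S' := by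
    intro R S R' S' h1 h2 h3 h4
    rw [hsum R x h1, hsum S y h2, hsum R' x h3, hsum S' y h4, Finset.sum_mul_sum,
      Finset.sum_mul_sum, Fintype.sum_prod_type, ← Finset.sum_sub_distrib]
    refine Finset.sum_congr rfl fun r _ => ?_
    rw [← Finset.sum_sub_distrib]
    refine Finset.sum_congr rfl fun t _ => ?_
    rw [sub_smul, smul_mul_smul_comm, smul_mul_smul_comm]
  have hc : ∑ i, c i • (x ^ (i.1 : ℕ) * y ^ (i.2 : ℕ)) = 0 := by
    rw [hfac P Q Q P hPU hQU hQU hPU, hrel, sub_self]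
  have hsplit := sum_filter_smul_eq_zero_of_minimal_close
    (fun i : U × U => x ^ (i.1 : ℕ) * y ^ (i.2 : ℕ))
    (Finset.univ.filter fun i : U × U => (i.1 : ℕ) ≤ a) (fun c hc hcm i j hi hj hiS => by
      have h1 := hT c hc hcm i j hi hj
      simp only [Finset.mem_filter, Finset.mem_univ, true_and] at hiS ⊢
      by_contra! hlt
      have := hgap j.1 j.1.2 hlt
      omega) c hc
  have htr : ∀ R : k[X], R.support ⊆ U → (tr R).support ⊆ U := fun R hR => by
    rw [hsupp]; exact (Finset.filter_subset _ _).trans hR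
  have hrel' : aeval x (tr P) * aeval y Q = aeval x (tr Q) * aeval y P := by
    rw [← sub_eq_zero, ← hfac (tr P) Q (tr Q) P (htr P hPU) hQU (htr Q hQU) hPU, ← hsplit,
      Finset.sum_filter]
    refine Finset.sum_congr rfl fun i _ => ?_
    rw [hcoeff, hcoeff]
    split_ifs
    · rfl
    · simp
  have hane : ∀ {w : L}, Transcendental k w → ∀ {R : k[X]}, R ≠ 0 → aeval w R ≠ 0 :=
    fun hw R hR h => hw ⟨R, hR, h⟩
  have hpoly : tr P * Q = tr Q * P := by
    refine (transcendental_iff_injective.1 hx) ?_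
    rw [map_mul, map_mul]
    refine mul_right_cancel₀ (hane hy hQ) ?_
    linear_combination (aeval x Q) * hrel' - (aeval x (tr Q)) * hrel
  have htrQ : tr Q ≠ 0 := by
    intro h0
    rw [h0, zero_mul, mul_eq_zero, or_iff_left hQ] at hpoly
    rw [hU, Finset.mem_union] at ha
    rcases ha with ha | ha
    · have := hcoeff P a
      rw [hpoly, coeff_zero, if_pos le_rfl] at this
      exact mem_support_iff.1 ha this.symm
    · have := hcoeff Q a
      rw [h0, coeff_zero, if_pos le_rfl] at this
      exact mem_support_iff.1 ha this.symm
  have hle := hmin _ _ htrQ hpoly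
  rw [hsupp, hsupp] at hle
  have h1 := Finset.card_filter_le P.support (· ≤ a)
  have h2 := Finset.card_filter_le Q.support (· ≤ a)
  rw [hU, Finset.mem_union] at hb
  rcases hb with hb | hb
  · have := Finset.card_lt_card ((Finset.filter_ssubset (p := (· ≤ a))).2 ⟨b, hb, not_le.2 hab⟩)
    omega
  · have := Finset.card_lt_card ((Finset.filter_ssubset (p := (· ≤ a))).2 ⟨b, hb, not_le.2 hab⟩)
    omega

theorem Polynomial.exists_eq_X_pow_mul_of_support {U : Finset ℕ} {n : ℕ}
    (hU : ∀ a ∈ U, ∀ b ∈ U, b ≤ a + n) : ∃ m : ℕ, ∀ P : k[X], P.support ⊆ U →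
      ∃ P' : k[X], P = X ^ m * P' ∧ P'.natDegree ≤ n := by
  rcases U.eq_empty_or_nonempty with rfl | hne
  · refine ⟨0, fun P hP => ⟨0, ?_, by simp⟩⟩
    rw [Finset.subset_empty, support_eq_empty] at hP
    rw [hP, mul_zero]
  refine ⟨U.min' hne, fun P hP => ?_⟩
  obtain ⟨P', hP'⟩ : X ^ (U.min' hne) ∣ P := X_pow_dvd_iff.2 fun d hd => by
    by_contra h
    exact absurd (U.min'_le d (hP (mem_support_iff.2 h))) (not_le.2 hd)
  refine ⟨P', hP', ?_⟩
  rw [natDegree_le_iff_coeff_eq_zero]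
  intro N hN
  by_contra h
  have h1 : P.coeff (N + U.min' hne) ≠ 0 := by rwa [hP', coeff_X_pow_mul]
  have := hU _ (U.min'_mem hne) _ (hP (mem_support_iff.2 h1))
  omega

end

theorem ratDeg_le_of_eq_div {h : RatFunc ℂ} {P Q : ℂ[X]} {n : ℕ} (hQ : Q ≠ 0)
    (hh : h = algebraMap ℂ[X] (RatFunc ℂ) P / algebraMap ℂ[X] (RatFunc ℂ) Q)
    (hP : P.natDegree ≤ n) (hQn : Q.natDegree ≤ n) : ratDeg h ≤ n := by
  have hd : h.denom ∣ Q := (RatFunc.denom_dvd hQ).2 ⟨P, hh⟩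
  rcases eq_or_ne P 0 with rfl | hP0
  · rw [map_zero, zero_div] at hh
    simp [hh, ratDeg]
  · have hn : h.num ∣ P := (RatFunc.num_dvd hP0).2 ⟨Q, hQ, hh⟩
    exact max_le ((natDegree_le_of_dvd hn hP0).trans hP) ((natDegree_le_of_dvd hd hQ).trans hQn)

theorem exists_Nsharp_eq (h : RatFunc ℂ) : ∃ p q : ℂ[X], q ≠ 0 ∧
    h = algebraMap ℂ[X] (RatFunc ℂ) p / algebraMap ℂ[X] (RatFunc ℂ) q ∧
    Nsharp h = p.support.card + q.support.card :=
  Nat.sInf_mem (s := {n : ℕ | ∃ p q : ℂ[X], q ≠ 0 ∧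
    h = algebraMap ℂ[X] (RatFunc ℂ) p / algebraMap ℂ[X] (RatFunc ℂ) q ∧
    n = p.support.card + q.support.card})
    ⟨_, h.num, h.denom, h.denom_ne_zero, (RatFunc.num_div_denom h).symm, rfl⟩

theorem Nsharp_le {h : RatFunc ℂ} {p q : ℂ[X]} (hq : q ≠ 0)
    (hh : h = algebraMap ℂ[X] (RatFunc ℂ) p / algebraMap ℂ[X] (RatFunc ℂ) q) :
    Nsharp h ≤ p.support.card + q.support.card :=
  Nat.sInf_le ⟨p, q, hq, hh, rfl⟩

theorem ratDeg_le_of_separated {L G : Type*} [Field L] [Algebra ℂ L] [Fintype G]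
    (D : Derivation ℂ L L) (hD : ∀ a, D a = 0 → ∃ c : ℂ, algebraMap ℂ L c = a)
    {x y z : L} (hx : Transcendental ℂ x) (hy : Transcendental ℂ y) (hz : Transcendental ℂ z)
    {A B : ℂ[X]} (hA : A ≠ 0) (hB : B ≠ 0) {m : ℕ}
    (hxz : aeval x (X ^ m * A) = z * aeval x B) (hyz : aeval y (X ^ m * A) = z * aeval y B)
    (v : G → Valuation L ℤᵐ⁰) (hv : ∀ g, ∀ c : ℂ, v g (algebraMap ℂ L c) ≤ 1)
    (T : Subalgebra ℂ L) (hxT : x ∈ T) (hyT : y ∈ T)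
    (hT : ∀ a ∈ T, a ≠ 0 → 0 ≤ ∑ g, log (v g a))
    {h : RatFunc ℂ} (hxy : RatFunc.substHom x hx h = RatFunc.substHom y hy h)
    {ℓ n : ℕ} (hℓ : Nsharp h ≤ ℓ)
    (hsep : ∀ a b : ℤ, ∑ g, |a * log (v g x) + b * log (v g y)| ≤
      2 * ((ℓ ^ 4 * (A.natDegree + B.natDegree) : ℕ) : ℤ) *
        ∑ g, (max 0 (log (v g x)) + max 0 (log (v g y))) → |a| ≤ n) :
    ratDeg h ≤ n * ℓ := by
  classical
  obtain ⟨P, Q, hQ, hh, hPQ⟩ := exists_Nsharp_eq h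
  have hane : ∀ {w : L}, Transcendental ℂ w → ∀ {R : ℂ[X]}, R ≠ 0 → aeval w R ≠ 0 :=
    fun hw R hR h => hw ⟨R, hR, h⟩
  have hQ' : algebraMap ℂ[X] (RatFunc ℂ) Q ≠ 0 := by simpa using hQ
  have hrel : aeval x P * aeval y Q = aeval x Q * aeval y P := by
    rw [hh, map_div₀, map_div₀] at hxy
    simp only [RatFunc.substHom_algebraMap] at hxy
    rw [div_eq_div_iff (hane hx hQ) (hane hy hQ)] at hxy
    rw [hxy, mul_comm]
  have hmin : ∀ P' Q' : ℂ[X], Q' ≠ 0 → P' * Q = Q' * P →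
      P.support.card + Q.support.card ≤ P'.support.card + Q'.support.card := by
    intro P' Q' hQ'0 hPQ'
    rw [← hPQ]
    refine Nsharp_le hQ'0 ?_
    have hQ'1 : algebraMap ℂ[X] (RatFunc ℂ) Q' ≠ 0 := by simpa using hQ'0
    rw [hh, div_eq_div_iff hQ' hQ'1, ← map_mul, ← map_mul, hPQ', mul_comm]
  have hcard : (P.support ∪ Q.support).card ≤ ℓ := (Finset.card_union_le _ _).trans (hPQ ▸ hℓ)
  have hspan := le_add_mul_card_of_minimal_relation hx hy hQ hrel hmin rfl (T := n)
    (fun c hc hcm i j hi hj => by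
      have h1 := sum_abs_log_le_of_minimal_relation D hD hx hy hz hA hB hxz hyz v hv T hxT hyT hT
        (fun i => (i.1 : ℕ)) (fun i => (i.2 : ℕ)) c hc hcm i j hi hj
      have h2 := hsep _ _ (h1.trans ?_)
      · rw [abs_le] at h2; omega
      refine mul_le_mul_of_nonneg_right ?_ (Finset.sum_nonneg fun g _ =>
        add_nonneg (le_max_left _ _) (le_max_left _ _))
      have h3 : Fintype.card ((P.support ∪ Q.support : Finset ℕ) ×
          (P.support ∪ Q.support : Finset ℕ)) ^ 2 ≤ ℓ ^ 4 := by
        rw [Fintype.card_prod, Fintype.card_coe]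
        calc _ = (P.support ∪ Q.support).card ^ 4 := by ring
          _ ≤ _ := Nat.pow_le_pow_left hcard 4
      exact_mod_cast Nat.mul_le_mul_left 2 (Nat.mul_le_mul_right _ h3))
  obtain ⟨e, he⟩ := exists_eq_X_pow_mul_of_support (k := ℂ) hspan
  obtain ⟨P', hP', hPd⟩ := he P Finset.subset_union_left
  obtain ⟨Q', hQ'', hQd⟩ := he Q Finset.subset_union_right
  have hQ'0 : Q' ≠ 0 := by rintro rfl; simp at hQ''; exact hQ hQ''
  refine (ratDeg_le_of_eq_div hQ'0 ?_ hPd hQd).trans (Nat.mul_le_mul_left _ hcard)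
  rw [hh, hP', hQ'', map_mul, map_mul, mul_div_mul_left]
  simp [RatFunc.X_ne_zero]

section
variable {k L : Type*} [Field k] [Field L] [Algebra k L]

theorem Valuation.aeval_le_one (v : Valuation L ℤᵐ⁰) (hv : ∀ c : k, v (algebraMap k L c) ≤ 1)
    {x : L} (hx : v x ≤ 1) (p : k[X]) : v (aeval x p) ≤ 1 := by
  rw [aeval_eq_sum_range]
  refine v.map_sum_le fun i _ => ?_
  rw [Algebra.smul_def, map_mul, map_pow]
  exact mul_le_one' (hv _) (pow_le_one' hx i)

theorem Valuation.aeval_eq_pow_natDegree (v : Valuation L ℤᵐ⁰)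
    (hv : ∀ c : k, c ≠ 0 → v (algebraMap k L c) = 1) {x : L} (hx : 1 < v x) {p : k[X]}
    (hp : p ≠ 0) : v (aeval x p) = v x ^ p.natDegree := by
  have hv' : ∀ c : k, v (algebraMap k L c) ≤ 1 := fun c => by
    rcases eq_or_ne c 0 with rfl | hc
    · simp
    · exact (hv c hc).le
  have hx0 : 0 < v x := zero_lt_one.trans hx
  rw [aeval_eq_sum_range, Finset.sum_range_succ, add_comm]
  have hlead : v (p.coeff p.natDegree • x ^ p.natDegree) = v x ^ p.natDegree := by
    rw [Algebra.smul_def, map_mul, map_pow, coeff_natDegree,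
      hv _ (leadingCoeff_ne_zero.2 hp), one_mul]
  rw [v.map_add_eq_of_lt_left, hlead]
  rw [hlead]
  refine v.map_sum_lt (pow_ne_zero _ hx0.ne') fun i hi => ?_
  rw [Algebra.smul_def, map_mul, map_pow]
  exact (mul_le_of_le_one_left' (hv' _)).trans_lt
    (pow_lt_pow_right₀ hx (Finset.mem_range.1 hi))

theorem Valuation.aeval_eq_one (v : Valuation L ℤᵐ⁰)
    (hv : ∀ c : k, c ≠ 0 → v (algebraMap k L c) = 1) {x : L} (hx : v x < 1) {p : k[X]}
    (hp : p.coeff 0 ≠ 0) : v (aeval x p) = 1 := by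
  have hv' : ∀ c : k, v (algebraMap k L c) ≤ 1 := fun c => by
    rcases eq_or_ne c 0 with rfl | hc
    · simp
    · exact (hv c hc).le
  rw [← X_mul_divX_add p, map_add, add_comm, aeval_C, v.map_add_eq_of_lt_left, hv _ hp]
  rw [hv _ hp, map_mul, aeval_X, map_mul]
  exact (mul_le_of_le_one_right' (v.aeval_le_one hv' hx.le _)).trans_lt hx

theorem Valuation.aeval_lt_one (v : Valuation L ℤᵐ⁰)
    (hv : ∀ c : k, v (algebraMap k L c) ≤ 1) {x : L} (hx : v x < 1) {p : k[X]}
    (hp : p.coeff 0 = 0) : v (aeval x p) < 1 := by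
  rw [← X_mul_divX_add p, hp, C_0, add_zero, map_mul, aeval_X, map_mul]
  exact (mul_le_of_le_one_right' (v.aeval_le_one hv hx.le _)).trans_lt hx

/-- The elements of `L` which are integral over the polynomials in `z`. -/
def integralOverAdjoin (k : Type*) [Field k] [Algebra k L] (z : L) : Subalgebra k L where
  carrier := {a | (aeval z : k[X] →ₐ[k] L).toRingHom.IsIntegralElem a}
  mul_mem' ha hb := RingHom.IsIntegralElem.mul _ ha hb
  add_mem' ha hb := RingHom.IsIntegralElem.add _ ha hb
  algebraMap_mem' c := by
    have := RingHom.isIntegralElem_map (aeval z : k[X] →ₐ[k] L).toRingHom (x := C c)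
    simpa using this

theorem mem_integralOverAdjoin_of_aeval_eq {x z : L} {A B : k[X]} (hAB : B.natDegree < A.natDegree)
    (h : aeval x A = z * aeval x B) : x ∈ integralOverAdjoin k z := by
  set c := A.leadingCoeff with hc
  have hA : A ≠ 0 := by rintro rfl; simp at hAB
  have hc0 : c ≠ 0 := leadingCoeff_ne_zero.2 hA
  have hdeg : (C c⁻¹ * A).Monic := by
    rw [Monic, leadingCoeff_mul, leadingCoeff_C, inv_mul_cancel₀ hc0]
  have hlt : ((X : k[X]) • (C c⁻¹ * B).map (C : k →+* k[X])).degree <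
      ((C c⁻¹ * A).map (C : k →+* k[X])).degree := by
    rw [smul_eq_C_mul, degree_C_mul X_ne_zero, degree_map_eq_of_injective C_injective,
      degree_map_eq_of_injective C_injective, degree_C_mul (inv_ne_zero hc0),
      degree_C_mul (inv_ne_zero hc0)]
    exact degree_lt_degree hAB
  refine ⟨(C c⁻¹ * A).map C - (X : k[X]) • (C c⁻¹ * B).map C,
    (hdeg.map C).sub_of_left hlt, ?_⟩
  have hcomp : (aeval z : k[X] →ₐ[k] L).toRingHom.comp (C : k →+* k[X]) = algebraMap k L := by
    ext c; simp
  have hmap : ∀ P : k[X], (P.map (C : k →+* k[X])).eval₂ (aeval z : k[X] →ₐ[k] L).toRingHom x =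
      aeval x P := fun P => by rw [eval₂_map, hcomp, aeval_def]
  rw [eval₂_sub, smul_eq_C_mul, eval₂_mul, eval₂_C, hmap, hmap]
  simp [h]
  ring

theorem mem_integralOverAdjoin_map {x z : L} (σ : L →ₐ[k] L) (hσ : σ z = z)
    (hx : x ∈ integralOverAdjoin k z) : σ x ∈ integralOverAdjoin k z := by
  obtain ⟨p, hp, h⟩ := hx
  refine ⟨p, hp, ?_⟩
  have := congrArg σ h
  rw [map_zero] at this
  rw [← this]
  change _ = (σ : L →+* L) _
  rw [hom_eval₂]
  congr 1
  ext c
  · simp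
  · simp [hσ]

theorem RatFunc.fieldRange_substHom (g : L) (hg : Transcendental k g) :
    (RatFunc.substHom g hg).fieldRange = IntermediateField.adjoin k {g} := by
  rw [AlgHom.fieldRange_eq_map, ← RatFunc.adjoin_X, IntermediateField.adjoin_map,
    Set.image_singleton, RatFunc.substHom_X]

theorem exists_aeval_eq_of_mem_integralOverAdjoin {z n : L} (hz : Transcendental k z)
    (hn : n ∈ IntermediateField.adjoin k {z}) (hint : n ∈ integralOverAdjoin k z) :
    ∃ p : k[X], aeval z p = n := by
  rw [← RatFunc.fieldRange_substHom z hz] at hn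
  obtain ⟨R, rfl⟩ := hn
  obtain ⟨p, hp, h⟩ := hint
  have hR : IsIntegral k[X] R := by
    refine ⟨p, hp, (RatFunc.substHom z hz).toRingHom.injective ?_⟩
    rw [hom_eval₂, map_zero, ← h]
    congr 1
    ext c
    · simp [← RatFunc.algebraMap_eq_C]
    · simp [RatFunc.substHom_X]
  obtain ⟨P, rfl⟩ := IsIntegrallyClosed.isIntegral_iff.1 hR
  exact ⟨P, (RatFunc.substHom_algebraMap z hz P).symm⟩

theorem exists_algebraMap_eq_of_mem_integralOverAdjoin_inv {z n : L} (hz : Transcendental k z)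
    (hn : n ∈ IntermediateField.adjoin k {z}) (hn0 : n ≠ 0) (hint : n ∈ integralOverAdjoin k z)
    (hint' : n⁻¹ ∈ integralOverAdjoin k z) : ∃ c : k, algebraMap k L c = n := by
  obtain ⟨p, hp⟩ := exists_aeval_eq_of_mem_integralOverAdjoin hz hn hint
  obtain ⟨q, hq⟩ := exists_aeval_eq_of_mem_integralOverAdjoin hz (inv_mem hn) hint'
  have : p * q = 1 := (transcendental_iff_injective.1 hz) (by
    rw [map_mul, hp, hq, map_one, mul_inv_cancel₀ hn0])
  obtain ⟨c, -, rfl⟩ := isUnit_iff.1 (IsUnit.of_mul_eq_one _ this)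
  exact ⟨c, by rw [← hp, aeval_C]⟩

end

/-- A field `L` containing `ℂ(x)`, with a finite group `G` of automorphisms whose fixed field is
`ℂ(z)` and in which the stabilizer of `x` has fixed field `ℂ(x)`, together with a valuation having
a pole at `x`. -/
structure IsGaloisModel {L : Type*} [Field L] [Algebra ℂ L] (x z : L) (G : Subgroup (L ≃ₐ[ℂ] L))
    (v : Valuation L ℤᵐ⁰) : Prop where
  transcendental_left : Transcendental ℂ x
  transcendental_right : Transcendental ℂ z
  finite : Finite G
  apply_right : ∀ σ ∈ G, σ z = z
  mem_adjoin_right : ∀ a, (∀ σ ∈ G, σ a = a) → a ∈ IntermediateField.adjoin ℂ {z}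
  mem_adjoin_left : ∀ a, (∀ σ ∈ G, σ x = x → σ a = a) → a ∈ IntermediateField.adjoin ℂ {x}
  one_lt : 1 < v x
  map_algebraMap : ∀ c : ℂ, c ≠ 0 → v (algebraMap ℂ L c) = 1
  exists_derivation : ∃ D : Derivation ℂ L L, ∀ a, D a = 0 → ∃ c : ℂ, algebraMap ℂ L c = a

theorem WithZero.log_prod_valuation {L ι : Type*} [Field L] (v : Valuation L ℤᵐ⁰) (s : Finset ι)
    (f : ι → L) (hf : ∀ i ∈ s, f i ≠ 0) : log (v (∏ i ∈ s, f i)) = ∑ i ∈ s, log (v (f i)) := by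
  classical
  induction s using Finset.induction_on with
  | empty => simp
  | insert a s ha ih =>
    rw [Finset.prod_insert ha, Finset.sum_insert ha, map_mul, log_mul, ih fun i hi =>
      hf i (Finset.mem_insert_of_mem hi)]
    · exact v.ne_zero_iff.2 (hf a (Finset.mem_insert_self _ _))
    · exact v.ne_zero_iff.2 (Finset.prod_ne_zero_iff.2 fun i hi =>
        hf i (Finset.mem_insert_of_mem hi))

theorem WithZero.log_pos_iff {a : ℤᵐ⁰} (ha : a ≠ 0) : 0 < log a ↔ 1 < a := by
  rw [← log_one, log_lt_log one_ne_zero ha]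

namespace IsGaloisModel

variable {L : Type*} [Field L] [Algebra ℂ L] {x z : L} {G : Subgroup (L ≃ₐ[ℂ] L)}
  {v : Valuation L ℤᵐ⁰}

theorem map_algebraMap_le (hM : IsGaloisModel x z G v) (c : ℂ) : v (algebraMap ℂ L c) ≤ 1 := by
  rcases eq_or_ne c 0 with rfl | hc
  · simp
  · exact (hM.map_algebraMap c hc).le

theorem left_ne_zero (hM : IsGaloisModel x z G v) : x ≠ 0 := by
  rintro rfl
  exact hM.transcendental_left isAlgebraic_zero

theorem aeval_ne_zero (hM : IsGaloisModel x z G v) {p : ℂ[X]} (hp : p ≠ 0) : aeval x p ≠ 0 :=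
  fun h => hM.transcendental_left ⟨p, hp, h⟩

theorem apply_aeval_eq (hM : IsGaloisModel x z G v) {A B : ℂ[X]} (h : aeval x A = z * aeval x B)
    {σ : L ≃ₐ[ℂ] L} (hσ : σ ∈ G) : aeval (σ x) A = z * aeval (σ x) B := by
  have := congrArg σ h
  rwa [map_mul, hM.apply_right σ hσ, ← aeval_algHom_apply, ← aeval_algHom_apply] at this

theorem one_lt_right (hM : IsGaloisModel x z G v) {A B : ℂ[X]} (hAB : B.natDegree < A.natDegree)
    (hB : B ≠ 0) (h : aeval x A = z * aeval x B) : 1 < v z := by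
  have hA : A ≠ 0 := by rintro rfl; simp at hAB
  have := congrArg v h
  rw [map_mul, v.aeval_eq_pow_natDegree hM.map_algebraMap hM.one_lt hA,
    v.aeval_eq_pow_natDegree hM.map_algebraMap hM.one_lt hB] at this
  by_contra! hz
  have h1 : v x ^ A.natDegree ≤ v x ^ B.natDegree := this ▸ mul_le_of_le_one_left' hz
  exact absurd h1 (not_le.2 (pow_lt_pow_right₀ hM.one_lt hAB))

theorem prod_mem_adjoin (hM : IsGaloisModel x z G v) [Fintype G] (a : L) :
    ∏ σ : G, σ.1 a ∈ IntermediateField.adjoin ℂ {z} := by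
  refine hM.mem_adjoin_right _ fun τ hτ => ?_
  rw [map_prod]
  exact Fintype.prod_equiv (Equiv.mulLeft (⟨τ, hτ⟩ : G)) _ _ fun σ => rfl

theorem prod_mem_integralOverAdjoin (hM : IsGaloisModel x z G v) [Fintype G] {a : L}
    (ha : a ∈ integralOverAdjoin ℂ z) : ∏ σ : G, σ.1 a ∈ integralOverAdjoin ℂ z :=
  Subalgebra.prod_mem _ fun σ _ =>
    mem_integralOverAdjoin_map σ.1.toAlgHom (hM.apply_right σ.1 σ.2) ha

theorem sum_log_nonneg (hM : IsGaloisModel x z G v) [Fintype G] (hz : 1 < v z) {a : L}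
    (ha : a ∈ integralOverAdjoin ℂ z) (ha0 : a ≠ 0) : 0 ≤ ∑ σ : G, log (v (σ.1 a)) := by
  have hne : ∀ σ : G, σ.1 a ≠ 0 := fun σ => by simpa using ha0
  rw [← log_prod_valuation v _ _ fun σ _ => hne σ]
  obtain ⟨p, hp⟩ := exists_aeval_eq_of_mem_integralOverAdjoin hM.transcendental_right
    (hM.prod_mem_adjoin a) (hM.prod_mem_integralOverAdjoin ha)
  have hp0 : p ≠ 0 := by
    rintro rfl
    rw [map_zero] at hp
    exact Finset.prod_ne_zero_iff.2 (fun σ _ => hne σ) hp.symm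
  rw [← hp, v.aeval_eq_pow_natDegree hM.map_algebraMap hz hp0, log_pow]
  exact nsmul_nonneg ((log_pos_iff (zero_lt_one.trans hz).ne').2 hz).le _

theorem exists_algebraMap_eq_prod (hM : IsGaloisModel x z G v) [Fintype G] {a : L} (ha0 : a ≠ 0)
    (ha : a ∈ integralOverAdjoin ℂ z) (ha' : a⁻¹ ∈ integralOverAdjoin ℂ z) :
    ∃ c : ℂ, algebraMap ℂ L c = ∏ σ : G, σ.1 a :=
  exists_algebraMap_eq_of_mem_integralOverAdjoin_inv hM.transcendental_right
    (hM.prod_mem_adjoin a) (Finset.prod_ne_zero_iff.2 fun σ _ => by simpa using ha0)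
    (hM.prod_mem_integralOverAdjoin ha) (by
      have := hM.prod_mem_integralOverAdjoin ha'
      simpa only [map_inv₀, Finset.prod_inv_distrib] using this)

theorem sum_log_eq_zero (hM : IsGaloisModel x z G v) [Fintype G] {a : L} (ha0 : a ≠ 0)
    (ha : a ∈ integralOverAdjoin ℂ z) (ha' : a⁻¹ ∈ integralOverAdjoin ℂ z) :
    ∑ σ : G, log (v (σ.1 a)) = 0 := by
  have hne : ∀ σ : G, σ.1 a ≠ 0 := fun σ => by simpa using ha0
  rw [← log_prod_valuation v _ _ fun σ _ => hne σ]
  obtain ⟨c, hc⟩ := hM.exists_algebraMap_eq_prod ha0 ha ha'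
  rw [← hc, hM.map_algebraMap c, log_one]
  rintro rfl
  exact Finset.prod_ne_zero_iff.2 (fun σ _ => hne σ) (by rw [← hc, map_zero])

theorem inv_aeval_mem_integralOverAdjoin (hM : IsGaloisModel x z G v) {A B : ℂ[X]}
    (hAB : B.natDegree < A.natDegree) (hcop : IsCoprime A B) (hB : B ≠ 0)
    (h : aeval x A = z * aeval x B) : (aeval x B)⁻¹ ∈ integralOverAdjoin ℂ z := by
  obtain ⟨u, w, huw⟩ := hcop
  have hx := mem_integralOverAdjoin_of_aeval_eq hAB h
  have hz : z ∈ integralOverAdjoin ℂ z := by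
    have := RingHom.isIntegralElem_map (aeval z : ℂ[X] →ₐ[ℂ] L).toRingHom (x := X)
    rw [AlgHom.toRingHom_eq_coe, RingHom.coe_coe, aeval_X] at this
    exact this
  have hB0 := hM.aeval_ne_zero hB
  have : (aeval x B)⁻¹ = aeval x u * z + aeval x w := by
    rw [inv_eq_iff_eq_inv, eq_comm, inv_eq_iff_eq_inv]
    refine eq_inv_of_mul_eq_one_left ?_
    have := congrArg (aeval x) huw
    rw [map_add, map_mul, map_mul, h, map_one] at this
    linear_combination this
  rw [this]
  have hpoly : ∀ p : ℂ[X], aeval x p ∈ integralOverAdjoin ℂ z := fun p =>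
    (Algebra.adjoin_le (Set.singleton_subset_iff.2 hx) :
      Algebra.adjoin ℂ {x} ≤ integralOverAdjoin ℂ z) (aeval_mem_adjoin_singleton ℂ x)
  exact add_mem (mul_mem (hpoly u) hz) (hpoly w)

theorem ratDeg_le_of_separated (hM : IsGaloisModel x z G v) [Fintype G] {A A₁ B : ℂ[X]} {m : ℕ}
    (hA : A = X ^ m * A₁) (hAB : B.natDegree < A.natDegree) (hB : B ≠ 0)
    (h : aeval x A = z * aeval x B) {f : RatFunc ℂ}
    (hf : RatFunc.substHom x hM.transcendental_left f ∈ IntermediateField.adjoin ℂ {z})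
    {ℓ n : ℕ} (hℓ : Nsharp f ≤ ℓ) (τ : G)
    (hsep : ∀ a b : ℤ, ∑ σ : G, |a * log (v (σ.1 x)) + b * log (v ((σ * τ).1 x))| ≤
      4 * ((ℓ ^ 4 * (A₁.natDegree + B.natDegree) : ℕ) : ℤ) *
        ∑ σ : G, max 0 (log (v (σ.1 x))) → |a| ≤ n) :
    ratDeg f ≤ n * ℓ := by
  obtain ⟨D, hD⟩ := hM.exists_derivation
  have hx := hM.transcendental_left
  have hy : Transcendental ℂ (τ.1 x) := by
    rw [transcendental_iff_injective, show (aeval (τ.1 x) : ℂ[X] →ₐ[ℂ] L) =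
      τ.1.toAlgHom.comp (aeval x) by ext; simp, AlgHom.coe_comp]
    exact (EquivLike.injective τ.1).comp (transcendental_iff_injective.1 hx)
  have hA₁ : A₁ ≠ 0 := by
    rintro rfl
    rw [mul_zero] at hA
    simp [hA] at hAB
  have hxT := mem_integralOverAdjoin_of_aeval_eq hAB h
  refine _root_.ratDeg_le_of_separated D hD hx hy hM.transcendental_right hA₁ hB (hA ▸ h)
    (hA ▸ hM.apply_aeval_eq h τ.2) (fun σ : G => v.comap (σ.1 : L →+* L))
    (fun σ c => by simpa using hM.map_algebraMap_le c) (integralOverAdjoin ℂ z) hxT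
    (mem_integralOverAdjoin_map τ.1.toAlgHom (hM.apply_right τ.1 τ.2) hxT)
    (fun a ha ha0 => hM.sum_log_nonneg (hM.one_lt_right hAB hB h) ha ha0) ?_ hℓ
    (fun a b hab => hsep a b (hab.trans_eq ?_))
  · have h1 : τ.1 (RatFunc.substHom x hx f) = RatFunc.substHom x hx f := by
      have hle : IntermediateField.adjoin ℂ {z} ≤
          IntermediateField.fixedField (Subgroup.zpowers τ.1) := by
        rw [IntermediateField.adjoin_simple_le_iff, IntermediateField.mem_fixedField_iff]
        intro σ hσ
        exact hM.apply_right σ ((Subgroup.zpowers_le.2 τ.2) hσ)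
      exact (IntermediateField.mem_fixedField_iff _ _).1 (hle hf) τ.1 (Subgroup.mem_zpowers _)
    rw [← h1]
    have h2 : τ.1.toAlgHom.comp (RatFunc.substHom x hx) = RatFunc.substHom (τ.1 x) hy := by
      refine RatFunc.algHom_ext_of_X ?_
      rw [AlgHom.comp_apply, RatFunc.substHom_X, RatFunc.substHom_X]
      rfl
    exact DFunLike.congr_fun h2 f
  · have hreindex : ∑ σ : G, max 0 (log (v ((σ * τ).1 x))) = ∑ σ : G, max 0 (log (v (σ.1 x))) :=
      Fintype.sum_equiv (Equiv.mulRight τ) _ _ fun σ => rfl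
    have : ∑ σ : G, (max 0 (log (v (σ.1 x))) + max 0 (log (v ((σ * τ).1 x)))) =
        2 * ∑ σ : G, max 0 (log (v (σ.1 x))) := by
      rw [Finset.sum_add_distrib, hreindex, two_mul]
    calc _ = 2 * ((ℓ ^ 4 * (A₁.natDegree + B.natDegree) : ℕ) : ℤ) *
        ∑ σ : G, (max 0 (log (v (σ.1 x))) + max 0 (log (v ((σ * τ).1 x)))) := rfl
      _ = _ := by rw [this]; ring

end IsGaloisModel

theorem exists_mul_sum_le_mul_sum_filter {G : Type*} [Group G] [Fintype G] {W : G → ℤ}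
    (hW : ∀ σ, 0 ≤ W σ) {b d : ℕ}
    (hcard : b * Fintype.card G ≤ d * (Finset.univ.filter fun σ => W σ = 0).card) :
    ∃ τ : G, b * ∑ σ, W σ ≤ d * ∑ σ, if W (σ * τ) = 0 then W σ else 0 := by
  have hdouble : ∑ τ, ∑ σ, (if W (σ * τ) = 0 then W σ else 0) =
      (∑ σ, W σ) * (Finset.univ.filter fun σ => W σ = 0).card := by
    rw [Finset.sum_comm, Finset.sum_mul]
    refine Finset.sum_congr rfl fun σ _ => ?_
    rw [Fintype.sum_equiv (Equiv.mulLeft σ) (fun τ => if W (σ * τ) = 0 then W σ else 0)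
      (fun τ => if W τ = 0 then W σ else 0) fun τ => rfl, ← Finset.sum_filter, Finset.sum_const,
      nsmul_eq_mul, mul_comm]
  have hS : 0 ≤ ∑ σ, W σ := Finset.sum_nonneg fun σ _ => hW σ
  obtain ⟨τ, -, hτ⟩ := Finset.exists_le_of_sum_le (s := (Finset.univ : Finset G))
    (f := fun _ => (b : ℤ) * ∑ σ, W σ)
    (g := fun τ => (d : ℤ) * ∑ σ, if W (σ * τ) = 0 then W σ else 0) Finset.univ_nonempty (by
      rw [← Finset.mul_sum, ← Finset.mul_sum, hdouble, Finset.sum_const, Finset.card_univ,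
        nsmul_eq_mul]
      have : (b : ℤ) * Fintype.card G ≤ d * (Finset.univ.filter fun σ => W σ = 0).card := by
        exact_mod_cast hcard
      nlinarith)
  exact ⟨τ, hτ⟩

namespace IsGaloisModel

variable {L : Type*} [Field L] [Algebra ℂ L] {x z : L} {G : Subgroup (L ≃ₐ[ℂ] L)}
  {v : Valuation L ℤᵐ⁰}

theorem log_cases (hM : IsGaloisModel x z G v) {A B : ℂ[X]} (hA0 : A.coeff 0 = 0)
    (hB0 : B.coeff 0 ≠ 0) (hAB : B.natDegree < A.natDegree) (hcop : IsCoprime A B)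
    (h : aeval x A = z * aeval x B) {σ : L ≃ₐ[ℂ] L} (hσ : σ ∈ G) :
    (log (v (σ x)) = 0 ∧ - log (v (aeval (σ x) B)) = log (v z)) ∨
    (0 < log (v (σ x)) ∧
      ((A.natDegree : ℤ) - B.natDegree) * log (v (σ x)) = log (v z) ∧
      log (v (aeval (σ x) B)) = B.natDegree * log (v (σ x))) := by
  have hA : A ≠ 0 := by rintro rfl; simp at hAB
  have hB : B ≠ 0 := by rintro rfl; simp at hB0
  have hy0 : σ x ≠ 0 := by simpa using hM.left_ne_zero
  have hvy : v (σ x) ≠ 0 := v.ne_zero_iff.2 hy0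
  have hz := hM.one_lt_right hAB hB h
  have hz0 : v z ≠ 0 := (zero_lt_one.trans hz).ne'
  have hBy : aeval (σ x) B ≠ 0 := by
    rw [show aeval (σ x) B = σ (aeval x B) from aeval_algHom_apply σ.toAlgHom x B]
    simpa using hM.aeval_ne_zero hB
  have hrel := congrArg v (hM.apply_aeval_eq h hσ)
  rw [map_mul] at hrel
  rcases lt_trichotomy (v (σ x)) 1 with hlt | heq | hgt
  · have h1 := v.aeval_lt_one hM.map_algebraMap_le hlt hA0
    rw [hrel, v.aeval_eq_one hM.map_algebraMap hlt hB0, mul_one] at h1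
    exact absurd h1 (not_lt.2 hz.le)
  · left
    have hAle := v.aeval_le_one hM.map_algebraMap_le heq.le A
    have hBlt : v (aeval (σ x) B) < 1 := by
      by_contra! hge
      exact absurd (hz.trans_le (le_mul_of_one_le_right' hge)) (not_lt.2 (hrel ▸ hAle))
    have hAone : v (aeval (σ x) A) = 1 := by
      refine le_antisymm hAle ?_
      by_contra! hlt
      obtain ⟨u, w, huw⟩ := hcop
      have h1 := congrArg (fun p => v (aeval (σ x) p)) huw
      simp only [map_add, map_mul, map_one] at h1
      have h2 : v (aeval (σ x) u * aeval (σ x) A + aeval (σ x) w * aeval (σ x) B) < 1 := by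
        refine v.map_add_lt ?_ ?_
        · rw [map_mul]
          exact (mul_le_of_le_one_left' (v.aeval_le_one hM.map_algebraMap_le heq.le u)).trans_lt hlt
        · rw [map_mul]
          exact (mul_le_of_le_one_left' (v.aeval_le_one hM.map_algebraMap_le heq.le w)).trans_lt
            hBlt
      exact absurd h1 h2.ne
    refine ⟨by rw [heq, log_one], ?_⟩
    have := congrArg log hrel
    rw [hAone, log_one, log_mul hz0 (v.ne_zero_iff.2 hBy)] at this
    linarith
  · right
    refine ⟨(log_pos_iff hvy).2 hgt, ?_, ?_⟩
    · rw [v.aeval_eq_pow_natDegree hM.map_algebraMap hgt hA,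
        v.aeval_eq_pow_natDegree hM.map_algebraMap hgt hB] at hrel
      have := congrArg log hrel
      rw [log_mul hz0 (pow_ne_zero _ hvy), log_pow, log_pow, nsmul_eq_mul, nsmul_eq_mul] at this
      linarith
    · rw [v.aeval_eq_pow_natDegree hM.map_algebraMap hgt hB, log_pow, nsmul_eq_mul]

theorem mul_card_le (hM : IsGaloisModel x z G v) [Fintype G] {A B : ℂ[X]} (hA0 : A.coeff 0 = 0)
    (hB0 : B.coeff 0 ≠ 0) (hAB : B.natDegree < A.natDegree) (hcop : IsCoprime A B)
    (h : aeval x A = z * aeval x B) :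
    B.natDegree * Fintype.card G ≤
      A.natDegree * (Finset.univ.filter fun σ : G => log (v (σ.1 x)) = 0).card := by
  have hB : B ≠ 0 := by rintro rfl; simp at hB0
  have hz := hM.one_lt_right hAB hB h
  have hlz : 0 < log (v z) := (log_pos_iff (zero_lt_one.trans hz).ne').2 hz
  have hsum := hM.sum_log_nonneg hz (hM.inv_aeval_mem_integralOverAdjoin hAB hcop hB h)
    (inv_ne_zero (hM.aeval_ne_zero hB))
  have hpt : ∀ σ : G, ((A.natDegree : ℤ) - B.natDegree) * log (v (σ.1 (aeval x B)⁻¹)) =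
      A.natDegree * (if log (v (σ.1 x)) = 0 then log (v z) else 0) - B.natDegree * log (v z) := by
    intro σ
    rw [map_inv₀, map_inv₀, log_inv,
      ← show aeval (σ.1 x) B = σ.1 (aeval x B) from aeval_algHom_apply σ.1.toAlgHom x B]
    rcases hM.log_cases hA0 hB0 hAB hcop h σ.2 with ⟨h1, h2⟩ | ⟨h1, h2, h3⟩
    · rw [if_pos h1, h2]; ring
    · rw [if_neg h1.ne', h3, ← h2]; ring
  have hnn : (0 : ℤ) ≤ (A.natDegree : ℤ) - B.natDegree := by omega
  have := mul_nonneg hnn hsum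
  rw [Finset.mul_sum, Finset.sum_congr rfl fun σ _ => hpt σ, Finset.sum_sub_distrib,
    ← Finset.mul_sum, ← Finset.sum_filter, Finset.sum_const, Finset.sum_const, Finset.card_univ,
    nsmul_eq_mul, nsmul_eq_mul] at this
  have h3 : (B.natDegree * Fintype.card G : ℤ) ≤
      A.natDegree * (Finset.univ.filter fun σ : G => log (v (σ.1 x)) = 0).card := by
    refine le_of_mul_le_mul_right ?_ hlz
    linarith
  exact_mod_cast h3

theorem ratDeg_le_of_natDegree_le (hM : IsGaloisModel x z G v) {A A₁ B : ℂ[X]} {m : ℕ}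
    (hm : m ≠ 0) (hA : A = X ^ m * A₁) (hB0 : B.coeff 0 ≠ 0) (hAB : B.natDegree < A.natDegree)
    (hcop : IsCoprime A B) (hBpos : 0 < B.natDegree) (hle : A₁.natDegree ≤ B.natDegree)
    (h : aeval x A = z * aeval x B) {f : RatFunc ℂ}
    (hf : RatFunc.substHom x hM.transcendental_left f ∈ IntermediateField.adjoin ℂ {z})
    {ℓ : ℕ} (hℓ : Nsharp f ≤ ℓ) : ratDeg f ≤ 8 * A.natDegree * ℓ ^ 4 * ℓ := by
  have := hM.finite
  have := Fintype.ofFinite G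
  have hA0 : A.coeff 0 = 0 := by
    rw [hA, mul_coeff_zero, coeff_X_pow, if_neg hm.symm, zero_mul]
  have hB : B ≠ 0 := by rintro rfl; simp at hB0
  have hW : ∀ σ : G, 0 ≤ log (v (σ.1 x)) := fun σ => by
    rcases hM.log_cases hA0 hB0 hAB hcop h σ.2 with ⟨h1, -⟩ | ⟨h1, -⟩
    · exact h1.ge
    · exact h1.le
  obtain ⟨τ, hτ⟩ := exists_mul_sum_le_mul_sum_filter hW (hM.mul_card_le hA0 hB0 hAB hcop h)
  have hpos : 0 < ∑ σ : G, log (v (σ.1 x)) := by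
    refine Finset.sum_pos' (fun σ _ => hW σ) ⟨1, Finset.mem_univ _, ?_⟩
    have h0 := v.ne_zero_iff.2 hM.left_ne_zero
    exact (log_pos_iff h0).2 hM.one_lt
  refine hM.ratDeg_le_of_separated hA hAB hB h hf hℓ τ fun a b hab => ?_
  rw [Finset.sum_congr rfl fun σ _ => max_eq_right (hW σ)] at hab
  set S := ∑ σ : G, log (v (σ.1 x)) with hS
  have h1 : |a| * ∑ σ : G, (if log (v ((σ * τ).1 x)) = 0 then log (v (σ.1 x)) else 0) ≤
      ∑ σ : G, |a * log (v (σ.1 x)) + b * log (v ((σ * τ).1 x))| := by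
    rw [Finset.mul_sum]
    refine Finset.sum_le_sum fun σ _ => ?_
    split_ifs with h0
    · rw [h0, mul_zero, add_zero, abs_mul, abs_of_nonneg (hW σ)]
    · rw [mul_zero]; exact abs_nonneg _
  have h2 : ((ℓ ^ 4 * (A₁.natDegree + B.natDegree) : ℕ) : ℤ) ≤ ℓ ^ 4 * (2 * B.natDegree) := by
    have : ℓ ^ 4 * (A₁.natDegree + B.natDegree) ≤ ℓ ^ 4 * (2 * B.natDegree) :=
      Nat.mul_le_mul_left _ (by omega)
    exact_mod_cast this
  have hBS : 0 < (B.natDegree : ℤ) * S := mul_pos (by exact_mod_cast hBpos) hpos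
  refine le_of_mul_le_mul_right ?_ hBS
  calc |a| * (B.natDegree * S) ≤
      |a| * (A.natDegree * ∑ σ : G, if log (v ((σ * τ).1 x)) = 0 then log (v (σ.1 x)) else 0) :=
        mul_le_mul_of_nonneg_left hτ (abs_nonneg a)
    _ = A.natDegree *
        (|a| * ∑ σ : G, if log (v ((σ * τ).1 x)) = 0 then log (v (σ.1 x)) else 0) := by ring
    _ ≤ A.natDegree * (4 * (ℓ ^ 4 * (2 * B.natDegree)) * S) := by
        refine mul_le_mul_of_nonneg_left ((h1.trans hab).trans ?_) (by positivity)
        exact mul_le_mul_of_nonneg_right (by linarith) hpos.le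
    _ = _ := by push_cast; ring

end IsGaloisModel

theorem eq_C_of_ratDeg_eq_zero {f : RatFunc ℂ} (h : ratDeg f = 0) : ∃ c, f = RatFunc.C c := by
  rw [ratDeg, Nat.max_eq_zero_iff] at h
  rw [← RatFunc.num_div_denom f, eq_C_of_natDegree_eq_zero h.1, eq_C_of_natDegree_eq_zero h.2]
  exact ⟨f.num.coeff 0 / f.denom.coeff 0, by simp⟩

theorem finiteDimensional_adjoin_simple {y : RatFunc ℂ} (hy : ¬∃ c, y = RatFunc.C c) :
    FiniteDimensional (IntermediateField.adjoin ℂ {y}) (RatFunc ℂ) := by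
  refine Module.finite_of_finrank_pos ?_
  rw [RatFunc.finrank_eq_max_natDegree]
  exact Nat.pos_of_ne_zero fun h => hy (eq_C_of_ratDeg_eq_zero h)

theorem exists_isGaloisModel {y : RatFunc ℂ} (hy : ¬∃ c, y = RatFunc.C c) :
    ∃ (L : Type) (_ : Field L) (_ : Algebra ℂ L) (ι : RatFunc ℂ →ₐ[ℂ] L)
      (G : Subgroup (L ≃ₐ[ℂ] L)) (v : Valuation L ℤᵐ⁰),
      IsGaloisModel (ι RatFunc.X) (ι y) G v := by
  have hfin := finiteDimensional_adjoin_simple hy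
  set K := IntermediateField.adjoin ℂ {y} with hK
  have halg : Algebra.IsAlgebraic K (AlgebraicClosure (RatFunc ℂ)) :=
    Algebra.IsAlgebraic.trans K (RatFunc ℂ) _
  have hclosure : IsAlgClosure K (AlgebraicClosure (RatFunc ℂ)) := ⟨inferInstance, halg⟩
  have hnormal : Normal K (AlgebraicClosure (RatFunc ℂ)) := IsAlgClosure.normal K _
  let L := IntermediateField.normalClosure K (RatFunc ℂ) (AlgebraicClosure (RatFunc ℂ))
  have : CharZero K := charZero_of_injective_algebraMap (algebraMap ℂ K).injective
  have hnL : Normal K L := normalClosure.normal K (RatFunc ℂ) _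
  have hgal : IsGalois K L := ⟨⟩
  have hfL : FiniteDimensional K L := normalClosure.is_finiteDimensional K (RatFunc ℂ) _
  have hfEL : FiniteDimensional (RatFunc ℂ) L := FiniteDimensional.right K (RatFunc ℂ) L
  have hgalE : IsGalois (RatFunc ℂ) L := IsGalois.tower_top_of_isGalois K (RatFunc ℂ) L
  have htower : IsScalarTower ℂ (RatFunc ℂ) L := IsScalarTower.of_algebraMap_eq fun c => by
    rw [IsScalarTower.algebraMap_apply ℂ K L, IsScalarTower.algebraMap_apply K (RatFunc ℂ) L,
      ← IsScalarTower.algebraMap_apply ℂ K (RatFunc ℂ)]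
  let ι : RatFunc ℂ →ₐ[ℂ] L := IsScalarTower.toAlgHom ℂ (RatFunc ℂ) L
  obtain ⟨v, hv1, hvc⟩ := exists_valuation_one_lt_X (algebraMap (RatFunc ℂ) L)
    (RingHom.finite_algebraMap.2 hfEL)
  obtain ⟨D, hD⟩ := exists_derivation_eq_one (k := ℂ) (L := L)
  have hι : ∀ a, ι a = algebraMap (RatFunc ℂ) L a := fun a => rfl
  have htr : ∀ a : RatFunc ℂ, Transcendental ℂ a → Transcendental ℂ (ι a) := fun a ha =>
    (transcendental_algebraMap_iff (algebraMap (RatFunc ℂ) L).injective).2 ha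
  refine ⟨L, inferInstance, inferInstance, ι, (AlgEquiv.restrictScalarsHom ℂ :
    (L ≃ₐ[K] L) →* (L ≃ₐ[ℂ] L)).range, v, ?_⟩
  have hmap : ∀ b : RatFunc ℂ, ∀ a ∈ IntermediateField.adjoin ℂ {b},
      ι a ∈ IntermediateField.adjoin ℂ {ι b} := by
    intro b a ha
    have := IntermediateField.adjoin_map ℂ {b} ι
    rw [Set.image_singleton] at this
    rw [← this]
    exact ⟨a, ha, rfl⟩
  have hfinite : Finite (L ≃ₐ[K] L) := Fintype.finite (AlgEquiv.fintype K L)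
  refine ⟨htr _ RatFunc.transcendental_X, htr _ (RatFunc.transcendental_of_ne_C y hy),
    Finite.of_surjective _ (MonoidHom.rangeRestrict_surjective _), ?_, ?_, ?_, hv1,
    fun c hc => ?_, D, fun a ha => ?_⟩
  · rintro _ ⟨σ, rfl⟩
    exact σ.commutes ⟨y, IntermediateField.mem_adjoin_simple_self ℂ y⟩
  · intro a ha
    obtain ⟨b, rfl⟩ := (IsGalois.mem_range_algebraMap_iff_fixed (F := K) a).2 fun σ =>
      ha _ ⟨σ, rfl⟩
    exact hmap y b.1 b.2
  · intro a ha
    obtain ⟨b, rfl⟩ := (IsGalois.mem_range_algebraMap_iff_fixed (F := RatFunc ℂ) a).2 fun σ =>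
      ha (AlgEquiv.restrictScalarsHom ℂ (σ.restrictScalars K)) ⟨_, rfl⟩ (σ.commutes RatFunc.X)
    exact hmap RatFunc.X b (by rw [RatFunc.adjoin_X]; trivial)
  · rw [IsScalarTower.algebraMap_apply ℂ (RatFunc ℂ) L, RatFunc.algebraMap_eq_C]
    exact hvc c hc
  · exact Derivation.exists_algebraMap_eq_of_eq_zero D (x := algebraMap (RatFunc ℂ) L RatFunc.X)
      (by rw [hD]; exact one_ne_zero) ha

namespace RatFunc

theorem ne_C_of_transcendental {y : RatFunc ℂ} (hy : Transcendental ℂ y) : ¬∃ c, y = C c := by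
  rintro ⟨c, rfl⟩
  exact hy (isAlgebraic_algebraMap c)

theorem finrank_adjoin_simple (y : RatFunc ℂ) :
    Module.finrank (IntermediateField.adjoin ℂ {y}) (RatFunc ℂ) = ratDeg y :=
  finrank_eq_max_natDegree y

theorem ratDeg_pos {y : RatFunc ℂ} (hy : Transcendental ℂ y) : 0 < ratDeg y :=
  Nat.pos_of_ne_zero fun h => ne_C_of_transcendental hy (eq_C_of_ratDeg_eq_zero h)

theorem map_substHom_adjoin {L : Type*} [Field L] [Algebra ℂ L] {g : L} (hg : Transcendental ℂ g)
    (f : RatFunc ℂ) : (IntermediateField.adjoin ℂ {f}).map (substHom g hg) =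
      IntermediateField.adjoin ℂ {substHom g hg f} := by
  rw [IntermediateField.adjoin_map, Set.image_singleton]

theorem exists_substHom_eq {L : Type*} [Field L] [Algebra ℂ L] {g h : L} (hg : Transcendental ℂ g)
    (hh : h ∈ IntermediateField.adjoin ℂ {g}) : ∃ f, substHom g hg f = h := by
  rwa [← fieldRange_substHom g hg] at hh

theorem substHom_mem_adjoin {L : Type*} [Field L] [Algebra ℂ L] {g : L} (hg : Transcendental ℂ g)
    (f : RatFunc ℂ) : substHom g hg f ∈ IntermediateField.adjoin ℂ {g} := by
  rw [← fieldRange_substHom g hg]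
  exact ⟨f, rfl⟩

theorem ratDeg_le_of_adjoin_le {y z : RatFunc ℂ} (hy : Transcendental ℂ y)
    (h : IntermediateField.adjoin ℂ {y} ≤ IntermediateField.adjoin ℂ {z}) :
    ratDeg z ≤ ratDeg y := by
  have := IntermediateField.relfinrank_mul_finrank_top h
  rw [finrank_adjoin_simple, finrank_adjoin_simple] at this
  have h2 := ratDeg_pos hy
  rw [← this] at h2 ⊢
  exact Nat.le_mul_of_pos_left _ (Nat.pos_of_mul_pos_right h2)

theorem ratDeg_substHom {g : RatFunc ℂ} (hg : Transcendental ℂ g) (f : RatFunc ℂ) :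
    ratDeg (substHom g hg f) = ratDeg f * ratDeg g := by
  have h : IntermediateField.adjoin ℂ {substHom g hg f} ≤ IntermediateField.adjoin ℂ {g} :=
    IntermediateField.adjoin_simple_le_iff.2 (substHom_mem_adjoin hg f)
  have := IntermediateField.relfinrank_mul_finrank_top h
  rw [finrank_adjoin_simple, finrank_adjoin_simple, ← map_substHom_adjoin,
    ← fieldRange_substHom g hg, AlgHom.fieldRange_eq_map, IntermediateField.relfinrank_map_map,
    IntermediateField.relfinrank_top_right, finrank_adjoin_simple] at this
  exact this.symm

theorem exists_eq_div_of_ratDeg_eq_one {S : RatFunc ℂ} (hS : ratDeg S = 1) :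
    ∃ α β γ δ : ℂ, α * δ - β * γ ≠ 0 ∧ S = (C α * X + C β) / (C γ * X + C δ) := by
  rw [ratDeg] at hS
  have h1 : S.num.natDegree ≤ 1 := by omega
  have h2 : S.denom.natDegree ≤ 1 := by omega
  obtain ⟨α, β, hn⟩ := exists_eq_X_add_C_of_natDegree_le_one h1
  obtain ⟨γ, δ, hd⟩ := exists_eq_X_add_C_of_natDegree_le_one h2
  refine ⟨α, β, γ, δ, fun h0 => ?_, ?_⟩
  · obtain ⟨u, w, huw⟩ := isCoprime_num_denom S
    rw [hn, hd] at huw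
    by_cases hαγ : α = 0 ∧ γ = 0
    · rw [hn, hd, hαγ.1, hαγ.2] at hS
      simp at hS
    · by_cases hα : α = 0
      · have hγ : γ ≠ 0 := fun h => hαγ ⟨hα, h⟩
        have hβ : β = 0 := by
          have : β * γ = 0 := by rw [hα] at h0; linear_combination -h0
          exact (mul_eq_zero.1 this).resolve_right hγ
        have := congrArg (Polynomial.eval (-δ / γ)) huw
        simp [hα, hβ] at this
        field_simp at this
        simp at this
      · have := congrArg (Polynomial.eval (-β / α)) huw
        simp only [Polynomial.eval_add, Polynomial.eval_mul, Polynomial.eval_C, Polynomial.eval_X,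
          Polynomial.eval_one] at this
        have e1 : α * (-β / α) + β = 0 := by field_simp; ring
        have e2 : γ * (-β / α) + δ = 0 := by field_simp; linear_combination h0
        rw [e1, e2] at this
        simp at this
  · conv_lhs => rw [← num_div_denom S, hn, hd]
    simp

theorem exists_moebius_of_adjoin_eq {y z : RatFunc ℂ} (hz : Transcendental ℂ z)
    (h : IntermediateField.adjoin ℂ {y} = IntermediateField.adjoin ℂ {z}) :
    ∃ α β γ δ : ℂ, α * δ - β * γ ≠ 0 ∧ y = (C α * z + C β) / (C γ * z + C δ) := by
  obtain ⟨S, rfl⟩ := exists_substHom_eq hz (h ▸ IntermediateField.mem_adjoin_simple_self ℂ y)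
  have h1 : ratDeg (substHom z hz S) = ratDeg z := by
    rw [← finrank_adjoin_simple, h, finrank_adjoin_simple]
  rw [ratDeg_substHom] at h1
  obtain ⟨α, β, γ, δ, hdet, hS⟩ :=
    exists_eq_div_of_ratDeg_eq_one
      (Nat.eq_of_mul_eq_mul_right (ratDeg_pos hz) (h1.trans (one_mul _).symm))
  refine ⟨α, β, γ, δ, hdet, ?_⟩
  conv_lhs => rw [hS]
  have hc : ∀ c : ℂ, substHom z hz (C c) = C c := fun c => (substHom z hz).commutes c
  simp only [map_div₀, map_add, map_mul, hc, substHom_X]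

theorem natDegree_le_ratDeg {y : RatFunc ℂ} {A B : ℂ[X]} (hB : B ≠ 0) (hcop : IsCoprime A B)
    (hy : y = algebraMap ℂ[X] (RatFunc ℂ) A / algebraMap ℂ[X] (RatFunc ℂ) B) :
    A.natDegree ≤ ratDeg y := by
  rcases eq_or_ne A 0 with rfl | hA
  · simp
  have hrel : y.num * B = A * y.denom := (num_mul_eq_mul_denom_iff hB).2 hy
  have hdvd : A ∣ y.num := hcop.dvd_of_dvd_mul_right ⟨_, hrel⟩
  have hy0 : y.num ≠ 0 := by
    intro h0
    rw [h0, zero_mul] at hrel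
    exact mul_ne_zero hA y.denom_ne_zero hrel.symm
  exact (natDegree_le_of_dvd hdvd hy0).trans (le_max_left _ _)

theorem adjoin_inv (y : RatFunc ℂ) :
    IntermediateField.adjoin ℂ {y⁻¹} = IntermediateField.adjoin ℂ {y} := by
  refine le_antisymm ?_ ?_ <;> rw [IntermediateField.adjoin_simple_le_iff]
  · exact inv_mem (IntermediateField.mem_adjoin_simple_self ℂ y)
  · simpa using inv_mem (IntermediateField.mem_adjoin_simple_self ℂ y⁻¹)

theorem adjoin_sub_C (y : RatFunc ℂ) (c : ℂ) :
    IntermediateField.adjoin ℂ {y - C c} = IntermediateField.adjoin ℂ {y} := by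
  have hc : ∀ K : IntermediateField ℂ (RatFunc ℂ), C c ∈ K := fun K => K.algebraMap_mem c
  refine le_antisymm ?_ ?_ <;> rw [IntermediateField.adjoin_simple_le_iff]
  · exact sub_mem (IntermediateField.mem_adjoin_simple_self ℂ y) (hc _)
  · simpa using add_mem (IntermediateField.mem_adjoin_simple_self ℂ (y - C c)) (hc _)

theorem div_sub_C {A B : ℂ[X]} (hB : B ≠ 0) (c : ℂ) :
    algebraMap ℂ[X] (RatFunc ℂ) A / algebraMap ℂ[X] (RatFunc ℂ) B - C c =
      algebraMap ℂ[X] (RatFunc ℂ) (A - Polynomial.C c * B) / algebraMap ℂ[X] (RatFunc ℂ) B := by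
  rw [map_sub, map_mul, algebraMap_C, sub_div, mul_div_assoc, div_self (algebraMap_ne_zero hB),
    mul_one]

theorem isCoprime_sub_C_mul {A B : ℂ[X]} (h : IsCoprime A B) (c : ℂ) :
    IsCoprime (A - Polynomial.C c * B) B := by
  rw [sub_eq_add_neg, ← neg_mul]
  exact h.add_mul_right_left _

theorem exists_adjoin_eq_natDegree_lt' {y : RatFunc ℂ} (hy : Transcendental ℂ y) :
    ∃ A B : ℂ[X], IsCoprime A B ∧ B ≠ 0 ∧ B.natDegree < A.natDegree ∧
      IntermediateField.adjoin ℂ {algebraMap ℂ[X] (RatFunc ℂ) A / algebraMap ℂ[X] (RatFunc ℂ) B} =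
        IntermediateField.adjoin ℂ {y} := by
  have hne := ne_C_of_transcendental hy
  have hd := y.denom_ne_zero
  have hn : y.num ≠ 0 := fun h => hne ⟨0, by rw [num_eq_zero_iff.1 h, map_zero]⟩
  rcases lt_trichotomy y.num.natDegree y.denom.natDegree with h | h | h
  · refine ⟨y.denom, y.num, y.isCoprime_num_denom.symm, hn, h, ?_⟩
    rw [← inv_div, num_div_denom, adjoin_inv]
  · set c := y.num.leadingCoeff / y.denom.leadingCoeff with hc
    have hlc : y.denom.leadingCoeff ≠ 0 := leadingCoeff_ne_zero.2 hd
    have hlc' : y.num.leadingCoeff ≠ 0 := leadingCoeff_ne_zero.2 hn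
    have hc0 : c ≠ 0 := div_ne_zero hlc' hlc
    have hsub := div_sub_C (A := y.num) hd c
    rw [num_div_denom] at hsub
    have h0 : y.num - Polynomial.C c * y.denom ≠ 0 := by
      intro h0
      rw [h0, map_zero, zero_div, sub_eq_zero] at hsub
      exact hne ⟨c, hsub⟩
    have hpos : 0 < y.denom.natDegree := by
      have := ratDeg_pos hy
      rw [ratDeg, h, max_self] at this
      exact this
    refine ⟨y.denom, y.num - Polynomial.C c * y.denom, (isCoprime_sub_C_mul
      y.isCoprime_num_denom c).symm, h0, ?_, ?_⟩
    · rw [← h] at hpos ⊢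
      refine natDegree_lt_natDegree h0 (degree_sub_lt_left ?_ hn ?_)
      · rw [degree_C_mul hc0, degree_eq_natDegree hn, degree_eq_natDegree hd, h]
      · rw [leadingCoeff_mul, leadingCoeff_C, hc, div_mul_cancel₀ _ hlc]
    · rw [← inv_div, ← hsub, adjoin_inv, adjoin_sub_C]
  · exact ⟨y.num, y.denom, y.isCoprime_num_denom, hd, h, by rw [num_div_denom]⟩

theorem exists_adjoin_eq_natDegree_lt {y : RatFunc ℂ} (hy : Transcendental ℂ y) :
    ∃ A B : ℂ[X], IsCoprime A B ∧ B ≠ 0 ∧ B.natDegree < A.natDegree ∧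
      (A.coeff 0 = 0 ∨ B.coeff 0 = 0) ∧
      IntermediateField.adjoin ℂ {algebraMap ℂ[X] (RatFunc ℂ) A / algebraMap ℂ[X] (RatFunc ℂ) B} =
        IntermediateField.adjoin ℂ {y} := by
  obtain ⟨A, B, hcop, hB, hlt, had⟩ := exists_adjoin_eq_natDegree_lt' hy
  by_cases h0 : B.coeff 0 = 0
  · exact ⟨A, B, hcop, hB, hlt, Or.inr h0, had⟩
  · refine ⟨A - Polynomial.C (A.coeff 0 / B.coeff 0) * B, B, isCoprime_sub_C_mul hcop _, hB, ?_,
      Or.inl ?_, ?_⟩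
    · rwa [natDegree_sub_eq_left_of_natDegree_lt]
      exact (natDegree_C_mul_le _ _).trans_lt hlt
    · rw [coeff_sub, coeff_C_mul, div_mul_cancel₀ _ h0, sub_self]
    · rw [← div_sub_C hB, adjoin_sub_C, had]

theorem transcendental_div {A B : ℂ[X]} (hB : B ≠ 0) (hcop : IsCoprime A B)
    (hAB : B.natDegree < A.natDegree) :
    Transcendental ℂ (algebraMap ℂ[X] (RatFunc ℂ) A / algebraMap ℂ[X] (RatFunc ℂ) B) := by
  refine transcendental_of_ne_C _ ?_
  rintro ⟨c, hc⟩
  have := natDegree_le_ratDeg hB hcop rfl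
  rw [hc, ratDeg, num_C, denom_C] at this
  simp at this
  omega

theorem aeval_algHom_eq {L : Type*} [Field L] [Algebra ℂ L] (ι : RatFunc ℂ →ₐ[ℂ] L) {A B : ℂ[X]}
    (hB : B ≠ 0) : aeval (ι X) A =
      ι (algebraMap ℂ[X] (RatFunc ℂ) A / algebraMap ℂ[X] (RatFunc ℂ) B) * aeval (ι X) B := by
  rw [← algHom_algebraMap, ← algHom_algebraMap, ← map_mul,
    div_mul_cancel₀ _ (algebraMap_ne_zero hB)]

theorem substHom_algHom_eq {L : Type*} [Field L] [Algebra ℂ L] (ι : RatFunc ℂ →ₐ[ℂ] L)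
    (hX : Transcendental ℂ (ι X)) (h : RatFunc ℂ) : substHom (ι X) hX h = ι h := by
  have : substHom (ι X) hX = ι := algHom_ext_of_X (substHom_X _ _)
  rw [this]

theorem algHom_mem_adjoin {L : Type*} [Field L] [Algebra ℂ L] (ι : RatFunc ℂ →ₐ[ℂ] L)
    {h y : RatFunc ℂ} (hh : h ∈ IntermediateField.adjoin ℂ {y}) :
    ι h ∈ IntermediateField.adjoin ℂ {ι y} := by
  have := IntermediateField.adjoin_map ℂ {y} ι
  rw [Set.image_singleton] at this
  rw [← this]
  exact ⟨h, hh, rfl⟩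

theorem ratDeg_le_of_natDegree_le {A A₁ B : ℂ[X]} {m : ℕ}
    (hm : m ≠ 0) (hA : A = Polynomial.X ^ m * A₁) (hB0 : B.coeff 0 ≠ 0)
    (hAB : B.natDegree < A.natDegree) (hcop : IsCoprime A B) (hBpos : 0 < B.natDegree)
    (hle : A₁.natDegree ≤ B.natDegree) {h : RatFunc ℂ}
    (hh : h ∈ IntermediateField.adjoin ℂ
      {algebraMap ℂ[X] (RatFunc ℂ) A / algebraMap ℂ[X] (RatFunc ℂ) B})
    {ℓ : ℕ} (hℓ : Nsharp h ≤ ℓ) : ratDeg h ≤ 8 * A.natDegree * ℓ ^ 4 * ℓ := by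
  have hB : B ≠ 0 := by rintro rfl; simp at hB0
  obtain ⟨L, _, _, ι, G, v, hM⟩ :=
    exists_isGaloisModel (ne_C_of_transcendental (transcendental_div hB hcop hAB))
  refine hM.ratDeg_le_of_natDegree_le hm hA hB0 hAB hcop hBpos hle (aeval_algHom_eq ι hB) ?_ hℓ
  rw [substHom_algHom_eq]
  exact algHom_mem_adjoin ι hh

theorem substHom_X_inv_algebraMap (p : ℂ[X]) :
    substHom X⁻¹ transcendental_X_inv (algebraMap ℂ[X] (RatFunc ℂ) p) =
      algebraMap ℂ[X] (RatFunc ℂ) p.reverse / X ^ p.natDegree := by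
  let : Invertible (X⁻¹ : RatFunc ℂ) := ⟨X, mul_inv_cancel₀ X_ne_zero, inv_mul_cancel₀ X_ne_zero⟩
  have := eval₂_reverse_mul_pow (algebraMap ℂ (RatFunc ℂ)) (X⁻¹ : RatFunc ℂ) p
  rw [substHom_algebraMap, aeval_def, ← this, inv_pow, div_eq_mul_inv]
  congr 1
  exact aeval_X_left_eq_algebraMap p.reverse

theorem substHom_X_inv_div (A B : ℂ[X]) :
    substHom X⁻¹ transcendental_X_inv
        (algebraMap ℂ[X] (RatFunc ℂ) A / algebraMap ℂ[X] (RatFunc ℂ) B) =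
      algebraMap ℂ[X] (RatFunc ℂ) (Polynomial.X ^ B.natDegree * A.reverse) /
        algebraMap ℂ[X] (RatFunc ℂ) (Polynomial.X ^ A.natDegree * B.reverse) := by
  rw [map_div₀, substHom_X_inv_algebraMap, substHom_X_inv_algebraMap, div_div_div_eq,
    map_mul, map_mul, map_pow, map_pow, algebraMap_X, mul_comm]

theorem card_support_X_pow_mul_reverse_le (n : ℕ) (p : ℂ[X]) :
    (Polynomial.X ^ n * p.reverse).support.card ≤ p.support.card := by
  refine card_support_mul_le.trans ?_
  rw [support_X_pow, Finset.card_singleton, one_mul, reverse, reflect_support]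
  exact Finset.card_image_le

theorem Nsharp_substHom_X_inv_le (h : RatFunc ℂ) :
    Nsharp (substHom X⁻¹ transcendental_X_inv h) ≤ Nsharp h := by
  obtain ⟨p, q, hq, hh, hN⟩ := exists_Nsharp_eq h
  rw [hN]
  refine (Nsharp_le (p := Polynomial.X ^ q.natDegree * p.reverse)
    (q := Polynomial.X ^ p.natDegree * q.reverse) ?_ ?_).trans (add_le_add
    (card_support_X_pow_mul_reverse_le _ _) (card_support_X_pow_mul_reverse_le _ _))
  · exact mul_ne_zero (pow_ne_zero _ Polynomial.X_ne_zero) (reverse_eq_zero.not.2 hq)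
  · rw [hh, substHom_X_inv_div]

theorem isCoprime_reverse {A B : ℂ[X]} (hcop : IsCoprime A B) (hA : A ≠ 0) (n : ℕ) :
    IsCoprime (Polynomial.X ^ n * B.reverse) A.reverse := by
  rw [isCoprime_iff_aeval_ne_zero_of_isAlgClosed ℂ ℂ] at hcop ⊢
  intro a
  rcases eq_or_ne a 0 with rfl | ha
  · right
    rw [← coeff_zero_eq_aeval_zero, coeff_zero_reverse]
    exact leadingCoeff_ne_zero.2 hA
  · let : Invertible a⁻¹ := ⟨a, mul_inv_cancel₀ ha, inv_mul_cancel₀ ha⟩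
    have key : ∀ p : ℂ[X], aeval a p.reverse = 0 ↔ aeval a⁻¹ p = 0 := fun p =>
      eval₂_reverse_eq_zero_iff (algebraMap ℂ ℂ) a⁻¹ p
    rw [map_mul, map_pow, aeval_X, Ne, mul_eq_zero, Ne, key, key]
    rcases hcop a⁻¹ with h | h
    · exact Or.inr h
    · left
      rintro (h' | h')
      · exact pow_ne_zero _ ha h'
      · exact h h'

theorem ratDeg_le_or_eq_C_mul_X_pow {A B : ℂ[X]} (hA0 : A.coeff 0 = 0)
    (hAB : B.natDegree < A.natDegree) (hcop : IsCoprime A B) {h : RatFunc ℂ}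
    (hh : h ∈ IntermediateField.adjoin ℂ
      {algebraMap ℂ[X] (RatFunc ℂ) A / algebraMap ℂ[X] (RatFunc ℂ) B})
    {ℓ : ℕ} (hℓ : Nsharp h ≤ ℓ) : ratDeg h ≤ 8 * A.natDegree * ℓ ^ 4 * ℓ ∨
      ∃ (c : ℂ) (n : ℕ), c ≠ 0 ∧
        algebraMap ℂ[X] (RatFunc ℂ) A / algebraMap ℂ[X] (RatFunc ℂ) B = C c * X ^ n := by
  have hA : A ≠ 0 := by rintro rfl; simp at hAB
  have hB0 : B.coeff 0 ≠ 0 := by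
    intro hB0
    rcases (isCoprime_iff_aeval_ne_zero_of_isAlgClosed ℂ ℂ A B).1 hcop 0 with h | h
    · exact h (by rw [← coeff_zero_eq_aeval_zero, hA0])
    · exact h (by rw [← coeff_zero_eq_aeval_zero, hB0])
  have hB : B ≠ 0 := by rintro rfl; simp at hB0
  obtain ⟨A₁, hA₁⟩ : Polynomial.X ^ A.natTrailingDegree ∣ A :=
    X_pow_dvd_iff.2 fun d hd => coeff_eq_zero_of_lt_natTrailingDegree hd
  have hk : A.natTrailingDegree ≠ 0 := by
    rw [Ne, natTrailingDegree_eq_zero, not_or]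
    exact ⟨hA, not_not.2 hA0⟩
  have hA₁0 : A₁ ≠ 0 := by rintro rfl; exact hA (by rw [hA₁, mul_zero])
  have hdeg : A.natDegree = A.natTrailingDegree + A₁.natDegree := by
    conv_lhs => rw [hA₁, natDegree_mul (pow_ne_zero _ Polynomial.X_ne_zero) hA₁0, natDegree_X_pow]
  have hrev := A.natDegree_eq_reverse_natDegree_add_natTrailingDegree
  have hrevB := B.natDegree_eq_reverse_natDegree_add_natTrailingDegree
  rw [natTrailingDegree_eq_zero.2 (Or.inr hB0)] at hrevB
  rcases le_or_gt A₁.natDegree B.natDegree with hle | hlt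
  · rcases Nat.eq_zero_or_pos B.natDegree with hBd | hBpos
    · right
      obtain ⟨a, ha⟩ := natDegree_eq_zero.1 (Nat.le_zero.1 (hle.trans hBd.le))
      obtain ⟨b, hb⟩ := natDegree_eq_zero.1 hBd
      have ha0 : a ≠ 0 := by rintro rfl; exact hA₁0 (by rw [← ha, map_zero])
      have hb0 : b ≠ 0 := by rintro rfl; exact hB (by rw [← hb, map_zero])
      refine ⟨a / b, A.natTrailingDegree, div_ne_zero ha0 hb0, ?_⟩
      conv_lhs => rw [hA₁, ← ha, ← hb]
      rw [map_mul, map_pow, algebraMap_X, algebraMap_C, algebraMap_C, map_div₀]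
      ring
    · exact Or.inl (ratDeg_le_of_natDegree_le hk hA₁ hB0 hAB hcop hBpos hle hh hℓ)
  · left
    have hX := transcendental_X_inv (k := ℂ)
    have hdeg' : (Polynomial.X ^ (A.natDegree - B.natDegree) * B.reverse).natDegree =
        A.natDegree := by
      rw [natDegree_mul (pow_ne_zero _ Polynomial.X_ne_zero) (reverse_eq_zero.not.2 hB),
        natDegree_X_pow]
      omega
    have hmem := algHom_mem_adjoin (substHom X⁻¹ hX) hh
    rw [substHom_X_inv_div, ← adjoin_inv, inv_div] at hmem
    have heq : algebraMap ℂ[X] (RatFunc ℂ) (Polynomial.X ^ A.natDegree * B.reverse) /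
        algebraMap ℂ[X] (RatFunc ℂ) (Polynomial.X ^ B.natDegree * A.reverse) =
        algebraMap ℂ[X] (RatFunc ℂ) (Polynomial.X ^ (A.natDegree - B.natDegree) * B.reverse) /
        algebraMap ℂ[X] (RatFunc ℂ) A.reverse := by
      rw [← Nat.add_sub_of_le hAB.le, pow_add, mul_assoc, map_mul, map_mul _ (_ ^ B.natDegree),
        mul_div_mul_left _ _ (algebraMap_ne_zero (pow_ne_zero _ Polynomial.X_ne_zero)),
        Nat.add_sub_cancel_left]
    rw [heq] at hmem
    have := ratDeg_le_of_natDegree_le (m := A.natDegree - B.natDegree) (by omega) rfl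
      (by rw [coeff_zero_reverse]; exact leadingCoeff_ne_zero.2 hA) (by rw [hdeg']; omega)
      (isCoprime_reverse hcop hA _) (by omega) (by omega) hmem
      ((Nsharp_substHom_X_inv_le h).trans hℓ)
    rw [hdeg', ratDeg_substHom] at this
    exact (Nat.le_mul_of_pos_right _ (ratDeg_pos hX)).trans this

end RatFunc

section TranslateDistance

variable {G : Type*} [Group G] [Fintype G]

theorem abs_mul_sum_le_of_le_translate (W : G → ℤ) (τ : G)
    (hp : ∑ σ, |W σ| ≤ 2 * ∑ σ, |W σ - W (σ * τ)|)
    (hm : ∑ σ, |W σ| ≤ 2 * ∑ σ, |W σ + W (σ * τ)|) (a b : ℤ) :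
    |a| * ∑ σ, |W σ| ≤ 4 * ∑ σ, |a * W σ + b * W (σ * τ)| := by
  have htr : ∑ σ, |W (σ * τ)| = ∑ σ, |W σ| :=
    Fintype.sum_equiv (Equiv.mulRight τ) _ _ fun σ => rfl
  set N := ∑ σ, |W σ|
  set T := ∑ σ, |a * W σ + b * W (σ * τ)|
  have h1 : |a| * N - |b| * N ≤ T := by
    nth_rw 2 [← htr]
    rw [Finset.mul_sum, Finset.mul_sum, ← Finset.sum_sub_distrib]
    refine Finset.sum_le_sum fun σ _ => ?_
    have := abs_sub_abs_le_abs_sub (a * W σ) (-(b * W (σ * τ)))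
    rwa [abs_neg, abs_mul, abs_mul, sub_neg_eq_add] at this
  have h2 : |b| * N - |a| * N ≤ T := by
    nth_rw 1 [← htr]
    rw [Finset.mul_sum, Finset.mul_sum, ← Finset.sum_sub_distrib]
    refine Finset.sum_le_sum fun σ _ => ?_
    have := abs_sub_abs_le_abs_sub (b * W (σ * τ)) (-(a * W σ))
    rwa [abs_neg, abs_mul, abs_mul, sub_neg_eq_add, add_comm (b * _)] at this
  have h3 : |a| * N ≤ 2 * (T + |(|a| - |b|)| * N) := by
    have key : ∀ s : ℤ, |s| = 1 → a * b = -s * (|a| * |b|) →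
        N ≤ 2 * ∑ σ, |W σ - s * W (σ * τ)| → |a| * N ≤ 2 * (T + |(|a| - |b|)| * N) := by
      intro s hs hab hN
      have hle : |a| * ∑ σ, |W σ - s * W (σ * τ)| ≤ T + |(|a| - |b|)| * N := by
        rw [← htr, Finset.mul_sum, Finset.mul_sum, ← Finset.sum_add_distrib]
        refine Finset.sum_le_sum fun σ _ => ?_
        rcases eq_or_ne a 0 with rfl | ha
        · simp only [abs_zero, zero_mul]
          positivity
        · have h1 : |a * W σ + b * W (σ * τ)| = |(|a| * W σ - s * (|b| * W (σ * τ)))| := by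
            refine mul_left_cancel₀ (abs_ne_zero.2 ha) ?_
            rw [← abs_mul, ← abs_abs a, ← abs_mul, abs_abs, mul_add, ← mul_assoc, ← mul_assoc, hab,
              ← abs_mul_abs_self a]
            congr 1
            ring
          rw [h1, ← abs_abs a, ← abs_mul, abs_abs, ← abs_mul,
            show |a| * (W σ - s * W (σ * τ)) = |a| * W σ - s * (|b| * W (σ * τ)) +
              -(s * ((|a| - |b|) * W (σ * τ))) by ring]
          refine (abs_add_le _ _).trans (add_le_add_right (le_of_eq ?_) _)
          rw [abs_neg, abs_mul, hs, one_mul]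
      have := mul_le_mul_of_nonneg_left hN (abs_nonneg a)
      linarith
    rcases le_total (a * b) 0 with h | h
    · refine key 1 (by simp) ?_ (by simpa using hp)
      rw [← abs_mul, abs_of_nonpos h]; ring
    · refine key (-1) (by simp) ?_ (by simpa using hm)
      rw [← abs_mul, abs_of_nonneg h]; ring
  have h4 : |(|a| - |b|)| * N ≤ T := by
    rcases abs_choice (|a| - |b|) with h | h <;> rw [h] <;> linarith
  linarith

theorem sum_abs_sub_mul_mul_le (W : G → ℤ) (s t : ℤ) (hs : |s| = 1) (τ ρ : G) :
    ∑ σ, |W σ - s * t * W (σ * (τ * ρ))| ≤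
      ∑ σ, |W σ - s * W (σ * τ)| + ∑ σ, |W σ - t * W (σ * ρ)| := by
  have htr : ∑ σ, |W (σ * τ) - t * W (σ * τ * ρ)| = ∑ σ, |W σ - t * W (σ * ρ)| :=
    Fintype.sum_equiv (Equiv.mulRight τ) _ _ fun σ => rfl
  rw [← htr, ← Finset.sum_add_distrib]
  refine Finset.sum_le_sum fun σ _ => ?_
  have h1 : |W (σ * τ) - t * W (σ * τ * ρ)| = |s * W (σ * τ) - s * t * W (σ * (τ * ρ))| := by
    rw [mul_assoc s, ← mul_sub, abs_mul, hs, one_mul, mul_assoc σ]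
  rw [h1]
  exact abs_sub_le _ _ _

theorem exists_sum_mul_ne_zero (W : G → ℤ) (hW : 0 < ∑ σ, |W σ|) (B : Subgroup G)
    (hB : ∀ τ ∈ B, 2 * ∑ σ, |W σ - W (σ * τ)| < ∑ σ, |W σ|) [Fintype B] :
    ∃ σ, ∑ τ : B, W (σ * τ) ≠ 0 := by
  by_contra! h0
  have h1 : ∀ σ, Fintype.card B * |W σ| ≤ ∑ τ : B, |W σ - W (σ * τ)| := by
    intro σ
    have := Finset.abs_sum_le_sum_abs (fun τ : B => W σ - W (σ * τ)) Finset.univ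
    rwa [Finset.sum_sub_distrib, h0, sub_zero, Finset.sum_const, Finset.card_univ, nsmul_eq_mul,
      abs_mul, Nat.abs_cast] at this
  have h2 := Finset.sum_le_sum fun σ (_ : σ ∈ Finset.univ) => h1 σ
  rw [← Finset.mul_sum, Finset.sum_comm] at h2
  have h3 : ∑ τ : B, 2 * ∑ σ, |W σ - W (σ * τ)| ≤ ∑ _τ : B, ∑ σ, |W σ| :=
    Finset.sum_le_sum fun τ _ => (hB τ τ.2).le
  rw [← Finset.mul_sum, Finset.sum_const, Finset.card_univ, nsmul_eq_mul] at h3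
  have h4 : 0 < (Fintype.card B : ℤ) * ∑ σ, |W σ| :=
    mul_pos (by exact_mod_cast Fintype.card_pos) hW
  linarith

theorem exists_separated_or_subgroup (W : G → ℤ) (hW : 0 < ∑ σ, |W σ|) (h0 : ∑ σ, W σ = 0) :
    (∃ τ, ∀ a b : ℤ, |a| * ∑ σ, |W σ| ≤ 4 * ∑ σ, |a * W σ + b * W (σ * τ)|) ∨
    ∃ B : Subgroup G, (∃ ρ, ρ ∉ B) ∧ (∀ τ ρ, τ ∉ B → ρ ∉ B → τ * ρ ∈ B) ∧
      (∀ τ, (∀ σ, W (σ * τ) = W σ) → τ ∈ B) ∧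
      ∀ [Fintype B], ∃ σ, ∑ τ : B, W (σ * τ) ≠ 0 := by
  classical
  by_cases hgood : ∃ τ, ∑ σ, |W σ| ≤ 2 * ∑ σ, |W σ - W (σ * τ)| ∧
      ∑ σ, |W σ| ≤ 2 * ∑ σ, |W σ + W (σ * τ)|
  · obtain ⟨τ, hp, hm⟩ := hgood
    exact Or.inl ⟨τ, abs_mul_sum_le_of_le_translate W τ hp hm⟩
  right
  push Not at hgood
  have hdisj : ∀ τ, 2 * ∑ σ, |W σ| ≤ ∑ σ, |W σ - W (σ * τ)| + ∑ σ, |W σ + W (σ * τ)| := by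
    intro τ
    rw [Finset.mul_sum, ← Finset.sum_add_distrib]
    refine Finset.sum_le_sum fun σ _ => ?_
    have := abs_add_le (W σ - W (σ * τ)) (W σ + W (σ * τ))
    rw [sub_add_add_cancel, ← two_mul, abs_mul] at this
    simpa using this
  have hneg : ∀ τ, ¬ 2 * ∑ σ, |W σ - W (σ * τ)| < ∑ σ, |W σ| →
      2 * ∑ σ, |W σ + W (σ * τ)| < ∑ σ, |W σ| := fun τ h => hgood τ (not_lt.1 h)
  have hpos : ∀ τ, ∑ σ, |W σ - W (σ * τ)| < ∑ σ, |W σ| →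
      2 * ∑ σ, |W σ - W (σ * τ)| < ∑ σ, |W σ| := by
    intro τ h
    by_contra h'
    have := hneg τ h'
    have := hdisj τ
    linarith
  let B : Subgroup G :=
    { carrier := {τ | 2 * ∑ σ, |W σ - W (σ * τ)| < ∑ σ, |W σ|}
      one_mem' := by simpa using hW
      mul_mem' := by
        intro τ ρ hτ hρ
        refine hpos _ ?_
        have := sum_abs_sub_mul_mul_le W 1 1 (by simp) τ ρ
        simp only [one_mul] at this
        simp only [Set.mem_ofPred_eq] at hτ hρ
        linarith
      inv_mem' := by
        intro τ hτ
        simp only [Set.mem_ofPred_eq] at hτ ⊢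
        have : ∑ σ, |W σ - W (σ * τ⁻¹)| = ∑ σ, |W σ - W (σ * τ)| := by
          refine Fintype.sum_equiv (Equiv.mulRight τ⁻¹) _ _ fun σ => ?_
          simp [abs_sub_comm]
        rwa [this] }
  have hBmem : ∀ τ, τ ∈ B ↔ 2 * ∑ σ, |W σ - W (σ * τ)| < ∑ σ, |W σ| := fun τ => Iff.rfl
  have hsum : ∀ [Fintype B], ∃ σ, ∑ τ : B, W (σ * τ) ≠ 0 :=
    exists_sum_mul_ne_zero W hW B fun τ hτ => hτ
  refine ⟨B, ?_, ?_, ?_, hsum⟩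
  · by_contra! hB
    obtain ⟨σ, hσ⟩ := hsum
    refine hσ ((Fintype.sum_equiv ((Equiv.subtypeUnivEquiv hB).trans (Equiv.mulLeft σ)) _ W
      fun τ => rfl).trans h0)
  · intro τ ρ hτ hρ
    have h1 := hneg τ hτ
    have h2 := hneg ρ hρ
    refine hpos _ ?_
    have := sum_abs_sub_mul_mul_le W (-1) (-1) (by simp) τ ρ
    simp only [neg_mul, one_mul, neg_neg, sub_neg_eq_add] at this
    linarith
  · intro τ hτ
    rw [hBmem]
    simpa [hτ] using hW

end TranslateDistance

theorem inv_mem_integralOverAdjoin {k L : Type*} [Field k] [Field L] [Algebra k L] {x z : L}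
    {A B : k[X]} (hx : x ≠ 0) (hA0 : A.coeff 0 ≠ 0) (hB0 : B.coeff 0 = 0)
    (hAB : B.natDegree < A.natDegree) (h : aeval x A = z * aeval x B) :
    x⁻¹ ∈ integralOverAdjoin k z := by
  have hA : A ≠ 0 := by rintro rfl; simp at hA0
  let : Invertible x := invertibleOfNonzero hx
  have hreflect : ∀ p : k[X], p.natDegree ≤ A.natDegree →
      aeval x⁻¹ (reflect A.natDegree p) * x ^ A.natDegree = aeval x p := fun p hp => by
    have := eval₂_reflect_mul_pow (algebraMap k L) x A.natDegree p hp
    rwa [invOf_eq_inv] at this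
  refine mem_integralOverAdjoin_of_aeval_eq (A := reflect A.natDegree A)
    (B := reflect A.natDegree B) ?_ ?_
  · have hdegA : A.natDegree ≤ (reflect A.natDegree A).natDegree :=
      le_natDegree_of_ne_zero (by
        rwa [coeff_reflect, revAt_le le_rfl, Nat.sub_self])
    refine lt_of_lt_of_le ?_ hdegA
    have hle : (reflect A.natDegree B).natDegree ≤ A.natDegree - 1 := by
      rw [natDegree_le_iff_coeff_eq_zero]
      intro N hN
      rw [coeff_reflect]
      rcases eq_or_lt_of_le (show A.natDegree ≤ N by omega) with rfl | hlt
      · rw [revAt_le le_rfl, Nat.sub_self, hB0]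
      · rw [revAt_eq_self_of_lt hlt]
        exact coeff_eq_zero_of_natDegree_lt (by omega)
    omega
  · refine mul_right_cancel₀ (pow_ne_zero A.natDegree hx) ?_
    rw [mul_assoc, hreflect A le_rfl, hreflect B hAB.le, h]

namespace IsGaloisModel

variable {L : Type*} [Field L] [Algebra ℂ L] {x z : L} {G : Subgroup (L ≃ₐ[ℂ] L)}
  {v : Valuation L ℤᵐ⁰}

theorem ratDeg_le_or_exists_subgroup (hM : IsGaloisModel x z G v) {A B : ℂ[X]}
    (hA0 : A.coeff 0 ≠ 0) (hB0 : B.coeff 0 = 0) (hB : B ≠ 0) (hAB : B.natDegree < A.natDegree)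
    (h : aeval x A = z * aeval x B) {f : RatFunc ℂ}
    (hf : RatFunc.substHom x hM.transcendental_left f ∈ IntermediateField.adjoin ℂ {z})
    {ℓ : ℕ} (hℓ : Nsharp f ≤ ℓ) : ratDeg f ≤ 16 * A.natDegree * ℓ ^ 4 * ℓ ∨
      ∃ H ≤ G, (∃ ρ ∈ G, ρ ∉ H) ∧ (∀ τ ∈ G, ∀ ρ ∈ G, τ ∉ H → ρ ∉ H → τ * ρ ∈ H) ∧
        (∀ τ ∈ G, τ x = x → τ ∈ H) ∧
        ∀ [Fintype H], ∀ c : ℂ, algebraMap ℂ L c ≠ ∏ τ : H, τ.1 x := by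
  have := hM.finite
  have := Fintype.ofFinite G
  have hx0 := hM.left_ne_zero
  have hint := mem_integralOverAdjoin_of_aeval_eq hAB h
  have hint' := inv_mem_integralOverAdjoin hx0 hA0 hB0 hAB h
  set W : G → ℤ := fun σ => log (v (σ.1 x)) with hW
  have hsum : ∑ σ, W σ = 0 := hM.sum_log_eq_zero hx0 hint hint'
  have hmax : ∑ σ, |W σ| = 2 * ∑ σ, max 0 (W σ) := by
    have : ∀ w : ℤ, |w| = 2 * max 0 w - w := fun w => by
      rcases le_total 0 w with hw | hw
      · rw [abs_of_nonneg hw, max_eq_right hw]; ring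
      · rw [abs_of_nonpos hw, max_eq_left hw]; ring
    rw [Finset.sum_congr rfl fun σ _ => this (W σ), Finset.sum_sub_distrib, hsum, sub_zero,
      Finset.mul_sum]
  have hpos : 0 < ∑ σ, |W σ| := by
    refine Finset.sum_pos' (fun σ _ => abs_nonneg _) ⟨1, Finset.mem_univ _, ?_⟩
    exact abs_pos.2 ((log_pos_iff (v.ne_zero_iff.2 hx0)).2 hM.one_lt).ne'
  rcases exists_separated_or_subgroup W hpos hsum with ⟨τ, hτ⟩ | ⟨S, ⟨ρ, hρ⟩, hmul, hstab, hS⟩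
  · left
    refine hM.ratDeg_le_of_separated (m := 0) (by rw [pow_zero, one_mul]) hAB hB h hf hℓ τ
      fun a b hab => ?_
    have h1 : |a| * ∑ σ, |W σ| ≤ 4 * _ :=
      (hτ a b).trans (mul_le_mul_of_nonneg_left hab (by norm_num))
    rw [hmax] at h1 hpos
    have h2 : ((ℓ ^ 4 * (A.natDegree + B.natDegree) : ℕ) : ℤ) ≤ ℓ ^ 4 * (2 * A.natDegree) := by
      have : ℓ ^ 4 * (A.natDegree + B.natDegree) ≤ ℓ ^ 4 * (2 * A.natDegree) :=
        Nat.mul_le_mul_left _ (by omega)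
      exact_mod_cast this
    refine le_of_mul_le_mul_right ?_ hpos
    have h3 := mul_le_mul_of_nonneg_right h2 hpos.le
    push_cast at h1 h3 ⊢
    linarith
  · right
    refine ⟨S.map G.subtype, ?_, ⟨ρ.1, ρ.2, ?_⟩, ?_, ?_, ?_⟩
    · rintro _ ⟨σ, -, rfl⟩
      exact σ.2
    · rintro ⟨σ, hσ, hσρ⟩
      exact hρ (Subtype.ext hσρ ▸ hσ)
    · intro σ hσ τ hτ hσS hτS
      exact ⟨⟨σ, hσ⟩ * ⟨τ, hτ⟩, hmul ⟨σ, hσ⟩ ⟨τ, hτ⟩ (fun h => hσS ⟨_, h, rfl⟩)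
        (fun h => hτS ⟨_, h, rfl⟩), rfl⟩
    · intro τ hτ hτx
      refine ⟨⟨τ, hτ⟩, hstab _ fun σ => ?_, rfl⟩
      simp only [hW, Subgroup.coe_mul, AlgEquiv.mul_apply, hτx]
    · intro _ c hc
      have := Fintype.ofFinite S
      obtain ⟨σ, hσ⟩ := hS
      refine hσ ?_
      have hprod : ∏ τ : S.map G.subtype, τ.1 x = ∏ τ : S, τ.1.1 x :=
        (Fintype.prod_equiv (S.equivMapOfInjective G.subtype G.subtype_injective).toEquiv _ _
          fun τ => rfl).symm
      rw [hprod] at hc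
      have hne : ∀ τ : S, τ.1.1 x ≠ 0 := fun τ => by simpa using hx0
      have hc0 : c ≠ 0 := by
        rintro rfl
        rw [map_zero] at hc
        exact Finset.prod_ne_zero_iff.2 (fun τ _ => hne τ) hc.symm
      have h1 := congrArg (fun a => log (v (σ.1 a))) hc
      simp only [AlgEquiv.commutes, hM.map_algebraMap c hc0, log_one, map_prod] at h1
      rw [← map_prod, log_prod_valuation v _ _ fun τ _ => by simpa using hx0] at h1
      exact h1.symm

theorem exists_quadratic_relation (hM : IsGaloisModel x z G v) {H : Subgroup (L ≃ₐ[ℂ] L)}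
    (hHG : H ≤ G) (hne : ∃ ρ ∈ G, ρ ∉ H)
    (hmul : ∀ τ ∈ G, ∀ ρ ∈ G, τ ∉ H → ρ ∉ H → τ * ρ ∈ H) {e : L} (he : ∀ σ ∈ H, σ e = e) :
    ∃ s ∈ IntermediateField.adjoin ℂ {z}, ∃ p ∈ IntermediateField.adjoin ℂ {z},
      e ^ 2 - s * e + p = 0 := by
  obtain ⟨ρ, hρ, hρH⟩ := hne
  have hρinv : ρ⁻¹ ∉ H := fun h => hρH (inv_mem_iff.1 h)
  have h1 : ∀ σ ∈ G, σ ∉ H → σ e = ρ e := fun σ hσ hσH => by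
    have := he _ (hmul _ (inv_mem hρ) σ hσ hρinv hσH)
    calc σ e = ρ ((ρ⁻¹ * σ) e) := by rw [← AlgEquiv.mul_apply, mul_inv_cancel_left]
      _ = ρ e := by rw [this]
  have h2 : ∀ σ ∈ H, σ (ρ e) = ρ e := fun σ hσ => by
    rw [← AlgEquiv.mul_apply]
    exact h1 _ (mul_mem (hHG hσ) hρ) fun h => hρH ((mul_mem_cancel_left hσ).1 h)
  have h3 : ∀ σ ∈ G, σ ∉ H → σ (ρ e) = e := fun σ hσ hσH => by
    rw [← AlgEquiv.mul_apply]
    exact he _ (hmul σ hσ ρ hρ hσH hρH)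
  refine ⟨e + ρ e, hM.mem_adjoin_right _ fun σ hσ => ?_, e * ρ e,
    hM.mem_adjoin_right _ fun σ hσ => ?_, by ring⟩
  · rw [map_add]
    by_cases hσH : σ ∈ H
    · rw [he σ hσH, h2 σ hσH]
    · rw [h1 σ hσ hσH, h3 σ hσ hσH, add_comm]
  · rw [map_mul]
    by_cases hσH : σ ∈ H
    · rw [he σ hσH, h2 σ hσH]
    · rw [h1 σ hσ hσH, h3 σ hσ hσH, mul_comm]

theorem exists_adjoin_of_subgroup {ι : RatFunc ℂ →ₐ[ℂ] L} {y : RatFunc ℂ}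
    (hM : IsGaloisModel (ι RatFunc.X) (ι y) G v) (hy : Transcendental ℂ y)
    {H : Subgroup (L ≃ₐ[ℂ] L)} (hHG : H ≤ G)
    (hstab : ∀ τ ∈ G, τ (ι RatFunc.X) = ι RatFunc.X → τ ∈ H) :
    ∃ A B : ℂ[X], IsCoprime A B ∧ B ≠ 0 ∧ B.natDegree < A.natDegree ∧
      (A.coeff 0 = 0 ∨ B.coeff 0 = 0) ∧
      y ∈ IntermediateField.adjoin ℂ
        {algebraMap ℂ[X] (RatFunc ℂ) A / algebraMap ℂ[X] (RatFunc ℂ) B} ∧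
      IsGaloisModel (ι RatFunc.X)
        (ι (algebraMap ℂ[X] (RatFunc ℂ) A / algebraMap ℂ[X] (RatFunc ℂ) B)) H v := by
  set K := (IntermediateField.fixedField H).comap ι with hK
  have hKmem : ∀ e, e ∈ K ↔ ∀ σ ∈ H, σ (ι e) = ι e := fun e =>
    IntermediateField.mem_fixedField_iff _ _
  have hyK : y ∈ K := (hKmem y).2 fun σ hσ => hM.apply_right σ (hHG hσ)
  have hKbot : K ≠ ⊥ := by
    intro hbot
    rw [hbot, IntermediateField.mem_bot] at hyK
    obtain ⟨c, rfl⟩ := hyK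
    exact hy (isAlgebraic_algebraMap c)
  obtain ⟨A, B, hcop, hB, hAB, h0, hadj⟩ := RatFunc.exists_adjoin_eq_natDegree_lt
    (RatFunc.Luroth.transcendental_generator hKbot)
  rw [← RatFunc.Luroth.eq_adjoin_generator] at hadj
  have hz := RatFunc.transcendental_div hB hcop hAB
  set w := algebraMap ℂ[X] (RatFunc ℂ) A / algebraMap ℂ[X] (RatFunc ℂ) B with hw
  refine ⟨A, B, hcop, hB, hAB, h0, hadj ▸ hyK, hM.transcendental_left, ?_, ?_, ?_, ?_, ?_,
    hM.one_lt, hM.map_algebraMap, hM.exists_derivation⟩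
  · exact fun h => hz ((isAlgebraic_algHom_iff ι ι.injective).1 h)
  · have := hM.finite
    exact Finite.of_injective _ (Subgroup.inclusion_injective hHG)
  · exact (hKmem w).1 (hadj ▸ IntermediateField.mem_adjoin_simple_self ℂ w)
  · intro a ha
    obtain ⟨e, rfl⟩ := RatFunc.exists_substHom_eq hM.transcendental_left
      (hM.mem_adjoin_left a fun σ hσ hσx => ha σ (hstab σ hσ hσx))
    rw [RatFunc.substHom_algHom_eq] at ha ⊢
    exact RatFunc.algHom_mem_adjoin ι (hadj ▸ (hKmem e).2 ha)
  · exact fun a ha => hM.mem_adjoin_left a fun σ hσ hσx => ha σ (hstab σ hσ hσx) hσx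

end IsGaloisModel

namespace RatFunc

theorem ratDeg_le_two {R s p : RatFunc ℂ} (hs : s ∈ IntermediateField.adjoin ℂ {R})
    (hp : p ∈ IntermediateField.adjoin ℂ {R}) (h : X ^ 2 - s * X + p = 0) : ratDeg R ≤ 2 := by
  set K := IntermediateField.adjoin ℂ {R} with hK
  let P : K[X] := Polynomial.X ^ 2 - Polynomial.C ⟨s, hs⟩ * Polynomial.X + Polynomial.C ⟨p, hp⟩
  have hdeg : P.natDegree = 2 := by
    simp only [P]
    compute_degree!
  have hP0 : P ≠ 0 := by rintro h0; rw [h0] at hdeg; simp at hdeg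
  have hroot : aeval (X : RatFunc ℂ) P = 0 := by
    simpa [P] using h
  have hint : IsIntegral K (X : RatFunc ℂ) := isAlgebraic_iff_isIntegral.1 ⟨P, hP0, hroot⟩
  have h1 := IntermediateField.adjoin.finrank hint
  have h2 : IntermediateField.adjoin K {(X : RatFunc ℂ)} = ⊤ := IntermediateField.adjoin_X K
  rw [h2, IntermediateField.finrank_top', finrank_adjoin_simple] at h1
  rw [h1, ← hdeg]
  exact natDegree_le_of_dvd (minpoly.dvd _ _ hroot) hP0

theorem transcendental_X_pow {n : ℕ} (hn : n ≠ 0) : Transcendental ℂ (X ^ n : RatFunc ℂ) :=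
  transcendental_X.pow (Nat.pos_of_ne_zero hn)

theorem aeval_X_pow (n : ℕ) (p : ℂ[X]) :
    aeval (X ^ n : RatFunc ℂ) p = algebraMap ℂ[X] (RatFunc ℂ) (expand ℂ n p) := by
  rw [← aeval_X_left_eq_algebraMap, expand_aeval]

theorem exists_adjoin_eq_of_substHom_X_pow {n : ℕ} (hn : n ≠ 0) {A B : ℂ[X]} (hB : B ≠ 0)
    (hA0 : A.coeff 0 ≠ 0) (hB0 : B.coeff 0 = 0) (hAB : B.natDegree < A.natDegree) {R : RatFunc ℂ}
    (hR : ratDeg R ≤ 2) (h : algebraMap ℂ[X] (RatFunc ℂ) A / algebraMap ℂ[X] (RatFunc ℂ) B =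
      substHom (X ^ n) (transcendental_X_pow hn) R) :
    ∃ a b : ℂ, IntermediateField.adjoin ℂ
        {algebraMap ℂ[X] (RatFunc ℂ) A / algebraMap ℂ[X] (RatFunc ℂ) B} =
      IntermediateField.adjoin ℂ {C a * X ^ n + C b * X⁻¹ ^ n} := by
  have hA : A ≠ 0 := by rintro rfl; simp at hA0
  have hd := R.denom_ne_zero
  have hy : algebraMap ℂ[X] (RatFunc ℂ) A / algebraMap ℂ[X] (RatFunc ℂ) B =
      algebraMap ℂ[X] (RatFunc ℂ) (expand ℂ n R.num) /
        algebraMap ℂ[X] (RatFunc ℂ) (expand ℂ n R.denom) := by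
    rw [h, substHom_eq, aeval_X_pow, aeval_X_pow]
  have hed : expand ℂ n R.denom ≠ 0 := (expand_ne_zero (Nat.pos_of_ne_zero hn)).2 hd
  have hcross : A * expand ℂ n R.denom = expand ℂ n R.num * B := by
    apply algebraMap_injective ℂ
    rw [map_mul, map_mul]
    exact (div_eq_div_iff (algebraMap_ne_zero hB) (algebraMap_ne_zero hed)).1 hy
  have hen : expand ℂ n R.num ≠ 0 := by
    intro h0
    rw [h0, zero_mul] at hcross
    exact mul_ne_zero hA hed hcross
  have hd0 : R.denom.coeff 0 = 0 := by
    have : (A * expand ℂ n R.denom).coeff 0 = _ := congrArg (coeff · 0) hcross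
    rw [mul_coeff_zero, mul_coeff_zero, hB0, mul_zero] at this
    have h0 := (mul_eq_zero.1 this).resolve_left hA0
    rwa [coeff_zero_eq_eval_zero, expand_eval, zero_pow hn, ← coeff_zero_eq_eval_zero] at h0
  have hlt : R.denom.natDegree < R.num.natDegree := by
    have := congrArg natDegree hcross
    rw [natDegree_mul hA hed, natDegree_mul hen hB, natDegree_expand, natDegree_expand] at this
    exact Nat.lt_of_mul_lt_mul_right (show R.denom.natDegree * n < R.num.natDegree * n by omega)
  have hn2 : R.num.natDegree ≤ 2 := (le_max_left _ _).trans hR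
  obtain ⟨q, r, hqr⟩ := exists_eq_X_add_C_of_natDegree_le_one
    (show R.denom.natDegree ≤ 1 by omega)
  have hr : r = 0 := by rw [hqr] at hd0; simpa using hd0
  have hq : q ≠ 0 := by
    rintro rfl
    rw [hqr, hr] at hd
    simp at hd
  have hnum := R.num.as_sum_range_C_mul_X_pow' (show R.num.natDegree < 3 by omega)
  simp only [Finset.sum_range_succ, Finset.sum_range_zero] at hnum
  set p₀ := R.num.coeff 0
  set p₁ := R.num.coeff 1
  set p₂ := R.num.coeff 2
  refine ⟨p₂ / q, p₀ / q, ?_⟩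
  rw [← adjoin_sub_C _ (p₁ / q), hy, hqr, hr, hnum]
  congr 2
  have hX : (X : RatFunc ℂ) ^ n ≠ 0 := pow_ne_zero _ X_ne_zero
  have hqC : (C q : RatFunc ℂ) ≠ 0 := by simpa using hq
  simp only [map_add, map_mul, map_zero, expand_C, expand_X, map_pow, algebraMap_C, algebraMap_X,
    map_div₀, inv_pow]
  field_simp
  ring

theorem ratDeg_le_two_of_quadratic {L : Type*} [Field L] [Algebra ℂ L] {ι : RatFunc ℂ →ₐ[ℂ] L}
    {w R : RatFunc ℂ} (hw : Transcendental ℂ w) {s p : L}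
    (hs : s ∈ IntermediateField.adjoin ℂ {ι (substHom w hw R)})
    (hp : p ∈ IntermediateField.adjoin ℂ {ι (substHom w hw R)})
    (h : ι w ^ 2 - s * ι w + p = 0) : ratDeg R ≤ 2 := by
  let φ : RatFunc ℂ →ₐ[ℂ] L := ι.comp (substHom w hw)
  have hφ : (IntermediateField.adjoin ℂ {R}).map φ =
      IntermediateField.adjoin ℂ {ι (substHom w hw R)} := by
    rw [IntermediateField.adjoin_map, Set.image_singleton]
    rfl
  rw [← hφ] at hs hp
  obtain ⟨s, hs, rfl⟩ := hs
  obtain ⟨p, hp, rfl⟩ := hp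
  refine ratDeg_le_two hs hp (φ.injective ?_)
  have hX : φ X = ι w := congrArg ι (substHom_X w hw)
  rw [map_zero, ← h, ← hX]
  simp

theorem adjoin_C_mul {c : ℂ} (hc : c ≠ 0) (w : RatFunc ℂ) :
    IntermediateField.adjoin ℂ {C c * w} = IntermediateField.adjoin ℂ {w} := by
  have hC : ∀ (K : IntermediateField ℂ (RatFunc ℂ)) (c : ℂ), C c ∈ K := fun K => K.algebraMap_mem
  refine le_antisymm ?_ ?_ <;> rw [IntermediateField.adjoin_simple_le_iff]
  · exact mul_mem (hC _ c) (IntermediateField.mem_adjoin_simple_self ℂ w)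
  · have : w = C c⁻¹ * (C c * w) := by
      rw [← mul_assoc, ← map_mul, inv_mul_cancel₀ hc, map_one, one_mul]
    rw [this]
    exact mul_mem (hC _ _) (by
      rw [← this]; exact IntermediateField.mem_adjoin_simple_self ℂ (C c * w))

theorem ratDeg_le_or_adjoin_eq {A B : ℂ[X]} (hB : B ≠ 0) (hB0 : B.coeff 0 = 0)
    (hAB : B.natDegree < A.natDegree) (hcop : IsCoprime A B) {h : RatFunc ℂ}
    (hh : h ∈ IntermediateField.adjoin ℂ
      {algebraMap ℂ[X] (RatFunc ℂ) A / algebraMap ℂ[X] (RatFunc ℂ) B})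
    {ℓ : ℕ} (hℓ : Nsharp h ≤ ℓ) : ratDeg h ≤ 16 * A.natDegree * ℓ ^ 4 * ℓ ∨
      ∃ (a b : ℂ) (n : ℕ), IntermediateField.adjoin ℂ
          {algebraMap ℂ[X] (RatFunc ℂ) A / algebraMap ℂ[X] (RatFunc ℂ) B} =
        IntermediateField.adjoin ℂ {C a * X ^ n + C b * X⁻¹ ^ n} := by
  have hcoeff : ∀ {P Q : ℂ[X]}, IsCoprime P Q → Q.coeff 0 = 0 → P.coeff 0 ≠ 0 := by
    intro P Q hPQ hQ hP
    rw [coeff_zero_eq_aeval_zero] at hP hQ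
    rcases (isCoprime_iff_aeval_ne_zero_of_isAlgClosed ℂ ℂ P Q).1 hPQ 0 with h | h
    exacts [h hP, h hQ]
  have hA0 := hcoeff hcop hB0
  have hy := transcendental_div hB hcop hAB
  have hdeg := ratDeg_le_of_eq_div (n := A.natDegree) hB rfl le_rfl hAB.le
  obtain ⟨L, _, _, ι, G, v, hM⟩ := exists_isGaloisModel (ne_C_of_transcendental hy)
  rcases hM.ratDeg_le_or_exists_subgroup hA0 hB0 hB hAB (aeval_algHom_eq ι hB)
    (by rw [substHom_algHom_eq]; exact algHom_mem_adjoin ι hh) hℓ with hle |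
    ⟨H, hHG, hne, hmul, hstab, hprod⟩
  · exact Or.inl hle
  obtain ⟨P, Q, hPQ, hQ, hlt, h0, hmem, hM'⟩ := hM.exists_adjoin_of_subgroup hy hHG hstab
  by_cases hQ0 : Q.coeff 0 = 0
  · exfalso
    have := hM'.finite
    have := Fintype.ofFinite H
    have hx := hM.left_ne_zero
    have hrel := aeval_algHom_eq ι (A := P) hQ
    obtain ⟨c, hc⟩ := hM'.exists_algebraMap_eq_prod hx
      (mem_integralOverAdjoin_of_aeval_eq hlt hrel)
      (inv_mem_integralOverAdjoin hx (hcoeff hPQ hQ0) hQ0 hlt hrel)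
    exact hprod c hc
  · have hle := IntermediateField.adjoin_simple_le_iff.2 hmem
    rcases ratDeg_le_or_eq_C_mul_X_pow (h0.resolve_right hQ0) hlt hPQ (hle hh) hℓ with
      hb | ⟨c, n, hc, hcn⟩
    · left
      have hPA : P.natDegree ≤ A.natDegree :=
        (natDegree_le_ratDeg hQ hPQ rfl).trans ((ratDeg_le_of_adjoin_le hy hle).trans hdeg)
      refine hb.trans ?_
      gcongr
      norm_num
    · right
      have hn : n ≠ 0 := by
        rintro rfl
        rw [pow_zero, mul_one] at hcn
        exact ne_C_of_transcendental (transcendental_div hQ hPQ hlt) ⟨c, hcn⟩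
      have hXn := transcendental_X_pow hn
      rw [hcn, adjoin_C_mul hc] at hmem
      obtain ⟨R, hR⟩ := exists_substHom_eq hXn hmem
      obtain ⟨s, hs, p, hp, hsp⟩ := hM.exists_quadratic_relation hHG hne hmul
        (e := ι (X ^ n)) fun σ hσ => by
          have h1 := hM'.apply_right σ hσ
          have hC : ι (C c) = algebraMap ℂ L c := ι.commutes c
          rw [hcn, map_mul, map_mul, hC, AlgEquiv.commutes] at h1
          exact mul_left_cancel₀ (by simpa using hc) h1
      rw [← hR] at hs hp
      have hR2 := ratDeg_le_two_of_quadratic hXn hs hp hsp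
      obtain ⟨a, b, hab⟩ :=
        exists_adjoin_eq_of_substHom_X_pow hn hB hA0 hB0 hAB hR2 hR.symm
      exact ⟨a, b, n, hab⟩

theorem ratDeg_le_or_exists_moebius {f g : RatFunc ℂ} (hg : Transcendental ℂ g) {ℓ : ℕ}
    (hℓ : Nsharp (substHom g hg f) ≤ ℓ) : ratDeg f ≤ 16 * ℓ ^ 5 ∨
      ∃ (a b : ℂ) (n : ℕ), IntermediateField.adjoin ℂ {g} =
        IntermediateField.adjoin ℂ {C a * X ^ n + C b * X⁻¹ ^ n} := by
  obtain ⟨A, B, hcop, hB, hAB, h0, hadj⟩ := exists_adjoin_eq_natDegree_lt hg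
  have hdeg : A.natDegree ≤ ratDeg g :=
    (natDegree_le_ratDeg hB hcop rfl).trans (ratDeg_le_of_adjoin_le hg hadj.ge)
  have hmem := substHom_mem_adjoin hg f
  rw [← hadj] at hmem
  have hbound : ∀ k ≤ 16, ratDeg (substHom g hg f) ≤ k * A.natDegree * ℓ ^ 4 * ℓ →
      ratDeg f ≤ 16 * ℓ ^ 5 := fun k hk h => by
    rw [ratDeg_substHom] at h
    refine Nat.le_of_mul_le_mul_right (h.trans ?_) (ratDeg_pos hg)
    calc k * A.natDegree * ℓ ^ 4 * ℓ ≤ 16 * ratDeg g * ℓ ^ 4 * ℓ := by gcongr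
      _ = 16 * ℓ ^ 5 * ratDeg g := by ring
  rw [← hadj]
  rcases h0 with h0 | h0
  · rcases ratDeg_le_or_eq_C_mul_X_pow h0 hAB hcop hmem hℓ with h | ⟨c, n, -, h⟩
    · exact Or.inl (hbound 8 (by norm_num) h)
    · exact Or.inr ⟨c, 0, n, by rw [h, map_zero, zero_mul, add_zero]⟩
  · exact (ratDeg_le_or_adjoin_eq hB h0 hAB hcop hmem hℓ).imp_left (hbound 16 le_rfl)

theorem transcendental_of_adjoin_eq {y z : RatFunc ℂ} (hy : Transcendental ℂ y)
    (h : IntermediateField.adjoin ℂ {y} = IntermediateField.adjoin ℂ {z}) :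
    Transcendental ℂ z := by
  refine transcendental_of_ne_C _ ?_
  rintro ⟨c, rfl⟩
  have h1 : y ∈ IntermediateField.adjoin ℂ {C c} :=
    h ▸ IntermediateField.mem_adjoin_simple_self ℂ y
  have h2 : IntermediateField.adjoin ℂ {(C c : RatFunc ℂ)} = ⊥ :=
    IntermediateField.adjoin_simple_eq_bot_iff.2 (IntermediateField.algebraMap_mem _ c)
  rw [h2, IntermediateField.mem_bot] at h1
  obtain ⟨d, rfl⟩ := h1
  exact hy (isAlgebraic_algebraMap d)

theorem ratComp_eq_substHom (f : RatFunc ℂ) {g : RatFunc ℂ} (hg : Transcendental ℂ g) :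
    ratComp f g = substHom g hg f :=
  (substHom_eq g hg f).symm

end RatFunc

theorem Nat.pow_five_le (ℓ : ℕ) : ℓ ^ 5 ≤ 126 * 5 ^ ℓ := by
  rcases lt_or_ge ℓ 4 with h | h
  · interval_cases ℓ <;> norm_num
  · induction ℓ, h using Nat.le_induction with
    | base => norm_num
    | succ n hn ih =>
      have : (n + 1) ^ 5 ≤ 5 * n ^ 5 := by
        obtain ⟨m, rfl⟩ := Nat.exists_eq_add_of_le hn
        ring_nf
        linarith [Nat.zero_le m, Nat.zero_le (m ^ 2), Nat.zero_le (m ^ 3), Nat.zero_le (m ^ 4),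
          Nat.zero_le (m ^ 5)]
      rw [pow_succ 5]
      omega

/-- Fuchs–Zannier (2012): if `N#(f ∘ g) ≤ ℓ` for a non-constant rational
function `g`, then either `g = λ(a x^n + b x^{-n})` for a Möbius
transformation `λ`, or `deg f ≤ 2016 ⬝ 5^ℓ`. -/
theorem fuchs_zannier_composite_rational (ℓ : ℕ) (hℓ : 1 ≤ ℓ) (f g : RatFunc ℂ)
    (hg : ∀ c : ℂ, g ≠ RatFunc.C c)
    (h : Nsharp (ratComp f g) ≤ ℓ) :
    (∃ (α β γ δ a b : ℂ) (n : ℕ), α * δ - β * γ ≠ 0 ∧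
      g = (RatFunc.C α * (RatFunc.C a * RatFunc.X ^ n + RatFunc.C b * RatFunc.X⁻¹ ^ n)
            + RatFunc.C β) /
          (RatFunc.C γ * (RatFunc.C a * RatFunc.X ^ n + RatFunc.C b * RatFunc.X⁻¹ ^ n)
            + RatFunc.C δ)) ∨
    ratDeg f ≤ 2016 * 5 ^ ℓ := by
  have hgt : Transcendental ℂ g := RatFunc.transcendental_of_ne_C g fun ⟨c, hc⟩ => hg c hc
  rw [RatFunc.ratComp_eq_substHom f hgt] at h
  rcases RatFunc.ratDeg_le_or_exists_moebius hgt h with hle | ⟨a, b, n, hab⟩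
  · right
    have := Nat.pow_five_le ℓ
    omega
  · left
    obtain ⟨α, β, γ, δ, hdet, hg⟩ := RatFunc.exists_moebius_of_adjoin_eq
      (RatFunc.transcendental_of_adjoin_eq hgt hab) hab
    exact ⟨α, β, γ, δ, a, b, n, hdet, hg⟩
end

section
/- Let ξ ∈ ℂ be nonzero and let a ∈ ℂ[T] be a non-constant polynomial. Then the set of solutions (x, y) ∈ ℂ[T]² of the Thue equation x(x − y)(x + y)(x − ay) + y⁴ = ξ over the polynomial ring ℂ[T] is exactly {(ζ, 0), (0, ζ), (ζ, ζ), (−ζ, ζ), (ζa, ζ), (−ζ, ζa) : ζ ∈ ℂ, ζ⁴ = ξ}. -/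
open Polynomial

/-- Over an algebraically closed extension of `k(X)` there is a valuation extending the
degree valuation of `k[X]`. -/
theorem exists_valuation_eq_pow_natDegree (k : Type) [Field k] :
    ∃ (K : Type) (_ : Field K) (_ : IsAlgClosed K) (ι : k[X] →+* K)
      (Γ : Type) (_ : LinearOrderedCommGroupWithZero Γ) (v : Valuation K Γ) (τ : Γ),
      1 < τ ∧ ∀ p : k[X], p ≠ 0 → v (ι p) = τ ^ p.natDegree := by
  let K := AlgebraicClosure (RatFunc k)
  let φ : k[X] →+* K := (algebraMap (RatFunc k) K).comp (algebraMap k[X] (RatFunc k))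
  have hφ : Function.Injective φ :=
    (algebraMap (RatFunc k) K).injective.comp (RatFunc.algebraMap_injective k)
  have hX : φ X ≠ 0 := (map_ne_zero_iff φ hφ).2 X_ne_zero
  have hproper : Ideal.span {φ.rangeRestrict X} ≠ ⊤ := by
    rw [Ne, Ideal.span_singleton_eq_top]
    intro h
    obtain ⟨⟨_, q, rfl⟩, hb⟩ := isUnit_iff_exists_inv.1 h
    have h1 : φ (X * q) = φ 1 := by
      simpa using congrArg Subtype.val hb
    exact not_isUnit_X (IsUnit.of_mul_eq_one q (hφ h1))
  obtain ⟨B, hB, hI⟩ := Ideal.image_subset_nonunits_valuationSubring _ hproper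
  have hXlt : B.valuation (φ X) < 1 :=
    hI ⟨φ.rangeRestrict X, Ideal.mem_span_singleton_self _, rfl⟩
  have hCle (c : k) : B.valuation (φ (C c)) ≤ 1 :=
    (B.valuation_le_one_iff _).2 (hB ⟨C c, rfl⟩)
  have hC (c : k) (hc : c ≠ 0) : B.valuation (φ (C c)) = 1 := by
    refine le_antisymm (hCle c) ?_
    have h : B.valuation (φ (C c)) * B.valuation (φ (C c⁻¹)) = 1 := by
      rw [← map_mul, ← map_mul, ← C_mul, mul_inv_cancel₀ hc, C_1, map_one, map_one]
    calc (1 : B.ValueGroup) = _ := h.symm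
      _ ≤ B.valuation (φ (C c)) * 1 := mul_le_mul_right (hCle _) _
      _ = _ := mul_one _
  have hτ : 1 < (B.valuation (φ X))⁻¹ :=
    (one_lt_inv₀ (zero_lt_iff.2 ((B.valuation.ne_zero_iff).2 hX))).2 hXlt
  refine ⟨K, inferInstance, inferInstance, eval₂RingHom (φ.comp C) (φ X)⁻¹, B.ValueGroup,
    inferInstance, B.valuation, (B.valuation (φ X))⁻¹, hτ, fun p => ?_⟩
  induction h : p.natDegree using Nat.strong_induction_on generalizing p with
  | _ n ih =>
    intro hp
    have hlead : B.valuation (eval₂RingHom (φ.comp C) (φ X)⁻¹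
        (C p.leadingCoeff * X ^ p.natDegree)) = (B.valuation (φ X))⁻¹ ^ n := by
      simp [hC _ (leadingCoeff_ne_zero.2 hp), h]
    rw [← eraseLead_add_C_mul_X_pow p, map_add, Valuation.map_add_eq_of_lt_right, hlead]
    rw [hlead]
    by_cases h0 : p.eraseLead = 0
    · rw [h0, map_zero, map_zero]
      exact pow_pos (zero_lt_one.trans hτ) n
    · have hlt := (eraseLead_natDegree_lt_or_eraseLead_eq_zero p).resolve_right h0
      rw [ih _ (h ▸ hlt) _ rfl h0]
      exact pow_lt_pow_right₀ hτ (h ▸ hlt)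

section Roots

variable {K : Type*} [Field K] {Γ : Type*} [LinearOrderedCommGroupWithZero Γ] (v : Valuation K Γ)

theorem exists_add_mul_inv_eq [IsAlgClosed K] {c s : K} (hc : v c = 1) (hs : 1 < v s) :
    ∃ z, z ≠ 0 ∧ z + c * z⁻¹ = s ∧ v z = v s := by
  have key (z : K) (hz : z + c * z⁻¹ = s) (h1 : 1 < v z) : v z = v s := by
    rw [← hz, Valuation.map_add_eq_of_lt_left]
    rw [map_mul, hc, one_mul, map_inv₀]
    exact (inv_lt_one_of_one_lt₀ h1).trans h1
  obtain ⟨z, hz⟩ := IsAlgClosed.exists_root (C 1 * X ^ 2 + C (-s) * X + C c : K[X])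
    (by rw [degree_quadratic one_ne_zero]; decide)
  have hz : z ^ 2 - s * z + c = 0 := by
    simpa [IsRoot, sub_eq_add_neg] using hz
  have hc0 : c ≠ 0 := by rintro rfl; simp at hc
  have hz0 : z ≠ 0 := by rintro rfl; simp [hc0] at hz
  have hzs : z + c * z⁻¹ = s := by
    field_simp
    linear_combination hz
  rcases lt_trichotomy (v z) 1 with h | h | h
  · have hzs' : c * z⁻¹ + c * (c * z⁻¹)⁻¹ = s := by
      rw [← hzs]; field_simp; ring
    refine ⟨c * z⁻¹, mul_ne_zero hc0 (inv_ne_zero hz0), hzs', key _ hzs' ?_⟩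
    rw [map_mul, hc, one_mul, map_inv₀]
    exact (one_lt_inv₀ (zero_lt_iff.2 (v.ne_zero_iff.2 hz0))).2 h
  · refine absurd hs (not_lt.2 ?_)
    rw [← hzs]
    refine v.map_add_le h.le ?_
    simp [hc, h]
  · exact ⟨z, hz0, hzs, key z hzs h⟩

theorem exists_sub_inv_eq [IsAlgClosed K] {s : K} (h2 : v 2 = 1) (hs : v s < 1) :
    ∃ z, z ≠ 0 ∧ z - z⁻¹ = s ∧ v z = 1 ∧ v (z - 1) = v s := by
  have key (z : K) (hz : z ≠ 0) (hzs : z - z⁻¹ = s) (hz1 : v z = 1) (hlt : v (z - 1) < 1) :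
      v (z - 1) = v s := by
    have hp : v (z + 1) = 1 := by
      rw [show z + 1 = z - 1 + 2 by ring, v.map_add_eq_of_lt_right (by rwa [h2]), h2]
    have h : (z - 1) * (z + 1) = s * z := by
      rw [← hzs]; field_simp; ring
    simpa [hp, hz1] using congrArg v h
  obtain ⟨z, hz⟩ := IsAlgClosed.exists_root (C 1 * X ^ 2 + C (-s) * X + C (-1) : K[X])
    (by rw [degree_quadratic one_ne_zero]; decide)
  have hz : z * (z - s) = 1 := by
    have : z ^ 2 - s * z - 1 = 0 := by simpa [IsRoot, sub_eq_add_neg] using hz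
    linear_combination this
  have hz0 : z ≠ 0 := by rintro rfl; simp at hz
  have hzs : z - z⁻¹ = s := by
    field_simp
    linear_combination hz
  have hvz : v z * v (z - s) = 1 := by rw [← map_mul, hz, map_one]
  have hz1 : v z = 1 := by
    rcases lt_trichotomy (v z) 1 with h | h | h
    · exact absurd hvz (mul_lt_one_of_lt_of_le h (v.map_sub_lt h hs).le).ne
    · exact h
    · rw [v.map_sub_eq_of_lt_left (hs.trans h)] at hvz
      exact absurd hvz (one_lt_mul_of_lt_of_le h h.le).ne'
  by_cases hlt : v (z - 1) < 1
  · exact ⟨z, hz0, hzs, hz1, key z hz0 hzs hz1 hlt⟩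
  · have hle : v (z - 1) = 1 := le_antisymm (v.map_sub_le hz1.le (map_one v).le) (not_lt.1 hlt)
    have hp : v (z + 1) = v s := by
      have h : (z - 1) * (z + 1) = s * z := by linear_combination hz
      simpa [hle, hz1] using congrArg v h
    have hzs' : -z⁻¹ - (-z⁻¹)⁻¹ = s := by rw [← hzs]; field_simp; ring
    refine ⟨-z⁻¹, neg_ne_zero.2 (inv_ne_zero hz0), hzs', by simp [hz1], ?_⟩
    rw [show -z⁻¹ - 1 = -((z + 1) * z⁻¹) by field_simp; ring, Valuation.map_neg, map_mul, hp,
      map_inv₀, hz1, inv_one, mul_one]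

/-- The roots of the quartic `X(X-1)(X+1)(X-A)+1` when `A` is large: they are close to
`A`, `1`, `-1` and `0`. -/
theorem exists_quartic_roots [IsAlgClosed K] {A : K} (h2 : v 2 = 1) (hA : 1 < v A) :
    ∃ α₁ α₂ α₃ α₄ : K,
      (∀ x y, x * (x - y) * (x + y) * (x - A * y) + y ^ 4 =
        (x - α₁ * y) * (x - α₂ * y) * (x - α₃ * y) * (x - α₄ * y)) ∧
      v α₁ = v A ∧ v (α₂ - 1) = (v A)⁻¹ ∧ v (α₃ + 1) = (v A)⁻¹ ∧ v α₄ = (v A)⁻¹ := by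
  obtain ⟨t, ht0, ht, hvt⟩ := exists_add_mul_inv_eq v (map_one v) hA
  obtain ⟨α, hα0, hα, hvα⟩ := exists_add_mul_inv_eq v (c := -1) (s := t) (by simp) (by rwa [hvt])
  obtain ⟨δ, hδ0, hδ, hvδ, hvδ1⟩ := exists_sub_inv_eq v (s := t⁻¹) h2
    (by rw [map_inv₀, hvt]; exact inv_lt_one_of_one_lt₀ hA)
  rw [map_inv₀, hvt] at hvδ1
  refine ⟨α, δ, -δ⁻¹, -α⁻¹, fun x y => ?_, hvα.trans hvt, hvδ1, ?_, ?_⟩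
  · have h1 : (x - α * y) * (x - -α⁻¹ * y) = x ^ 2 - t * x * y - y ^ 2 := by
      rw [← hα]; field_simp; ring
    have h3 : (x - δ * y) * (x - -δ⁻¹ * y) = x ^ 2 - t⁻¹ * x * y - y ^ 2 := by
      rw [← hδ]; field_simp; ring
    have h4 : (x - α * y) * (x - δ * y) * (x - -δ⁻¹ * y) * (x - -α⁻¹ * y) =
      (x ^ 2 - t * x * y - y ^ 2) * (x ^ 2 - t⁻¹ * x * y - y ^ 2) := by
      rw [← h1, ← h3]; ring
    rw [h4, ← ht]
    field_simp
    ring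
  · rw [show -δ⁻¹ + 1 = (δ - 1) * δ⁻¹ by field_simp; ring, map_mul, hvδ1, map_inv₀, hvδ, inv_one,
      mul_one]
  · rw [Valuation.map_neg, map_inv₀, hvα, hvt]

end Roots

section DividedDifferences

variable {K : Type*} [Field K] {Γ : Type*} [LinearOrderedCommGroupWithZero Γ] (v : Valuation K Γ)

theorem valuation_sub_eq_one {x b c : K} (hx : v (x - c) < 1) (hcb : v (c - b) = 1) :
    v (x - b) = 1 := by
  rw [show x - b = x - c + (c - b) by ring, v.map_add_eq_of_lt_right (by rwa [hcb]), hcb]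

/-- A cubic polynomial that is bounded at one large point and at three points with distinct
residues has small coefficients, hence is constant if its coefficients are never small. -/
theorem cubic_coeff_eq_zero {g₀ g₁ g₂ g₃ α₁ α₂ α₃ α₄ : K}
    (h₁₂ : 1 < v (α₁ - α₂)) (h₁₃ : 1 < v (α₁ - α₃)) (h₁₄ : 1 < v (α₁ - α₄))
    (h₂₃ : v (α₂ - α₃) = 1) (h₂₄ : v (α₂ - α₄) = 1) (h₃₄ : v (α₃ - α₄) = 1)
    (hg : ∀ α ∈ ({α₁, α₂, α₃, α₄} : Set K), v (g₀ + g₁ * α + g₂ * α ^ 2 + g₃ * α ^ 3) ≤ 1)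
    (hg₁ : v g₁ < 1 → g₁ = 0) (hg₂ : v g₂ < 1 → g₂ = 0) (hg₃ : v g₃ < 1 → g₃ = 0) :
    g₁ = 0 ∧ g₂ = 0 ∧ g₃ = 0 := by
  have small {u w z : K} (hu : 1 < v u) (hz : v z ≤ 1) (h : u * w = z) : v w < 1 := by
    by_contra! hw
    rw [← h, map_mul] at hz
    exact absurd hz (not_le.2 (one_lt_mul_of_lt_of_le hu hw))
  have bdd {u w z : K} (hu : v u = 1) (hz : v z ≤ 1) (h : u * w = z) : v w ≤ 1 := by
    rwa [← h, map_mul, hu, one_mul] at hz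
  have e₁ := hg α₁ (by simp)
  have e₂ := hg α₂ (by simp)
  have e₃ := hg α₃ (by simp)
  have e₄ := hg α₄ (by simp)
  have d₁₂ : v (g₁ + g₂ * (α₁ + α₂) + g₃ * (α₁ ^ 2 + α₁ * α₂ + α₂ ^ 2)) < 1 :=
    small h₁₂ (v.map_sub_le e₁ e₂) (by ring)
  have d₂₃ : v (g₁ + g₂ * (α₂ + α₃) + g₃ * (α₂ ^ 2 + α₂ * α₃ + α₃ ^ 2)) ≤ 1 :=
    bdd h₂₃ (v.map_sub_le e₂ e₃) (by ring)
  have d₃₄ : v (g₁ + g₂ * (α₃ + α₄) + g₃ * (α₃ ^ 2 + α₃ * α₄ + α₄ ^ 2)) ≤ 1 :=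
    bdd h₃₄ (v.map_sub_le e₃ e₄) (by ring)
  have d₁₂₃ : v (g₂ + g₃ * (α₁ + α₂ + α₃)) < 1 :=
    small h₁₃ (v.map_sub_le d₁₂.le d₂₃) (by ring)
  have d₂₃₄ : v (g₂ + g₃ * (α₂ + α₃ + α₄)) ≤ 1 :=
    bdd h₂₄ (v.map_sub_le d₂₃ d₃₄) (by ring)
  have z₃ : g₃ = 0 := hg₃ (small h₁₄ (v.map_sub_le d₁₂₃.le d₂₃₄) (by ring))
  have z₂ : g₂ = 0 := hg₂ (by simpa [z₃] using d₁₂₃)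
  exact ⟨hg₁ (by simpa [z₃, z₂] using d₁₂), z₂, z₃⟩

end DividedDifferences

/-- The quartic polynomial `X(X-1)(X+1)(X-a)+1`. -/
noncomputable def thueQuartic {R : Type*} [CommRing R] (a : R) : R[X] :=
  X * (X - 1) * (X + 1) * (X - C a) + 1

theorem thueQuartic_eq {R : Type*} [CommRing R] (a : R) :
    thueQuartic a = X ^ 4 - C a * X ^ 3 - X ^ 2 + C a * X + 1 := by
  rw [thueQuartic]; ring

theorem natDegree_thueQuartic {R : Type*} [CommRing R] [Nontrivial R] (a : R) :
    (thueQuartic a).natDegree = 4 := by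
  rw [thueQuartic_eq]; compute_degree!

theorem monic_thueQuartic {R : Type*} [CommRing R] [Nontrivial R] (a : R) :
    (thueQuartic a).Monic := by
  rw [thueQuartic_eq]; monicity!

/-- The roots of the quartic in a field with a valuation `v` extending the degree valuation of
`ℂ[X]` along `ι`; they are close to `a`, `1`, `-1` and `0` respectively. -/
structure ThueRoots (a : ℂ[X]) {K : Type*} [Field K] {Γ : Type*} [LinearOrderedCommGroupWithZero Γ]
    (v : Valuation K Γ) (ι : ℂ[X] →+* K) (τ : Γ) (α₁ α₂ α₃ α₄ : K) : Prop where
  natDegree_pos : 0 < a.natDegree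
  one_lt : 1 < τ
  map_eq : ∀ p : ℂ[X], p ≠ 0 → v (ι p) = τ ^ (p.natDegree : ℤ)
  factor : ∀ x y, x * (x - y) * (x + y) * (x - ι a * y) + y ^ 4 =
    (x - α₁ * y) * (x - α₂ * y) * (x - α₃ * y) * (x - α₄ * y)
  val₁ : v α₁ = τ ^ (a.natDegree : ℤ)
  val₂ : v (α₂ - 1) = τ ^ (-a.natDegree : ℤ)
  val₃ : v (α₃ + 1) = τ ^ (-a.natDegree : ℤ)
  val₄ : v α₄ = τ ^ (-a.natDegree : ℤ)

theorem exists_thueRoots {a : ℂ[X]} (ha : 0 < a.natDegree) :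
    ∃ (K : Type) (_ : Field K) (Γ : Type) (_ : LinearOrderedCommGroupWithZero Γ)
      (v : Valuation K Γ) (ι : ℂ[X] →+* K) (τ : Γ) (α₁ α₂ α₃ α₄ : K),
      ThueRoots a v ι τ α₁ α₂ α₃ α₄ := by
  obtain ⟨K, _, _, ι, Γ, _, v, τ, hτ, hv⟩ := exists_valuation_eq_pow_natDegree ℂ
  have two : v 2 = 1 := by
    have h := hv (C 2) (by simp)
    rwa [natDegree_C, pow_zero, map_ofNat C 2, map_ofNat ι 2] at h
  have hva := hv a (by rintro rfl; simp at ha)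
  have hA : 1 < v (ι a) := by rw [hva]; exact one_lt_pow₀ hτ ha.ne'
  obtain ⟨α₁, α₂, α₃, α₄, hprod, v₁, v₂, v₃, v₄⟩ := exists_quartic_roots v two hA
  rw [hva, ← zpow_natCast, ← zpow_neg] at v₂ v₃ v₄
  rw [hva, ← zpow_natCast] at v₁
  exact ⟨K, _, Γ, _, v, ι, τ, α₁, α₂, α₃, α₄, ha, hτ, by simpa using hv, hprod, v₁, v₂, v₃, v₄⟩

namespace ThueRoots

variable {a : ℂ[X]} {K : Type*} [Field K] {Γ : Type*} [LinearOrderedCommGroupWithZero Γ]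
  {v : Valuation K Γ} {ι : ℂ[X] →+* K} {τ : Γ} {α₁ α₂ α₃ α₄ : K}
  (R : ThueRoots a v ι τ α₁ α₂ α₃ α₄)

include R

theorem ne_zero : τ ≠ 0 := (zero_lt_one.trans R.one_lt).ne'

theorem val_two : v 2 = 1 := by
  have h := R.map_eq (C 2) (by simp)
  rwa [natDegree_C, Nat.cast_zero, zpow_zero, map_ofNat C 2, map_ofNat ι 2] at h

theorem zpow_neg_lt_one : τ ^ (-a.natDegree : ℤ) < 1 :=
  zpow_lt_one_of_neg₀ R.one_lt (by simpa using R.natDegree_pos)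

theorem one_lt_val₁ : 1 < v α₁ := by
  rw [R.val₁]
  exact one_lt_zpow₀ R.one_lt (by exact_mod_cast R.natDegree_pos)

theorem near₂ : v (α₂ - 1) < 1 := R.val₂ ▸ R.zpow_neg_lt_one

theorem near₃ : v (α₃ - -1) < 1 := by
  rw [sub_neg_eq_add, R.val₃]
  exact R.zpow_neg_lt_one

theorem near₄ : v (α₄ - 0) < 1 := by
  rw [sub_zero, R.val₄]
  exact R.zpow_neg_lt_one

theorem val₁_sub_one : v (α₁ - 1) = τ ^ (a.natDegree : ℤ) := by
  rw [v.map_sub_eq_of_lt_left (by simpa using R.one_lt_val₁), R.val₁]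

theorem val₁_add_one : v (α₁ + 1) = τ ^ (a.natDegree : ℤ) := by
  rw [v.map_add_eq_of_lt_left (by simpa using R.one_lt_val₁), R.val₁]

theorem val₂_self : v α₂ = 1 := by
  simpa using valuation_sub_eq_one v (b := 0) R.near₂ (by simp)

theorem val₂_add_one : v (α₂ + 1) = 1 := by
  simpa using valuation_sub_eq_one v (b := -1) R.near₂ (by norm_num [R.val_two])

theorem val₃_self : v α₃ = 1 := by
  simpa using valuation_sub_eq_one v (b := 0) R.near₃ (by simp)

theorem val₃_sub_one : v (α₃ - 1) = 1 :=
  valuation_sub_eq_one v R.near₃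
    (by rw [show (-1 - 1 : K) = -2 by norm_num, Valuation.map_neg, R.val_two])

theorem val₄_sub_one : v (α₄ - 1) = 1 := valuation_sub_eq_one v R.near₄ (by simp)

theorem val₄_add_one : v (α₄ + 1) = 1 := by
  simpa using valuation_sub_eq_one v (b := -1) R.near₄ (by simp)

theorem mul_eq_neg_one {α : K} (hα : α ∈ ({α₁, α₂, α₃, α₄} : Set K)) :
    α * (α - 1) * (α + 1) * (α - ι a) = -1 := by
  have h1 := R.factor α 1
  have h2 : (α - α₁) * (α - α₂) * (α - α₃) * (α - α₄) = 0 := by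
    rcases hα with rfl | rfl | rfl | rfl <;> simp
  simp only [mul_one, one_pow, h2] at h1
  exact eq_neg_of_add_eq_zero_left h1

/-- A polynomial expression which is bounded at the four roots of the quartic is constant modulo
the quartic. -/
theorem exists_eq_thueQuartic_mul_add_C
    (G : ℂ[X][X]) (hG : ∀ α ∈ ({α₁, α₂, α₃, α₄} : Set K), v (G.eval₂ ι α) ≤ 1) :
    ∃ (q : ℂ[X][X]) (c : ℂ), G = thueQuartic a * q + C (C c) := by
  have hvlt (p : ℂ[X]) (hp : v (ι p) < 1) : p = 0 := by
    by_contra h0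
    rw [R.map_eq p h0, zpow_natCast] at hp
    exact absurd (one_le_pow₀ R.one_lt.le) (not_le.2 hp)
  have hvlt' (p : ℂ[X]) (hp : v (ι p) < 1) : ι p = 0 := by rw [hvlt p hp, map_zero]
  have hvle (p : ℂ[X]) (hp : v (ι p) ≤ 1) : ∃ c, p = C c := by
    by_cases h0 : p = 0
    · exact ⟨0, by simp [h0]⟩
    · refine ⟨_, eq_C_of_natDegree_eq_zero ?_⟩
      by_contra hd
      rw [R.map_eq p h0, zpow_natCast] at hp
      exact absurd (one_lt_pow₀ R.one_lt hd) (not_lt.2 hp)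
  set g := G %ₘ thueQuartic a with hgdef
  have hdiv : g + thueQuartic a * (G /ₘ thueQuartic a) = G := modByMonic_add_div G _
  have hdeg : g.natDegree < 4 := by
    rw [← natDegree_thueQuartic a]
    exact natDegree_modByMonic_lt _ (monic_thueQuartic a) fun h => by
      simpa [h] using natDegree_thueQuartic a
  have hg : g = C (g.coeff 0) + C (g.coeff 1) * X + C (g.coeff 2) * X ^ 2 +
      C (g.coeff 3) * X ^ 3 := by
    conv_lhs => rw [as_sum_range_C_mul_X_pow' g hdeg]
    simp [Finset.sum_range_succ]
  have hbdd : ∀ α ∈ ({α₁, α₂, α₃, α₄} : Set K), v (ι (g.coeff 0) + ι (g.coeff 1) * α +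
      ι (g.coeff 2) * α ^ 2 + ι (g.coeff 3) * α ^ 3) ≤ 1 := by
    intro α hα
    have h : g.eval₂ ι α = G.eval₂ ι α := by
      rw [← hdiv, eval₂_add, eval₂_mul,
        show (thueQuartic a).eval₂ ι α = 0 by simp [thueQuartic, R.mul_eq_neg_one hα],
        zero_mul, add_zero]
    have hb := hG α hα
    rw [← h, hg] at hb
    simpa [eval₂_add, eval₂_mul, eval₂_pow] using hb
  have h₁ := R.one_lt_val₁
  have v₂ := R.val₂_self
  have v₃ := R.val₃_self
  have v₄ : v α₄ < 1 := by simpa using R.near₄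
  obtain ⟨z₁, z₂, z₃⟩ := cubic_coeff_eq_zero v
    (by rwa [v.map_sub_eq_of_lt_left (by rwa [v₂])])
    (by rwa [v.map_sub_eq_of_lt_left (by rwa [v₃])])
    (by rwa [v.map_sub_eq_of_lt_left (v₄.trans h₁)])
    (by
      rw [Valuation.map_sub_swap]
      refine valuation_sub_eq_one v R.near₃ ?_
      rw [show -1 - α₂ = -(α₂ + 1) by ring, Valuation.map_neg, R.val₂_add_one])
    (by
      rw [Valuation.map_sub_swap]
      exact valuation_sub_eq_one v R.near₄ (by simp [v₂]))
    (by
      rw [Valuation.map_sub_swap]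
      exact valuation_sub_eq_one v R.near₄ (by simp [v₃]))
    hbdd (hvlt' _) (hvlt' _) (hvlt' _)
  have c₁ : g.coeff 1 = 0 := hvlt _ (by simp [z₁])
  have c₂ : g.coeff 2 = 0 := hvlt _ (by simp [z₂])
  have c₃ : g.coeff 3 = 0 := hvlt _ (by simp [z₃])
  obtain ⟨c, hc⟩ := hvle (g.coeff 0) (by simpa [z₁, z₂, z₃] using hbdd α₁ (by simp))
  refine ⟨G /ₘ thueQuartic a, c, ?_⟩
  rw [← hc, add_comm]
  conv_lhs => rw [← hdiv, hg]
  simp [c₁, c₂, c₃]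

/-- Specializing at a point where `a = 2` makes the quartic a square, so that bounded expressions
take equal, critical values at the golden ratio and at its conjugate. -/
theorem exists_critical_value {T₀ : ℂ} (h : a.eval T₀ = 2) (G : ℂ[X][X])
    (hG : ∀ α ∈ ({α₁, α₂, α₃, α₄} : Set K), v (G.eval₂ ι α) ≤ 1) :
    ∃ c, ∀ z : ℂ, z ^ 2 = z + 1 → (G.map (evalRingHom T₀)).eval z = c ∧
      (derivative (G.map (evalRingHom T₀))).eval z = 0 := by
  obtain ⟨q, c, hq⟩ := R.exists_eq_thueQuartic_mul_add_C G hG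
  refine ⟨c, fun z hz => ?_⟩
  have hz' : z ^ 2 - z - 1 = 0 := by rw [hz]; ring
  rw [hq, Polynomial.map_add, Polynomial.map_mul,
    show (thueQuartic a).map (evalRingHom T₀) = (X ^ 2 - X - 1) ^ 2 by
      simp [thueQuartic, h, map_ofNat C 2]; ring]
  constructor <;> simp [derivative_pow, hz']

theorem factor_eq {ξ : ℂ} {x y : ℂ[X]}
    (h : x * (x - y) * (x + y) * (x - a * y) + y ^ 4 = C ξ) (hξ : ξ ≠ 0) :
    v (ι x - α₁ * ι y) * v (ι x - α₂ * ι y) * v (ι x - α₃ * ι y) * v (ι x - α₄ * ι y) = 1 := by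
  have hξv : v (ι (C ξ)) = 1 := by simpa using R.map_eq (C ξ) (by simpa)
  rw [← map_mul, ← map_mul, ← map_mul, ← R.factor, ← hξv, ← h]
  simp

end ThueRoots

theorem exists_eval_eq_two {a : ℂ[X]} (ha : 0 < a.natDegree) : ∃ T₀, a.eval T₀ = 2 := by
  have ha := natDegree_pos_iff_degree_pos.1 ha
  obtain ⟨T₀, hT₀⟩ := IsAlgClosed.exists_root (a - C 2) (by rw [degree_sub_C ha]; exact ha.ne')
  exact ⟨T₀, by simpa [sub_eq_zero] using hT₀⟩

theorem sub_mul_ne_zero_of_sq_eq {ξ : ℂ} (hξ : ξ ≠ 0) {x₀ y₀ z : ℂ}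
    (hF : x₀ * (x₀ - y₀) * (x₀ + y₀) * (x₀ - 2 * y₀) + y₀ ^ 4 = ξ) (hz : z ^ 2 = z + 1) :
    x₀ - y₀ * z ≠ 0 := by
  intro hu
  refine hξ ?_
  rw [← hF, sub_eq_zero.1 hu]
  linear_combination y₀ ^ 4 * (z ^ 2 - z - 1) * hz

/-- The logarithmic derivative of a product of powers. -/
theorem eval_derivative_mul_pow_eq_zero {k : Type*} [Field k] {P Q R : k[X]} {p q r : ℕ} {z : k}
    (hP : P.eval z ≠ 0) (hQ : Q.eval z ≠ 0) (hR : R.eval z ≠ 0)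
    (h : (derivative (P ^ p * Q ^ q * R ^ r)).eval z = 0) :
    p * (derivative P).eval z * Q.eval z * R.eval z +
      q * P.eval z * (derivative Q).eval z * R.eval z +
      r * P.eval z * Q.eval z * (derivative R).eval z = 0 := by
  have hpow (S : k[X]) (s : ℕ) :
      derivative (S ^ s) * S = s * S ^ s * derivative S := by
    cases s with
    | zero => simp
    | succ s => simp [derivative_pow]; ring
  have key : derivative (P ^ p * Q ^ q * R ^ r) * (P * Q * R) = P ^ p * Q ^ q * R ^ r *
      (p * derivative P * Q * R + q * P * derivative Q * R + r * P * Q * derivative R) := by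
    simp only [derivative_mul]
    linear_combination Q ^ q * R ^ r * Q * R * hpow P p + P ^ p * R ^ r * P * R * hpow Q q +
      P ^ p * Q ^ q * P * Q * hpow R r
  have he := congrArg (eval z) key
  rw [eval_mul, h, zero_mul, eval_mul] at he
  refine (mul_eq_zero.1 he.symm).resolve_left ?_ |> fun h => by simpa using h
  simp [hP, hQ, hR]

open Real goldenRatio in
theorem natDegree_eq_zero_of_natDegree_lt {ξ : ℂ} (hξ : ξ ≠ 0) {a x y : ℂ[X]}
    (ha : 0 < a.natDegree) (h : x * (x - y) * (x + y) * (x - a * y) + y ^ 4 = C ξ)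
    (hlt : y.natDegree < x.natDegree) : y.natDegree = 0 := by
  by_contra hn
  obtain ⟨K, _, Γ, _, v, ι, τ, α₁, α₂, α₃, α₄, R⟩ := exists_thueRoots ha
  have hx := R.map_eq x (by rintro rfl; simp at hlt)
  have hy := R.map_eq y (by rintro rfl; simp at hn)
  have hfact := R.factor_eq h hξ
  have v₁ := R.val₁
  have v₄ := R.val₄
  have hneg := R.zpow_neg_lt_one
  set m := x.natDegree
  set n := y.natDegree
  set d := a.natDegree
  have hyx : v (ι y) < v (ι x) := by
    rw [hx, hy]; exact zpow_lt_zpow_right₀ R.one_lt (by exact_mod_cast hlt)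
  have β₂ : v (ι x - α₂ * ι y) = τ ^ (m : ℤ) := by
    rw [v.map_sub_eq_of_lt_left (by simpa [R.val₂_self]), hx]
  have β₃ : v (ι x - α₃ * ι y) = τ ^ (m : ℤ) := by
    rw [v.map_sub_eq_of_lt_left (by simpa [R.val₃_self]), hx]
  have β₄ : v (ι x - α₄ * ι y) = τ ^ (m : ℤ) := by
    rw [v.map_sub_eq_of_lt_left, hx]
    rw [map_mul, v₄]
    exact (mul_le_of_le_one_left' hneg.le).trans_lt hyx
  have β₁ : v (ι x - α₁ * ι y) = τ ^ (-(3 * m) : ℤ) := by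
    rw [β₂, β₃, β₄, mul_assoc, mul_assoc, ← zpow_add₀ R.ne_zero, ← zpow_add₀ R.ne_zero] at hfact
    rw [eq_inv_of_mul_eq_one_left hfact, ← zpow_neg]
    congr 1; ring
  have hm : m = d + n := by
    by_contra hne
    have h1 : v (ι x) ≠ v (α₁ * ι y) := by
      rw [map_mul, v₁, hx, hy, ← zpow_add₀ R.ne_zero]
      intro he
      have := zpow_right_injective₀ (zero_lt_one.trans R.one_lt) R.one_lt.ne' he
      lia
    have h2 : v (ι x) ≤ v (ι x - α₁ * ι y) := by
      rw [sub_eq_add_neg, v.map_add_of_distinct_val (by simpa using h1)]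
      exact le_max_left _ _
    rw [β₁, hx, zpow_le_zpow_iff_right₀ R.one_lt] at h2
    lia
  obtain ⟨T₀, hT₀⟩ := exists_eval_eq_two ha
  obtain ⟨c, hc⟩ := R.exists_critical_value hT₀
    ((C x - C y * X) ^ d * (X * (X - 1) * (X + 1)) ^ m) (by
      intro α hα
      refine le_of_eq ?_
      simp only [eval₂_mul, eval₂_pow, eval₂_sub, eval₂_add, eval₂_C, eval₂_X, eval₂_one, map_mul,
        map_pow, mul_comm (ι y)]
      rcases hα with rfl | rfl | rfl | rfl <;>
      simp only [β₁, β₂, β₃, β₄, v₁, v₄, R.val₂, R.val₃, R.val₁_sub_one, R.val₁_add_one,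
        R.val₂_self, R.val₂_add_one, R.val₃_self, R.val₃_sub_one, R.val₄_sub_one, R.val₄_add_one,
        one_mul, mul_one] <;>
      simp only [← zpow_natCast, ← zpow_mul, ← zpow_add₀ R.ne_zero] <;>
      convert zpow_zero τ using 2 <;>
      ring)
  set x₀ := x.eval T₀
  set y₀ := y.eval T₀
  have hF : x₀ * (x₀ - y₀) * (x₀ + y₀) * (x₀ - 2 * y₀) + y₀ ^ 4 = ξ := by
    simpa [hT₀] using congrArg (eval T₀) h
  have crit {z : ℂ} (hz : z ^ 2 = z + 1) :
      (x₀ - y₀ * z) ^ d * (z ^ 2) ^ m = c ∧ d * y₀ = m * z ^ 2 * (x₀ - y₀ * z) := by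
    have hz0 : z ≠ 0 := by rintro rfl; simp at hz
    have hcube : z * (z - 1) * (z + 1) = z ^ 2 := by linear_combination z * hz
    obtain ⟨e₁, e₂⟩ := hc z hz
    have hmap : ((C x - C y * X) ^ d * (X * (X - 1) * (X + 1)) ^ m : ℂ[X][X]).map
        (evalRingHom T₀) = (C x₀ - C y₀ * X) ^ d * (X * (X - 1) * (X + 1)) ^ m * 1 ^ 0 := by
      simp [x₀, y₀]
    rw [hmap] at e₁ e₂
    have e₃ := eval_derivative_mul_pow_eq_zero
      (by simpa using sub_mul_ne_zero_of_sq_eq hξ hF hz) (by simpa [hcube] using hz0) (by simp) e₂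
    refine ⟨by simpa [hcube] using e₁, ?_⟩
    simp [hcube] at e₃
    refine mul_right_cancel₀ (pow_ne_zero 2 hz0) ?_
    linear_combination -e₃ - m * (x₀ - y₀ * z) * (z ^ 2 + z - 1) * hz
  have sq₁ : (φ : ℂ) ^ 2 = φ + 1 := by exact_mod_cast goldenRatio_sq
  have sq₂ : (ψ : ℂ) ^ 2 = ψ + 1 := by exact_mod_cast goldenConj_sq
  obtain ⟨ec, ed⟩ := crit sq₁
  obtain ⟨ec', ed'⟩ := crit sq₂
  have w0 := sub_mul_ne_zero_of_sq_eq hξ hF sq₂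
  set u := x₀ - y₀ * φ
  set w := x₀ - y₀ * ψ
  have hm0 : (m : ℂ) ≠ 0 := by simp; lia
  have huw : u * (φ : ℂ) ^ 2 = w * (ψ : ℂ) ^ 2 :=
    mul_left_cancel₀ hm0 (by linear_combination ed' - ed)
  have hpow : ((φ : ℂ) ^ 2) ^ n = ((ψ : ℂ) ^ 2) ^ n := by
    rw [← ec', hm, pow_add, pow_add, ← mul_assoc, ← mul_assoc, ← mul_pow, ← mul_pow, huw] at ec
    refine mul_left_cancel₀ (pow_ne_zero d (mul_ne_zero w0 ?_)) ec
    exact pow_ne_zero 2 (by exact_mod_cast goldenConj_ne_zero)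
  have hpow' : (φ ^ 2) ^ n = (ψ ^ 2) ^ n := by exact_mod_cast hpow
  have hsq : ψ ^ 2 < φ ^ 2 := by
    rw [goldenRatio_sq, goldenConj_sq]
    linarith [one_lt_goldenRatio, goldenConj_neg]
  exact absurd hpow' (pow_lt_pow_left₀ hsq (sq_nonneg _) hn).ne'

theorem pow_mul_pow_eq {k : Type*} [Field k] {u w p q k₁ k₂ c : k} {d m : ℕ}
    (hp : u ^ d * (p ^ 3) ^ m * p ^ (3 * m + d) = c)
    (hq : w ^ d * (q ^ 3) ^ m * q ^ (3 * m + d) = c)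
    (huw : u * k₁ = w * k₂) (hu : u ≠ 0) :
    k₂ ^ d * p ^ (6 * m + d) = k₁ ^ d * q ^ (6 * m + d) := by
  refine mul_left_cancel₀ (pow_ne_zero d hu) ?_
  calc u ^ d * (k₂ ^ d * p ^ (6 * m + d))
      = k₂ ^ d * (u ^ d * (p ^ 3) ^ m * p ^ (3 * m + d)) := by ring
    _ = (w * k₂) ^ d * q ^ (6 * m + d) := by rw [hp, ← hq]; ring
    _ = _ := by rw [← huw]; ring

open Real goldenRatio in
theorem natDegree_le_natDegree_sub {ξ : ℂ} (hξ : ξ ≠ 0) {a x y : ℂ[X]}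
    (ha : 0 < a.natDegree) (h : x * (x - y) * (x + y) * (x - a * y) + y ^ 4 = C ξ)
    (hxy : x.natDegree = y.natDegree) (hne : x - y ≠ 0) :
    x.natDegree ≤ (x - y).natDegree := by
  by_contra! hlt
  obtain ⟨K, _, Γ, _, v, ι, τ, α₁, α₂, α₃, α₄, R⟩ := exists_thueRoots ha
  have hx := R.map_eq x (by rintro rfl; simp at hlt)
  have hy := R.map_eq y (by rintro rfl; simp at hxy; simp [hxy] at hlt)
  have hsub := R.map_eq _ hne
  have hfact := R.factor_eq h hξ
  have v₁ := R.val₁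
  have v₄ := R.val₄
  have hneg := R.zpow_neg_lt_one
  have hpos := R.one_lt_val₁
  rw [← hxy] at hy
  set m := x.natDegree
  set d := a.natDegree
  rw [v₁] at hpos
  have hτm : (0 : Γ) < τ ^ (m : ℤ) := zpow_pos (zero_lt_one.trans R.one_lt) _
  have β₁ : v (ι x - α₁ * ι y) = τ ^ (d + m : ℤ) := by
    rw [v.map_sub_eq_of_lt_right, map_mul, v₁, hy, zpow_add₀ R.ne_zero]
    rw [map_mul, v₁, hx, hy]
    exact lt_mul_of_one_lt_left hτm hpos
  have β₄ : v (ι x - α₄ * ι y) = τ ^ (m : ℤ) := by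
    rw [v.map_sub_eq_of_lt_left, hx]
    rw [map_mul, v₄, hx, hy]
    exact mul_lt_of_lt_one_left hτm hneg
  have β₃ : v (ι x - α₃ * ι y) = τ ^ (m : ℤ) := by
    have h1 : v ((1 - α₃) * ι y) = τ ^ (m : ℤ) := by
      rw [map_mul, Valuation.map_sub_swap, R.val₃_sub_one, one_mul, hy]
    rw [show ι x - α₃ * ι y = ι (x - y) + (1 - α₃) * ι y by rw [map_sub]; ring,
      v.map_add_eq_of_lt_right, h1]
    rw [h1, hsub]
    exact zpow_lt_zpow_right₀ R.one_lt (by exact_mod_cast hlt)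
  have β₂ : v (ι x - α₂ * ι y) = τ ^ (-(d + 3 * m) : ℤ) := by
    rw [β₁, β₃, β₄, mul_comm (τ ^ (d + m : ℤ)), mul_assoc, mul_assoc, ← zpow_add₀ R.ne_zero,
      ← zpow_add₀ R.ne_zero] at hfact
    rw [eq_inv_of_mul_eq_one_left hfact, ← zpow_neg]
    congr 1; ring
  have hinv (α : K) (hα : α ∈ ({α₁, α₂, α₃, α₄} : Set K)) :
      v (-α * (α + 1) * (α - ι a)) = (v (α - 1))⁻¹ := by
    refine eq_inv_of_mul_eq_one_left ?_
    rw [← map_mul, ← map_one v]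
    congr 1
    linear_combination -R.mul_eq_neg_one hα
  obtain ⟨T₀, hT₀⟩ := exists_eval_eq_two ha
  obtain ⟨c, hc⟩ := R.exists_critical_value hT₀
    ((C x - C y * X) ^ d * (X * (X + 1)) ^ m * (-X * (X + 1) * (X - C a)) ^ (3 * m + d)) (by
      intro α hα
      refine le_of_eq ?_
      simp only [eval₂_mul, eval₂_pow, eval₂_sub, eval₂_add, eval₂_C, eval₂_X, eval₂_one, eval₂_neg,
        mul_comm (ι y)]
      rw [map_mul, map_pow _ (-α * (α + 1) * (α - ι a)), hinv α hα]
      simp only [map_mul, map_pow]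
      rcases hα with rfl | rfl | rfl | rfl <;>
      simp only [β₁, β₂, β₃, β₄, v₁, v₄, R.val₂, R.val₃, R.val₁_sub_one, R.val₁_add_one,
        R.val₂_self, R.val₂_add_one, R.val₃_self, R.val₃_sub_one, R.val₄_sub_one, R.val₄_add_one,
        one_mul, mul_one, inv_one, one_pow] <;>
      simp only [← zpow_natCast, ← zpow_neg, ← zpow_mul, ← zpow_add₀ R.ne_zero] <;>
      convert zpow_zero τ using 2 <;>
      push_cast <;>
      ring)
  set x₀ := x.eval T₀
  set y₀ := y.eval T₀
  have hF : x₀ * (x₀ - y₀) * (x₀ + y₀) * (x₀ - 2 * y₀) + y₀ ^ 4 = ξ := by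
    simpa [hT₀] using congrArg (eval T₀) h
  have crit {z : ℂ} (hz : z ^ 2 = z + 1) :
      (x₀ - y₀ * z) ^ d * (z ^ 3) ^ m * z ^ (3 * m + d) = c ∧
        d * y₀ = (m - (3 * m + d) * z) * (x₀ - y₀ * z) := by
    have hz0 : z ≠ 0 := by rintro rfl; simp at hz
    have hcube : z * (z + 1) = z ^ 3 := by linear_combination -z * hz
    have hinv₀ : -(z ^ 3 * (z - 2)) = z := by
      linear_combination (-z ^ 2 + z) * hz
    obtain ⟨e₁, e₂⟩ := hc z hz
    have hmap : ((C x - C y * X) ^ d * (X * (X + 1)) ^ m *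
        (-X * (X + 1) * (X - C a)) ^ (3 * m + d) : ℂ[X][X]).map (evalRingHom T₀) =
        (C x₀ - C y₀ * X) ^ d * (X * (X + 1)) ^ m * (-X * (X + 1) * (X - C 2)) ^ (3 * m + d) := by
      simp [x₀, y₀, hT₀]
    rw [hmap] at e₁ e₂
    have e₃ := eval_derivative_mul_pow_eq_zero
      (by simpa using sub_mul_ne_zero_of_sq_eq hξ hF hz) (by simpa [hcube] using hz0)
      (by simpa [hcube, hinv₀] using hz0) e₂
    refine ⟨by simpa [hcube, hinv₀] using e₁, ?_⟩
    simp [hcube, hinv₀] at e₃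
    refine mul_right_cancel₀ (pow_ne_zero 4 hz0) ?_
    linear_combination -e₃ - (m * z * (z + 1) + (3 * m + d) * z ^ 3 * (z + 2)) * (x₀ - y₀ * z) * hz
  have sq₁ : (φ : ℂ) ^ 2 = φ + 1 := by exact_mod_cast goldenRatio_sq
  have sq₂ : (ψ : ℂ) ^ 2 = ψ + 1 := by exact_mod_cast goldenConj_sq
  obtain ⟨ec, ed⟩ := crit sq₁
  obtain ⟨ec', ed'⟩ := crit sq₂
  have u0 := sub_mul_ne_zero_of_sq_eq hξ hF sq₁
  set u := x₀ - y₀ * φ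
  set w := x₀ - y₀ * ψ
  have hpow : ((m : ℂ) - (3 * m + d) * ψ) ^ d * (φ : ℂ) ^ (6 * m + d) =
      ((m : ℂ) - (3 * m + d) * φ) ^ d * (ψ : ℂ) ^ (6 * m + d) :=
    pow_mul_pow_eq ec ec' (by linear_combination ed' - ed) u0
  have hpow' : ((m : ℝ) - (3 * m + d) * ψ) ^ d * φ ^ (6 * m + d) =
      ((m : ℝ) - (3 * m + d) * φ) ^ d * ψ ^ (6 * m + d) := by exact_mod_cast hpow
  have habs : |(m : ℝ) - (3 * m + d) * ψ| ^ d * (φ ^ 2) ^ d * φ ^ (12 * m) =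
      |(m : ℝ) - (3 * m + d) * φ| ^ d := by
    have h1 := congrArg (fun r => |r * φ ^ (6 * m + d)|) hpow'
    simp only [mul_assoc, ← mul_pow, mul_comm ψ φ, goldenRatio_mul_goldenConj] at h1
    simp only [abs_mul, abs_pow, abs_neg, abs_one, one_pow, mul_one,
      abs_of_pos goldenRatio_pos] at h1
    have hexp (r s : ℝ) :
        r ^ d * (s * s) ^ (6 * m + d) = r ^ d * (s ^ 2) ^ d * s ^ (12 * m) := by ring
    rw [← hexp, h1]
  have hφ := one_lt_goldenRatio
  have hd : (0 : ℝ) < d := by exact_mod_cast ha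
  have hm : (0 : ℝ) < m := by exact_mod_cast (Nat.zero_le _).trans_lt hlt
  have hmφ : (0 : ℝ) < m * φ := mul_pos hm goldenRatio_pos
  have hdφ : (0 : ℝ) < d * φ := mul_pos hd goldenRatio_pos
  have hpos₂ : 0 < (m : ℝ) - (3 * m + d) * ψ := by
    nlinarith [goldenConj_neg]
  have hlt' : |(m : ℝ) - (3 * m + d) * φ| < |(m : ℝ) - (3 * m + d) * ψ| * φ ^ 2 := by
    have hval : ((m : ℝ) - (3 * m + d) * ψ) * φ ^ 2 = m * (φ + 1) + (3 * m + d) * φ := by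
      linear_combination m * goldenRatio_sq - (3 * m + d) * φ * goldenRatio_mul_goldenConj
    rw [abs_of_pos hpos₂, hval, abs_lt]
    constructor <;> nlinarith
  refine habs.not_gt ?_
  rw [← mul_pow]
  calc |(m : ℝ) - (3 * m + d) * φ| ^ d
      < (|(m : ℝ) - (3 * m + d) * ψ| * φ ^ 2) ^ d := pow_lt_pow_left₀ hlt' (abs_nonneg _) ha.ne'
    _ ≤ _ := le_mul_of_one_le_right (by positivity) (one_le_pow₀ hφ.le)

theorem exists_eq_C_of_pow_four_eq {ξ : ℂ} {p : ℂ[X]} (h : p ^ 4 = C ξ) :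
    ∃ ζ, ζ ^ 4 = ξ ∧ p = C ζ := by
  have hdeg : p.natDegree = 0 := by
    have := congrArg natDegree h
    simpa using this
  refine ⟨p.coeff 0, ?_, eq_C_of_natDegree_eq_zero hdeg⟩
  rw [eq_C_of_natDegree_eq_zero hdeg, ← C_pow] at h
  exact C_injective h

theorem exists_eq_of_natDegree_lt {ξ : ℂ} (hξ : ξ ≠ 0) {a x y : ℂ[X]} (ha : 0 < a.natDegree)
    (h : x * (x - y) * (x + y) * (x - a * y) + y ^ 4 = C ξ) (hlt : y.natDegree < x.natDegree)
    (hy : y ≠ 0) : ∃ ζ, ζ ^ 4 = ξ ∧ x = C ζ * a ∧ y = C ζ := by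
  obtain ⟨η, rfl⟩ := natDegree_eq_zero.1 (natDegree_eq_zero_of_natDegree_lt hξ ha h hlt)
  have hx : x.natDegree ≠ 0 := Nat.ne_zero_of_lt hlt
  have hprod : x * ((x - C η) * (x + C η) * (x - a * C η)) = C (ξ - η ^ 4) := by
    rw [C_sub, C_pow, ← h]; ring
  have hη : ξ - η ^ 4 = 0 := by
    by_contra h0
    refine hx (natDegree_eq_zero_of_isUnit (isUnit_of_mul_isUnit_left
      (y := (x - C η) * (x + C η) * (x - a * C η)) ?_))
    rw [hprod]; exact isUnit_C.2 (Ne.isUnit h0)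
  refine ⟨η, (sub_eq_zero.1 hη).symm, ?_, rfl⟩
  rw [hη, C_0] at hprod
  have hx0 : x ≠ 0 := by rintro rfl; simp at hx
  have h1 : x - C η ≠ 0 := fun h0 => hx (by rw [sub_eq_zero.1 h0, natDegree_C])
  have h2 : x + C η ≠ 0 := fun h0 => hx (by rw [eq_neg_of_add_eq_zero_left h0]; simp)
  simpa [hx0, h1, h2, sub_eq_zero, mul_comm a] using hprod

theorem natDegree_ne_natDegree {ξ : ℂ} (hξ : ξ ≠ 0) {a x y : ℂ[X]} (ha : 0 < a.natDegree)
    (h : x * (x - y) * (x + y) * (x - a * y) + y ^ 4 = C ξ) (hx : x ≠ 0) (hy : y ≠ 0)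
    (hsub : x - y ≠ 0) (hadd : x + y ≠ 0) : x.natDegree ≠ y.natDegree := by
  intro hxy
  have h1 := natDegree_le_natDegree_sub hξ ha h hxy hsub
  have h2 := natDegree_le_natDegree_sub (x := -y) (y := x) hξ ha (by rw [← h]; ring)
    (by rw [natDegree_neg, hxy]) (by rw [← neg_add', add_comm]; exact neg_ne_zero.2 hadd)
  rw [natDegree_neg, ← neg_add', natDegree_neg, add_comm y] at h2
  have ha0 : a ≠ 0 := by rintro rfl; simp at ha
  have heq : a * (x * y * (x - y) * (x + y)) = x ^ 4 - x ^ 2 * y ^ 2 + y ^ 4 - C ξ := by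
    rw [← h]; ring
  have hdeg := congrArg natDegree heq
  rw [natDegree_mul ha0 (by simp [hx, hy, hsub, hadd]), natDegree_mul (by simp [hx, hy, hsub]) hadd,
    natDegree_mul (by simp [hx, hy]) hsub, natDegree_mul hx hy] at hdeg
  have hle : (x ^ 4 - x ^ 2 * y ^ 2 + y ^ 4 - C ξ).natDegree ≤ 4 * x.natDegree := by
    refine (natDegree_sub_le_of_le (natDegree_add_le_of_le (natDegree_sub_le_of_le
      (natDegree_pow_le (n := 4)) (natDegree_mul_le_of_le (natDegree_pow_le (n := 2))
      (natDegree_pow_le (n := 2)))) (natDegree_pow_le (n := 4))) (natDegree_C ξ).le).trans ?_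
    simp only [← hxy, max_le_iff]
    lia
  lia

/-- Fuchs–Jurasić–Paulin: the family of quartic Thue equations
`x(x-y)(x+y)(x-ay) + y⁴ = ξ` over `ℂ[T]`, with `ξ ∈ ℂ ∖ {0}` and `a` a
non-constant polynomial, has only the trivial solutions. -/
theorem fuchs_jurasic_paulin_quartic_function_field (ξ : ℂ) (hξ : ξ ≠ 0)
    (a : Polynomial ℂ) (ha : 0 < a.natDegree) :
    {p : Polynomial ℂ × Polynomial ℂ |
        p.1 * (p.1 - p.2) * (p.1 + p.2) * (p.1 - a * p.2) + p.2 ^ 4 = Polynomial.C ξ} =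
      {p | ∃ ζ : ℂ, ζ ^ 4 = ξ ∧
        (p = (Polynomial.C ζ, 0) ∨ p = (0, Polynomial.C ζ) ∨
         p = (Polynomial.C ζ, Polynomial.C ζ) ∨ p = (-Polynomial.C ζ, Polynomial.C ζ) ∨
         p = (Polynomial.C ζ * a, Polynomial.C ζ) ∨
         p = (-Polynomial.C ζ, Polynomial.C ζ * a))} := by
  ext ⟨x, y⟩
  simp only [Set.mem_ofPred_eq, Prod.mk.injEq]
  constructor
  · intro h
    by_cases hy : y = 0
    · subst hy
      obtain ⟨ζ, hζ, rfl⟩ := exists_eq_C_of_pow_four_eq (ξ := ξ) (p := x) (by rw [← h]; ring)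
      exact ⟨ζ, hζ, by simp⟩
    by_cases hx : x = 0
    · subst hx
      obtain ⟨ζ, hζ, rfl⟩ := exists_eq_C_of_pow_four_eq (ξ := ξ) (p := y) (by rw [← h]; ring)
      exact ⟨ζ, hζ, by simp⟩
    by_cases hsub : x - y = 0
    · obtain rfl := sub_eq_zero.1 hsub
      obtain ⟨ζ, hζ, rfl⟩ := exists_eq_C_of_pow_four_eq (ξ := ξ) (p := x) (by rw [← h]; ring)
      exact ⟨ζ, hζ, by simp⟩
    by_cases hadd : x + y = 0
    · obtain rfl := eq_neg_of_add_eq_zero_left hadd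
      obtain ⟨ζ, hζ, rfl⟩ := exists_eq_C_of_pow_four_eq (ξ := ξ) (p := y) (by rw [← h]; ring)
      exact ⟨ζ, hζ, by simp⟩
    rcases lt_trichotomy x.natDegree y.natDegree with hlt | heq | hlt
    · obtain ⟨ζ, hζ, h1, h2⟩ := exists_eq_of_natDegree_lt (x := -y) (y := x) hξ ha
        (by rw [← h]; ring) (by rwa [natDegree_neg]) hx
      refine ⟨-ζ, by rw [← hζ]; ring, ?_⟩
      have h3 : y = C (-ζ) * a := by rw [C_neg, neg_mul, ← h1, neg_neg]
      simp [h2, h3]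
    · exact absurd heq (natDegree_ne_natDegree hξ ha h hx hy hsub hadd)
    · obtain ⟨ζ, hζ, h1, h2⟩ := exists_eq_of_natDegree_lt hξ ha h hlt hy
      exact ⟨ζ, hζ, by simp [h1, h2]⟩
  · rintro ⟨ζ, rfl, h⟩
    rw [C_pow]
    rcases h with ⟨rfl, rfl⟩ | ⟨rfl, rfl⟩ | ⟨rfl, rfl⟩ | ⟨rfl, rfl⟩ | ⟨rfl, rfl⟩ | ⟨rfl, rfl⟩ <;>
      ring
end
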